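/- For every finite simple graph G, the following are equivalent: (1) G has spaghetti treewidth at most two; (2) every block of G is either a 2-connected graph whose cell completion is a chain tree of cycles, or a single edge, or an isolated vertex; (3) G has no minor isomorphic to K_4 or to D_3. -/

import Mathlib

open SimpleGraph

/-- The cycle graph on `ZMod n` (for `3 ≤ n` this is a cycle of length `n`). -/
def cycGraph (n : ℕ) : SimpleGraph (ZMod n) :=
  SimpleGraph.fromRel (fun x y => x = y + 1)

/-- The set `s` of nodes induces a path in the graph `H`. -/
def IsPathSet {ι : Type} (H : SimpleGraph ι) (s : Set ι) : Prop :=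
  (H.induce s).Connected ∧ ∀ x ∈ s, {y | y ∈ s ∧ H.Adj x y}.ncard ≤ 2

/-- The set `s` of nodes induces a directed path in `H` with respect to the
orientation `o` of the edges of `H`. -/
def IsDirPathSet {ι : Type} (H : SimpleGraph ι) (o : ι → ι → Prop) (s : Set ι) : Prop :=
  IsPathSet H s ∧ (∀ x ∈ s, {y | y ∈ s ∧ o x y}.ncard ≤ 1) ∧
    (∀ x ∈ s, {y | y ∈ s ∧ o y x}.ncard ≤ 1)

/-- A tree decomposition of a finite simple graph `G`. -/
structure TreeDecomp {V : Type} (G : SimpleGraph V) where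
  ι : Type
  finι : Finite ι
  tree : SimpleGraph ι
  isTree : tree.IsTree
  bag : ι → Set V
  bag_cover : ∀ v : V, ∃ x, v ∈ bag x
  bag_edge : ∀ ⦃u v : V⦄, G.Adj u v → ∃ x, u ∈ bag x ∧ v ∈ bag x
  bag_conn : ∀ v : V, (tree.induce {x | v ∈ bag x}).Connected

/-- A spaghetti tree decomposition: for every vertex `v` of `G`, the nodes whose
bags contain `v` induce a path in the tree. -/
structure SpaghettiTD {V : Type} (G : SimpleGraph V) extends TreeDecomp G where
  bag_path : ∀ v : V, IsPathSet tree {x | v ∈ bag x}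

/-- A directed spaghetti tree decomposition: the tree edges are oriented, and for
every vertex `v` of `G` the nodes whose bags contain `v` induce a directed path. -/
structure DirSpaghettiTD {V : Type} (G : SimpleGraph V) extends TreeDecomp G where
  orient : ι → ι → Prop
  orient_iff : ∀ x y : ι, tree.Adj x y ↔ (orient x y ∨ orient y x)
  orient_asymm : ∀ x y : ι, orient x y → ¬ orient y x
  bag_dirpath : ∀ v : V, IsDirPathSet tree orient {x | v ∈ bag x}

/-- A special tree decomposition: the tree is rooted, and for every vertex `v` of
`G` the nodes whose bags contain `v` induce a vertical path, i.e. a directed path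
with respect to the orientation of every tree edge towards the root. -/
structure SpecialTD {V : Type} (G : SimpleGraph V) extends TreeDecomp G where
  root : ι
  bag_vertical : ∀ v : V,
    IsDirPathSet tree (fun x y => tree.Adj x y ∧ tree.dist y root < tree.dist x root)
      {x | v ∈ bag x}

/-- A path decomposition of a finite simple graph `G`. -/
structure PathDecomp {V : Type} (G : SimpleGraph V) where
  m : ℕ
  hm : 0 < m
  bag : Fin m → Set V
  bag_cover : ∀ v : V, ∃ i, v ∈ bag i
  bag_edge : ∀ ⦃u v : V⦄, G.Adj u v → ∃ i, u ∈ bag i ∧ v ∈ bag i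
  bag_convex : ∀ (v : V) (i j k : Fin m), i ≤ j → j ≤ k → v ∈ bag i → v ∈ bag k → v ∈ bag j

/-- Treewidth: minimal width of a tree decomposition. -/
noncomputable def treewidth {V : Type} (G : SimpleGraph V) : ℕ :=
  sInf {k | ∃ td : TreeDecomp G, ∀ x, (td.bag x).ncard ≤ k + 1}

/-- Spaghetti treewidth: minimal width of a spaghetti tree decomposition. -/
noncomputable def sptw {V : Type} (G : SimpleGraph V) : ℕ :=
  sInf {k | ∃ td : SpaghettiTD G, ∀ x, (td.bag x).ncard ≤ k + 1}

/-- Directed spaghetti treewidth: minimal width of a directed spaghetti tree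
decomposition. -/
noncomputable def dptw {V : Type} (G : SimpleGraph V) : ℕ :=
  sInf {k | ∃ td : DirSpaghettiTD G, ∀ x, (td.bag x).ncard ≤ k + 1}

/-- Special treewidth: minimal width of a special tree decomposition. -/
noncomputable def spctw {V : Type} (G : SimpleGraph V) : ℕ :=
  sInf {k | ∃ td : SpecialTD G, ∀ x, (td.bag x).ncard ≤ k + 1}

/-- Pathwidth: minimal width of a path decomposition. -/
noncomputable def pw {V : Type} (G : SimpleGraph V) : ℕ :=
  sInf {k | ∃ pd : PathDecomp G, ∀ i, (pd.bag i).ncard ≤ k + 1}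

/-- A graph is chordal iff it has no induced (i.e. chordless) cycle of length at
least four. -/
def IsChordal {V : Type} (G : SimpleGraph V) : Prop :=
  ∀ (S : Set V) (n : ℕ), 4 ≤ n → ¬ Nonempty ((G.induce S) ≃g cycGraph n)

/-- A graph is strongly chordal if it is chordal and every even cycle of length at
least six has an odd chord: a chord splitting the cycle into two odd paths of
length at least three. -/
def IsStronglyChordal {V : Type} (G : SimpleGraph V) : Prop :=
  IsChordal G ∧ ∀ n : ℕ, 6 ≤ n → Even n → ∀ f : ZMod n → V,
    Function.Injective f → (∀ i : ZMod n, G.Adj (f i) (f (i + 1))) →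
      ∃ (i : ZMod n) (d : ℕ), Odd d ∧ 3 ≤ d ∧ d + 3 ≤ n ∧ G.Adj (f i) (f (i + (d : ZMod n)))

/-- Strongly chordal treewidth: the minimum of `ω(H) - 1` over all strongly chordal
supergraphs `H` of `G` (on the same vertex set; here `ω(H) ≤ k + 1` is expressed as
`H.CliqueFree (k + 2)`). -/
noncomputable def sctw {V : Type} (G : SimpleGraph V) : ℕ :=
  sInf {k | ∃ H : SimpleGraph V, G ≤ H ∧ IsStronglyChordal H ∧ H.CliqueFree (k + 2)}

/-- `H` is a minor of `G`: there is a family of nonempty, pairwise disjoint,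
connected branch sets in `G`, one for each vertex of `H`, such that every edge of
`H` is realized by an edge of `G` between the corresponding branch sets. -/
def IsMinorOf {W V : Type} (H : SimpleGraph W) (G : SimpleGraph V) : Prop :=
  ∃ f : W → Set V,
    (∀ w, (f w).Nonempty) ∧ (∀ w, (G.induce (f w)).Connected) ∧
    (Pairwise fun w w' => Disjoint (f w) (f w')) ∧
    ∀ ⦃w w'⦄, H.Adj w w' → ∃ u ∈ f w, ∃ v ∈ f w', G.Adj u v

/-- The complete graph on four vertices. -/
def K4 : SimpleGraph (Fin 4) := ⊤

/-- `D₃`: two vertices (`0` and `1`) joined by three internally vertex-disjoint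
paths of length three. -/
def D3 : SimpleGraph (Fin 8) := SimpleGraph.fromRel (fun x y =>
  (x = 0 ∧ y = 2) ∨ (x = 2 ∧ y = 3) ∨ (x = 3 ∧ y = 1) ∨
  (x = 0 ∧ y = 4) ∨ (x = 4 ∧ y = 5) ∨ (x = 5 ∧ y = 1) ∨
  (x = 0 ∧ y = 6) ∨ (x = 6 ∧ y = 7) ∨ (x = 7 ∧ y = 1))

/-- `S₃` (the 3-sun): a 6-cycle `0 1 2 3 4 5` together with the triangle `1 3 5`. -/
def S3 : SimpleGraph (Fin 6) := SimpleGraph.fromRel (fun x y =>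
  (x = 0 ∧ y = 1) ∨ (x = 1 ∧ y = 2) ∨ (x = 2 ∧ y = 3) ∨ (x = 3 ∧ y = 4) ∨
  (x = 4 ∧ y = 5) ∨ (x = 5 ∧ y = 0) ∨ (x = 1 ∧ y = 3) ∨ (x = 3 ∧ y = 5) ∨ (x = 5 ∧ y = 1))

/-- A graph is 2-connected if it has at least three vertices and deleting any one
vertex leaves it connected. -/
def TwoConnected {V : Type} (G : SimpleGraph V) : Prop :=
  3 ≤ Nat.card V ∧ ∀ v : V, (G.induce {x | x ≠ v}).Connected

/-- The cell completion of `G`: add an edge `vw` for every pair of (nonadjacent)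
vertices `v, w` such that deleting `v` and `w` leaves at least three connected
components. -/
def cellCompletion {V : Type} (G : SimpleGraph V) : SimpleGraph V :=
  SimpleGraph.fromRel (fun v w => G.Adj v w ∨
    3 ≤ Nat.card ((G.induce {x | x ≠ v ∧ x ≠ w}).ConnectedComponent))

/-- The induced subgraph of `G` on `S` has no cut vertex. -/
def NoCutVertex {V : Type} (G : SimpleGraph V) (S : Set V) : Prop :=
  ∀ v ∈ S, (S \ {v}).Nonempty → (G.induce (S \ {v})).Connected

/-- `S` carries a block of `G`: a maximal connected (induced) subgraph without a
cut vertex. -/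
def IsBlock {V : Type} (G : SimpleGraph V) (S : Set V) : Prop :=
  S.Nonempty ∧ (G.induce S).Connected ∧ NoCutVertex G S ∧
    ∀ S' : Set V, S ⊆ S' → (G.induce S').Connected → NoCutVertex G S' → S' = S

/-- Glue a cycle of length `n` onto the graph `G` by identifying the cycle edge
`{0, 1}` (with its end vertices) with the edge `{a, b}` of `G`. -/
def glueCycle {V : Type} (G : SimpleGraph V) (n : ℕ) (a b : V) :
    SimpleGraph (V ⊕ {x : ZMod n // x ≠ 0 ∧ x ≠ 1}) :=
  SimpleGraph.fromRel (fun p q =>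
    match p, q with
    | Sum.inl u, Sum.inl v => G.Adj u v
    | Sum.inl u, Sum.inr x => (u = a ∧ (cycGraph n).Adj 0 x.1) ∨ (u = b ∧ (cycGraph n).Adj 1 x.1)
    | Sum.inr x, Sum.inr y => (cycGraph n).Adj x.1 y.1
    | Sum.inr _, Sum.inl _ => False)

/-- The class of trees of cycles: every cycle is a tree of cycles, and gluing a
cycle onto a tree of cycles along an edge yields a tree of cycles (up to
isomorphism). -/
inductive IsTreeOfCycles : {V : Type} → SimpleGraph V → Prop
  | cycle {V : Type} (G : SimpleGraph V) (n : ℕ) (hn : 3 ≤ n)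
      (e : Nonempty (G ≃g cycGraph n)) : IsTreeOfCycles G
  | glue {V W : Type} (G : SimpleGraph V) (hG : IsTreeOfCycles G)
      (n : ℕ) (hn : 3 ≤ n) (a b : V) (hab : G.Adj a b)
      (H : SimpleGraph W) (e : Nonempty (H ≃g glueCycle G n a b)) : IsTreeOfCycles H

/-- `S` is the vertex set of a chordless cycle of `G`, i.e. it induces a cycle. -/
def IsChordlessCycle {V : Type} (G : SimpleGraph V) (S : Set V) : Prop :=
  ∃ n : ℕ, 3 ≤ n ∧ Nonempty ((G.induce S) ≃g cycGraph n)

/-- The edge `uv` is an edge separator: it lies in at least two distinct chordless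
cycles of `G`. -/
def IsEdgeSeparator {V : Type} (G : SimpleGraph V) (u v : V) : Prop :=
  G.Adj u v ∧ ∃ S₁ S₂ : Set V, S₁ ≠ S₂ ∧ IsChordlessCycle G S₁ ∧ IsChordlessCycle G S₂ ∧
    u ∈ S₁ ∧ v ∈ S₁ ∧ u ∈ S₂ ∧ v ∈ S₂

/-- `S` is a simplicial triangle of `G`: a chordless cycle on three vertices
containing a simplicial vertex of `G`. -/
def IsSimplicialTriangle {V : Type} (G : SimpleGraph V) (S : Set V) : Prop :=
  IsChordlessCycle G S ∧ S.ncard = 3 ∧ ∃ v ∈ S, G.IsClique (G.neighborSet v)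

/-- A chain tree of cycles: a tree of cycles in which every edge lies in at most two
chordless cycles that are not simplicial triangles (equivalently, if an edge lies in
`m ≥ 3` chordless cycles then at least `m - 2` of them are simplicial triangles). -/
def IsChainTreeOfCycles {V : Type} (G : SimpleGraph V) : Prop :=
  IsTreeOfCycles G ∧ ∀ u v : V, G.Adj u v →
    {S : Set V | IsChordlessCycle G S ∧ u ∈ S ∧ v ∈ S ∧ ¬ IsSimplicialTriangle G S}.ncard ≤ 2

/-- A tree of two-boundaried cycles: a tree of cycles in which every chordless
cycle contains at most two edge separators. -/
def IsTreeOfTwoBoundariedCycles {V : Type} (G : SimpleGraph V) : Prop :=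
  IsTreeOfCycles G ∧ ∀ S : Set V, IsChordlessCycle G S →
    {e : Sym2 V | ∃ u v : V, e = s(u, v) ∧ u ∈ S ∧ v ∈ S ∧ IsEdgeSeparator G u v}.ncard ≤ 2

/-- A path of cycles: a tree of cycles in which every chordless cycle contains at
most two edge separators and every edge lies in at most two chordless cycles that
are not simplicial triangles. -/
def IsPathOfCycles {V : Type} (G : SimpleGraph V) : Prop :=
  IsTreeOfCycles G ∧
    (∀ S : Set V, IsChordlessCycle G S →
      {e : Sym2 V | ∃ u v : V, e = s(u, v) ∧ u ∈ S ∧ v ∈ S ∧ IsEdgeSeparator G u v}.ncard ≤ 2) ∧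
    ∀ u v : V, G.Adj u v →
      {S : Set V | IsChordlessCycle G S ∧ u ∈ S ∧ v ∈ S ∧ ¬ IsSimplicialTriangle G S}.ncard ≤ 2

/-- The graph is a single edge. -/
def IsSingleEdgeGraph {V : Type} (G : SimpleGraph V) : Prop :=
  Nat.card V = 2 ∧ ∀ a b : V, a ≠ b → G.Adj a b

/-- A mamba: a 2-connected graph of pathwidth two, a single edge, or an isolated
vertex. -/
def IsMamba {V : Type} (G : SimpleGraph V) : Prop :=
  (TwoConnected G ∧ pw G = 2) ∨ IsSingleEdgeGraph G ∨ Nat.card V = 1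

/-- `v` is a head vertex of the mamba `G`: some path decomposition of `G` of width
at most two has `v` in its first bag. -/
def IsHeadVertex {V : Type} (G : SimpleGraph V) (v : V) : Prop :=
  ∃ pd : PathDecomp G, (∀ i, (pd.bag i).ncard ≤ 3) ∧ v ∈ pd.bag ⟨0, pd.hm⟩

/-- Glue the graph `M` onto the graph `G` by identifying the vertex `h` of `M` with
the vertex `x` of `G`. -/
def glueAtVertex {V W : Type} (G : SimpleGraph V) (x : V) (M : SimpleGraph W) (h : W) :
    SimpleGraph (V ⊕ {w : W // w ≠ h}) :=
  SimpleGraph.fromRel (fun p q =>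
    match p, q with
    | Sum.inl u, Sum.inl u' => G.Adj u u'
    | Sum.inl u, Sum.inr w => u = x ∧ M.Adj h w.1
    | Sum.inr w, Sum.inr w' => M.Adj w.1 w'.1
    | Sum.inr _, Sum.inl _ => False)

/-- The class of mamba trees: every mamba is a mamba tree, and gluing a mamba onto
a mamba tree by identifying a vertex of the mamba tree with a head vertex of the
mamba yields a mamba tree (up to isomorphism). -/
inductive IsMambaTree : {V : Type} → SimpleGraph V → Prop
  | mamba {V : Type} (G : SimpleGraph V) (hG : IsMamba G) : IsMambaTree G
  | glue {V W U : Type} (G : SimpleGraph V) (hG : IsMambaTree G)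
      (M : SimpleGraph W) (hM : IsMamba M) (x : V) (h : W) (hh : IsHeadVertex M h)
      (K : SimpleGraph U) (e : Nonempty (K ≃g glueAtVertex G x M h)) : IsMambaTree K

/-- Subdivide the edge `{a, b}` of `G` by a new vertex. -/
def subdivideEdge {V : Type} (G : SimpleGraph V) (a b : V) : SimpleGraph (V ⊕ Unit) :=
  SimpleGraph.fromRel (fun p q =>
    match p, q with
    | Sum.inl u, Sum.inl v => G.Adj u v ∧ ¬(u = a ∧ v = b) ∧ ¬(u = b ∧ v = a)
    | Sum.inl u, Sum.inr _ => u = a ∨ u = b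
    | Sum.inr _, _ => False)

/-- `H` is a subdivision of `G`: `H` is obtained from (an isomorphic copy of) `G`
by repeatedly subdividing edges. -/
inductive IsSubdivisionOf : {W V : Type} → SimpleGraph W → SimpleGraph V → Prop
  | base {V W : Type} {G : SimpleGraph V} {H : SimpleGraph W}
      (e : Nonempty (H ≃g G)) : IsSubdivisionOf H G
  | step {V W U : Type} {G : SimpleGraph V} {H : SimpleGraph W} (a b : W) (hab : H.Adj a b)
      (h : IsSubdivisionOf H G) {K : SimpleGraph U}
      (e : Nonempty (K ≃g subdivideEdge H a b)) : IsSubdivisionOf K G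

/-- Contract the edge `{a, b}` of `G` (the contracted vertex is `a`, `b` is removed). -/
def contractEdge {V : Type} (G : SimpleGraph V) (a b : V) : SimpleGraph {x : V // x ≠ b} :=
  SimpleGraph.fromRel (fun x y =>
    G.Adj x.1 y.1 ∨ (x.1 = a ∧ G.Adj b y.1) ∨ (y.1 = a ∧ G.Adj b x.1))

/-- A set `S` of vertices is connected in `G` if it is nonempty and every cut of `S` into two
nonempty parts is crossed by an edge. -/
def ConnSet {V : Type} (G : SimpleGraph V) (S : Set V) : Prop :=
  S.Nonempty ∧ ∀ A : Set V, (∃ x ∈ S, x ∈ A) → (∃ y ∈ S, y ∉ A) →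
    ∃ x ∈ S, x ∈ A ∧ ∃ y ∈ S, y ∉ A ∧ G.Adj x y

namespace ConnSet

variable {V : Type} {G : SimpleGraph V}

theorem iff_induce {S : Set V} : ConnSet G S ↔ (G.induce S).Connected := by
  constructor
  · rintro ⟨⟨v, hv⟩, h⟩
    have hpre : (G.induce S).Preconnected := by
      intro x y
      by_contra hxy
      obtain ⟨a, ha, ⟨ha', har⟩, b, hb, hb', hab⟩ :=
        h {z | ∃ hz : z ∈ S, (G.induce S).Reachable x ⟨z, hz⟩} ⟨x, x.2, x.2, Reachable.refl _⟩
          ⟨y, y.2, fun ⟨_, h⟩ => hxy h⟩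
      refine hb' ⟨hb, har.trans (Adj.reachable ?_)⟩
      exact hab
    have : Nonempty S := ⟨⟨v, hv⟩⟩
    exact ⟨hpre⟩
  · intro h
    obtain ⟨v⟩ := h.nonempty
    refine ⟨⟨v, v.2⟩, ?_⟩
    rintro A ⟨x, hx, hxA⟩ ⟨y, hy, hyA⟩
    obtain ⟨w⟩ := h.preconnected ⟨x, hx⟩ ⟨y, hy⟩
    obtain ⟨d, -, hd1, hd2⟩ := w.exists_boundary_dart {z | z.1 ∈ A} hxA hyA
    exact ⟨d.fst, d.fst.2, hd1, d.snd, d.snd.2, hd2, d.adj⟩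

theorem singleton (v : V) : ConnSet G {v} :=
  ⟨⟨v, rfl⟩, by
    rintro A ⟨x, rfl, hx⟩ ⟨y, rfl, hy⟩
    exact absurd hx hy⟩

theorem cross {S : Set V} (h : ConnSet G S) (A : Set V) {x y : V} (hx : x ∈ S) (hxA : x ∈ A)
    (hy : y ∈ S) (hyA : y ∉ A) : ∃ x ∈ S, x ∈ A ∧ ∃ y ∈ S, y ∉ A ∧ G.Adj x y :=
  h.2 A ⟨x, hx, hxA⟩ ⟨y, hy, hyA⟩

theorem mono {G' : SimpleGraph V} {S : Set V} (h : ConnSet G S)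
    (hle : ∀ x ∈ S, ∀ y ∈ S, G.Adj x y → G'.Adj x y) : ConnSet G' S :=
  ⟨h.1, fun A hA hA' => by
    obtain ⟨x, hx, hxA, y, hy, hyA, hxy⟩ := h.2 A hA hA'
    exact ⟨x, hx, hxA, y, hy, hyA, hle x hx y hy hxy⟩⟩

theorem union_of_inter {S T : Set V} (hS : ConnSet G S) (hT : ConnSet G T)
    (h : (S ∩ T).Nonempty) : ConnSet G (S ∪ T) := by
  obtain ⟨z, hzS, hzT⟩ := h
  refine ⟨⟨z, Or.inl hzS⟩, ?_⟩
  rintro A ⟨x, hx, hxA⟩ ⟨y, hy, hyA⟩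
  have key : ∀ R : Set V, R ⊆ S ∪ T → ConnSet G R → (∃ x ∈ R, x ∈ A) → (∃ y ∈ R, y ∉ A) →
      ∃ x ∈ S ∪ T, x ∈ A ∧ ∃ y ∈ S ∪ T, y ∉ A ∧ G.Adj x y := by
    intro R hR hc h1 h2
    obtain ⟨x, hx, hxA, y, hy, hyA, hxy⟩ := hc.2 A h1 h2
    exact ⟨x, hR hx, hxA, y, hR hy, hyA, hxy⟩
  by_cases hz : z ∈ A
  · rcases hy with hy | hy
    · exact key S (fun _ h => Or.inl h) hS ⟨z, hzS, hz⟩ ⟨y, hy, hyA⟩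
    · exact key T (fun _ h => Or.inr h) hT ⟨z, hzT, hz⟩ ⟨y, hy, hyA⟩
  · rcases hx with hx | hx
    · exact key S (fun _ h => Or.inl h) hS ⟨x, hx, hxA⟩ ⟨z, hzS, hz⟩
    · exact key T (fun _ h => Or.inr h) hT ⟨x, hx, hxA⟩ ⟨z, hzT, hz⟩

theorem pair {u v : V} (h : G.Adj u v) : ConnSet G {u, v} := by
  refine ⟨⟨u, by simp⟩, ?_⟩
  rintro A ⟨x, hx, hxA⟩ ⟨y, hy, hyA⟩
  refine ⟨x, hx, hxA, y, hy, hyA, ?_⟩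
  rcases hx with rfl | rfl <;> rcases hy with rfl | rfl
  · exact absurd hxA hyA
  · exact h
  · exact h.symm
  · exact absurd hxA hyA

theorem union_of_adj {S T : Set V} (hS : ConnSet G S) (hT : ConnSet G T) {u v : V}
    (hu : u ∈ S) (hv : v ∈ T) (h : G.Adj u v) : ConnSet G (S ∪ T) := by
  have h1 : ConnSet G (S ∪ {u, v}) := hS.union_of_inter (pair h) ⟨u, hu, by simp⟩
  have h2 := h1.union_of_inter hT ⟨v, by simp, hv⟩
  have : S ∪ {u, v} ∪ T = S ∪ T := by
    ext x
    simp only [Set.mem_union, Set.mem_insert_iff, Set.mem_singleton_iff]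
    constructor
    · rintro ((h | rfl | rfl) | h) <;> tauto
    · tauto
  rwa [this] at h2

theorem insert_of_adj {S : Set V} (hS : ConnSet G S) {u v : V} (hu : u ∈ S) (h : G.Adj v u) :
    ConnSet G (insert v S) := by
  rw [Set.insert_eq]
  exact (singleton v).union_of_adj hS rfl hu h

/-- Removing a part that is attached only to a clique leaves a connected set connected. -/
theorem diff_hanging {X R K : Set V} (hX : ConnSet G X) (hne : (X \ R).Nonempty)
    (hR : ∀ x ∈ R, ∀ y ∈ X \ R, G.Adj x y → y ∈ K)
    (hK : ∀ x ∈ K, ∀ y ∈ K, x ∈ X \ R → y ∈ X \ R → x ≠ y → G.Adj x y) : ConnSet G (X \ R) := by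
  refine ⟨hne, ?_⟩
  rintro A ⟨x, hx, hxA⟩ ⟨y, hy, hyA⟩
  by_contra hcon
  push Not at hcon
  by_cases hKA : ∃ k ∈ K, k ∈ X \ R ∧ k ∈ A
  · obtain ⟨k, hkK, hkX, hkA⟩ := hKA
    obtain ⟨p, hp, hpA, q, hq, hqA, hpq⟩ := hX.cross {z | z ∈ R ∨ z ∈ A} hx.1 (Or.inr hxA) hy.1
      (fun h => h.elim hy.2 hyA)
    simp only [Set.mem_ofPred_eq, not_or] at hqA
    by_cases hpR : p ∈ R
    · have hqK := hR p hpR q ⟨hq, hqA.1⟩ hpq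
      refine hcon k hkX hkA q ⟨hq, hqA.1⟩ hqA.2 (hK k hkK q hqK hkX ⟨hq, hqA.1⟩ ?_)
      rintro rfl
      exact hqA.2 hkA
    · exact hcon p ⟨hp, hpR⟩ (hpA.resolve_left hpR) q ⟨hq, hqA.1⟩ hqA.2 hpq
  · obtain ⟨p, hp, hpA, q, hq, hqA, hpq⟩ := hX.cross {z | z ∉ R ∧ z ∈ A} hx.1 ⟨hx.2, hxA⟩ hy.1
      (fun h => hyA h.2)
    by_cases hqR : q ∈ R
    · exact hKA ⟨p, hR q hqR p ⟨hp, hpA.1⟩ hpq.symm, ⟨hp, hpA.1⟩, hpA.2⟩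
    · exact hcon p ⟨hp, hpA.1⟩ hpA.2 q ⟨hq, hqR⟩ (fun h => hqA ⟨hqR, h⟩) hpq

/-- A union of connected sets through a common vertex is connected. -/
theorem union_of_mem {ι : Sort*} {P : ι → Prop} {f : ι → Set V} {v : V}
    (hf : ∀ i, P i → ConnSet G (f i)) (hv : ∀ i, P i → v ∈ f i) (hne : ∃ i, P i) :
    ConnSet G {x | ∃ i, P i ∧ x ∈ f i} := by
  obtain ⟨i0, h0⟩ := hne
  refine ⟨⟨v, i0, h0, hv i0 h0⟩, ?_⟩
  rintro A ⟨x, ⟨i, hi, hx⟩, hxA⟩ ⟨y, ⟨j, hj, hy⟩, hyA⟩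
  by_cases hvA : v ∈ A
  · obtain ⟨p, hp, hpA, q, hq, hqA, hpq⟩ := (hf j hj).cross A (hv j hj) hvA hy hyA
    exact ⟨p, ⟨j, hj, hp⟩, hpA, q, ⟨j, hj, hq⟩, hqA, hpq⟩
  · obtain ⟨p, hp, hpA, q, hq, hqA, hpq⟩ := (hf i hi).cross A hx hxA (hv i hi) hvA
    exact ⟨p, ⟨i, hi, hp⟩, hpA, q, ⟨i, hi, hq⟩, hqA, hpq⟩

theorem map {W : Type} {G' : SimpleGraph W} {S : Set V} (hS : ConnSet G S) (f : V → W)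
    (hf : ∀ x ∈ S, ∀ y ∈ S, G.Adj x y → f x ≠ f y → G'.Adj (f x) (f y)) :
    ConnSet G' (f '' S) := by
  refine ⟨hS.1.image f, ?_⟩
  rintro A ⟨_, ⟨x, hx, rfl⟩, hxA⟩ ⟨_, ⟨y, hy, rfl⟩, hyA⟩
  obtain ⟨p, hp, hpA, q, hq, hqA, hpq⟩ := hS.cross (f ⁻¹' A) hx hxA hy hyA
  exact ⟨f p, ⟨p, hp, rfl⟩, hpA, f q, ⟨q, hq, rfl⟩, hqA, hf p hp q hq hpq (by
    intro h
    simp only [Set.mem_preimage] at hpA hqA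
    exact hqA (h ▸ hpA))⟩

theorem of_image {W : Type} {G' : SimpleGraph W} {S : Set V} {f : V → W}
    (hS : ConnSet G' (f '' S)) (hinj : Function.Injective f)
    (hf : ∀ x ∈ S, ∀ y ∈ S, G'.Adj (f x) (f y) → G.Adj x y) : ConnSet G S := by
  refine ⟨Set.image_nonempty.1 hS.1, ?_⟩
  rintro A ⟨x, hx, hxA⟩ ⟨y, hy, hyA⟩
  obtain ⟨_, ⟨p, hp, rfl⟩, hpA, _, ⟨q, hq, rfl⟩, hqA, hpq⟩ :=
    hS.cross (f '' A) ⟨x, hx, rfl⟩ ⟨x, hxA, rfl⟩ ⟨y, hy, rfl⟩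
      (by rintro ⟨z, hz, hzy⟩; exact hyA (hinj hzy ▸ hz))
  refine ⟨p, hp, ?_, q, hq, fun h => hqA ⟨q, h, rfl⟩, hf p hp q hq hpq⟩
  obtain ⟨z, hz, hzp⟩ := hpA
  exact hinj hzp ▸ hz

theorem image_iff {W : Type} {G' : SimpleGraph W} (e : G ↪g G') {S : Set V} :
    ConnSet G' (e '' S) ↔ ConnSet G S :=
  ⟨fun h => h.of_image e.injective fun _ _ _ _ h => e.map_adj_iff.1 h,
    fun h => h.map e fun _ _ _ _ h _ => e.map_adj_iff.2 h⟩

theorem induce_iff {S : Set V} {T : Set S} :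
    ConnSet (G.induce S) T ↔ ConnSet G (Subtype.val '' T) :=
  (image_iff (Embedding.induce S)).symm

theorem univ_iff : ConnSet G Set.univ ↔ G.Connected :=
  iff_induce.trans (induceUnivIso G).connected_iff

end ConnSet

/-- The connected component of `x` in `G - Z`, as a set of vertices of `G`. -/
def compSet {V : Type} (G : SimpleGraph V) (Z : Set V) (x : V) : Set V :=
  {y | ∃ D : Set V, (ConnSet G D ∧ x ∈ D ∧ D ∩ Z = ∅) ∧ y ∈ D}

section compSet

variable {V : Type} {G : SimpleGraph V} {Z : Set V} {x : V}

theorem mem_compSet_self (hx : x ∉ Z) : x ∈ compSet G Z x :=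
  ⟨{x}, ⟨.singleton x, rfl, by ext z; simp; rintro rfl; exact hx⟩, rfl⟩

theorem connSet_compSet (hx : x ∉ Z) : ConnSet G (compSet G Z x) :=
  ConnSet.union_of_mem (v := x) (fun _ h => h.1) (fun _ h => h.2.1)
    ((mem_compSet_self (G := G) hx).imp fun _ h => h.1)

theorem notMem_of_mem_compSet {y : V} (hy : y ∈ compSet G Z x) : y ∉ Z := by
  obtain ⟨D, ⟨-, -, h⟩, hyD⟩ := hy
  intro hyZ
  exact (h ▸ (⟨hyD, hyZ⟩ : y ∈ D ∩ Z) : y ∈ (∅ : Set V))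

theorem subset_compSet {D : Set V} (hD : ConnSet G D) (hDZ : ∀ y ∈ D, y ∉ Z) {y : V}
    (hyD : y ∈ D) (hy : y ∈ compSet G Z x) : D ⊆ compSet G Z x := by
  obtain ⟨D', ⟨hc, hx, hZ⟩, hyD'⟩ := hy
  intro z hz
  refine ⟨D' ∪ D, ⟨hc.union_of_inter hD ⟨y, hyD', hyD⟩, Or.inl hx, ?_⟩, Or.inr hz⟩
  rw [Set.union_inter_distrib_right, hZ, Set.empty_union]
  ext w
  simp only [Set.mem_inter_iff, Set.mem_empty_iff_false, iff_false, not_and]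
  exact hDZ w

theorem mem_compSet_of_adj {y z : V} (hy : y ∈ compSet G Z x) (h : G.Adj y z) (hz : z ∉ Z) :
    z ∈ compSet G Z x := by
  refine subset_compSet (ConnSet.pair h) ?_ (by simp) hy (by simp)
  rintro w (rfl | rfl)
  · exact notMem_of_mem_compSet hy
  · exact hz

end compSet

/-- There is an edge between the vertex sets `A` and `B`. -/
def Touch {V : Type} (G : SimpleGraph V) (A B : Set V) : Prop :=
  ∃ u ∈ A, ∃ v ∈ B, G.Adj u v

theorem Touch.symm {V : Type} {G : SimpleGraph V} {A B : Set V} (h : Touch G A B) :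
    Touch G B A := by
  obtain ⟨u, hu, v, hv, h⟩ := h
  exact ⟨v, hv, u, hu, h.symm⟩

section

variable {V : Type} {G : SimpleGraph V}

theorem isMinorOf_iff {W : Type} {H : SimpleGraph W} :
    IsMinorOf H G ↔ ∃ f : W → Set V, (∀ w, ConnSet G (f w)) ∧
      (∀ w w' x, x ∈ f w → x ∈ f w' → w = w') ∧ ∀ w w', H.Adj w w' → Touch G (f w) (f w') := by
  constructor
  · rintro ⟨f, -, hc, hd, ht⟩
    refine ⟨f, fun w => ConnSet.iff_induce.2 (hc w), fun w w' x hx hx' => ?_, fun w w' h => ht h⟩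
    by_contra hne
    exact Set.disjoint_left.1 (hd hne) hx hx'
  · rintro ⟨f, hc, hd, ht⟩
    refine ⟨f, fun w => (hc w).1, fun w => ConnSet.iff_induce.1 (hc w), fun w w' hne => ?_,
      fun w w' h => ht w w' h⟩
    exact Set.disjoint_left.2 fun x hx hx' => hne (hd w w' x hx hx')

theorem IsMinorOf.of_embedding {W U : Type} {H : SimpleGraph W} {G' : SimpleGraph U}
    (h : IsMinorOf H G) (e : G ↪g G') : IsMinorOf H G' := by
  rw [isMinorOf_iff] at h ⊢
  obtain ⟨f, hc, hd, ht⟩ := h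
  refine ⟨fun w => e '' f w, fun w => (ConnSet.image_iff e).2 (hc w), ?_, ?_⟩
  · rintro w w' _ ⟨x, hx, rfl⟩ ⟨y, hy, hyx⟩
    rw [e.injective hyx] at hy
    exact hd w w' x hx hy
  · intro w w' hww
    obtain ⟨u, hu, v, hv, huv⟩ := ht w w' hww
    exact ⟨e u, ⟨u, hu, rfl⟩, e v, ⟨v, hv, rfl⟩, e.map_adj_iff.2 huv⟩

theorem isMinorOf_K4_of_sets {A B C D : Set V} (hA : ConnSet G A) (hB : ConnSet G B)
    (hC : ConnSet G C) (hD : ConnSet G D) (dAB : Disjoint A B) (dAC : Disjoint A C)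
    (dAD : Disjoint A D) (dBC : Disjoint B C) (dBD : Disjoint B D) (dCD : Disjoint C D)
    (tAB : Touch G A B) (tAC : Touch G A C) (tAD : Touch G A D) (tBC : Touch G B C)
    (tBD : Touch G B D) (tCD : Touch G C D) : IsMinorOf K4 G := by
  rw [isMinorOf_iff]
  refine ⟨![A, B, C, D], ?_, ?_, ?_⟩
  · intro w
    fin_cases w <;> assumption
  · intro w w' x hx hx'
    by_contra hne
    rw [Set.disjoint_left] at *
    fin_cases w <;> fin_cases w' <;> simp at * <;> tauto
  · intro w w' hww
    have := hww.ne
    fin_cases w <;> fin_cases w' <;> first | exact absurd rfl this | assumption | (apply Touch.symm; assumption)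

theorem isMinorOf_D3_of_sets {u v : V} {P Q : Fin 3 → Set V} (huv : u ≠ v)
    (hP : ∀ i, ConnSet G (P i)) (hQ : ∀ i, ConnSet G (Q i))
    (huP : ∀ i, u ∉ P i) (huQ : ∀ i, u ∉ Q i) (hvP : ∀ i, v ∉ P i) (hvQ : ∀ i, v ∉ Q i)
    (dPQ : ∀ i x, x ∈ P i → x ∉ Q i)
    (d : ∀ i j x, x ∈ P i ∪ Q i → x ∈ P j ∪ Q j → i = j)
    (tu : ∀ i, Touch G {u} (P i)) (tPQ : ∀ i, Touch G (P i) (Q i))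
    (tv : ∀ i, Touch G (Q i) {v}) : IsMinorOf D3 G := by
  rw [isMinorOf_iff]
  refine ⟨![{u}, {v}, P 0, Q 0, P 1, Q 1, P 2, Q 2], ?_, ?_, ?_⟩
  · intro w
    fin_cases w <;> first | exact hP _ | exact hQ _ | exact ConnSet.singleton _
  · have dPP : ∀ i j x, x ∈ P i → x ∈ P j → i = j := fun i j x h h' => d i j x (Or.inl h) (Or.inl h')
    have dQQ : ∀ i j x, x ∈ Q i → x ∈ Q j → i = j := fun i j x h h' => d i j x (Or.inr h) (Or.inr h')
    have dPQ' : ∀ i j x, x ∈ P i → x ∉ Q j := fun i j x h h' => by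
      obtain rfl := d i j x (Or.inl h) (Or.inr h')
      exact dPQ i x h h'
    intro w w' x hx hx'
    have h01 : (0 : Fin 3) ≠ 1 := by decide
    have h02 : (0 : Fin 3) ≠ 2 := by decide
    have h12 : (1 : Fin 3) ≠ 2 := by decide
    fin_cases w <;> fin_cases w' <;>
      simp only [Fin.zero_eta, Fin.mk_one, Fin.reduceFinMk, Matrix.cons_val, Matrix.cons_val_zero,
        Matrix.cons_val_one, Set.mem_singleton_iff] at hx hx' ⊢ <;>
      first
      | rfl
      | (exfalso
         subst hx
         first
         | exact huv hx' | exact huv hx'.symm | exact huP _ hx'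
         | exact huQ _ hx' | exact hvP _ hx' | exact hvQ _ hx')
      | (exfalso
         subst hx'
         first
         | exact huP _ hx | exact huQ _ hx | exact hvP _ hx
         | exact hvQ _ hx)
      | (exfalso; first | exact dPQ' _ _ _ hx hx' | exact dPQ' _ _ _ hx' hx)
      | (exfalso
         first
         | exact h01 (dPP _ _ _ hx hx') | exact h02 (dPP _ _ _ hx hx')
         | exact h12 (dPP _ _ _ hx hx') | exact h01 (dPP _ _ _ hx' hx)
         | exact h02 (dPP _ _ _ hx' hx) | exact h12 (dPP _ _ _ hx' hx))
      | (exfalso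
         first
         | exact h01 (dQQ _ _ _ hx hx') | exact h02 (dQQ _ _ _ hx hx')
         | exact h12 (dQQ _ _ _ hx hx') | exact h01 (dQQ _ _ _ hx' hx)
         | exact h02 (dQQ _ _ _ hx' hx) | exact h12 (dQQ _ _ _ hx' hx))
  · have key : ∀ w w' : Fin 8, ((w = 0 ∧ w' = 2) ∨ (w = 2 ∧ w' = 3) ∨ (w = 3 ∧ w' = 1) ∨
        (w = 0 ∧ w' = 4) ∨ (w = 4 ∧ w' = 5) ∨ (w = 5 ∧ w' = 1) ∨
        (w = 0 ∧ w' = 6) ∨ (w = 6 ∧ w' = 7) ∨ (w = 7 ∧ w' = 1)) →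
        Touch G ((![{u}, {v}, P 0, Q 0, P 1, Q 1, P 2, Q 2] : Fin 8 → Set V) w)
          ((![{u}, {v}, P 0, Q 0, P 1, Q 1, P 2, Q 2] : Fin 8 → Set V) w') := by
      rintro w w' (⟨rfl, rfl⟩ | ⟨rfl, rfl⟩ | ⟨rfl, rfl⟩ | ⟨rfl, rfl⟩ | ⟨rfl, rfl⟩ | ⟨rfl, rfl⟩ |
        ⟨rfl, rfl⟩ | ⟨rfl, rfl⟩ | ⟨rfl, rfl⟩) <;>
        first | exact tu _ | exact tPQ _ | exact tv _
    rintro w w' ⟨-, h | h⟩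
    · exact key w w' h
    · exact (key w' w h).symm

theorem exists_noncut [Finite V] {S : Set V} (hS : ConnSet G S) {x : V} (hx : x ∈ S)
    {y : V} (hy : y ∈ S) (hxy : y ≠ x) : ∃ z ∈ S, z ≠ x ∧ ConnSet G (S \ {z}) := by
  obtain ⟨D, -, ⟨hD, hxD, hDS, w, hwS, hwD⟩, hmax⟩ := Set.Finite.exists_le_maximal
    (s := {D : Set V | ConnSet G D ∧ x ∈ D ∧ D ⊆ S ∧ ∃ w ∈ S, w ∉ D}) (Set.toFinite _)
    (a := {x}) ⟨.singleton x, rfl, by simpa using hx, y, hy, hxy⟩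
  obtain ⟨p, hp, hpD, q, hq, hqD, hpq⟩ := hS.cross D hx hxD hwS hwD
  refine ⟨q, hq, fun h => hqD (h ▸ hxD), ?_⟩
  have hins : ConnSet G (insert q D) := hD.insert_of_adj hpD hpq.symm
  have : S \ {q} = D := by
    ext z
    simp only [Set.mem_sdiff, Set.mem_singleton_iff]
    constructor
    · rintro ⟨hz, hzq⟩
      by_contra hzD
      refine hqD (hmax (y := insert q D) ⟨hins, Or.inr hxD, Set.insert_subset hq hDS, z, hz, ?_⟩
        (Set.subset_insert _ _) (Or.inl rfl))
      rintro (h | h)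
      · exact hzq h
      · exact hzD h
    · intro hz
      exact ⟨hDS hz, fun h => hqD (h ▸ hz)⟩
  rwa [this]

/-- Three vertices of a connected set can be joined to a common vertex by disjoint connected
sets. -/
theorem exists_median [Finite V] {S : Set V} (hS : ConnSet G S) (u : Fin 3 → V)
    (hu : ∀ i, u i ∈ S) :
    ∃ d ∈ S, ∃ I : Fin 3 → Set V, (∀ i, I i ⊆ S \ {d}) ∧
      (∀ i j x, x ∈ I i → x ∈ I j → i = j) ∧
      ∀ i, (u i = d ∧ I i = ∅) ∨ (u i ∈ I i ∧ ConnSet G (I i) ∧ ∃ x ∈ I i, G.Adj d x) := by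
  induction hn : S.ncard using Nat.strong_induction_on generalizing S u with
  | _ n ih =>
  by_cases hsub : ∀ y ∈ S, y = u 0
  · refine ⟨u 0, hu 0, fun _ => ∅, by simp, by simp, fun i => Or.inl ⟨hsub _ (hu i), rfl⟩⟩
  push Not at hsub
  obtain ⟨y, hy, hyu⟩ := hsub
  obtain ⟨z, hz, hzu, hzc⟩ := exists_noncut hS (hu 0) hy hyu
  obtain ⟨z', hz', hzz, hzc'⟩ := exists_noncut hS hz (hu 0) hzu.symm
  have main : ∀ z ∈ S, ConnSet G (S \ {z}) → (∀ i j, u i = z → u j = z → i = j) →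
      ∃ d ∈ S, ∃ I : Fin 3 → Set V, (∀ i, I i ⊆ S \ {d}) ∧
      (∀ i j x, x ∈ I i → x ∈ I j → i = j) ∧
      ∀ i, (u i = d ∧ I i = ∅) ∨ (u i ∈ I i ∧ ConnSet G (I i) ∧ ∃ x ∈ I i, G.Adj d x) := by
    intro z hz hzc hzi
    have hlt : (S \ {z}).ncard < n := hn ▸ Set.ncard_sdiff_singleton_lt_of_mem hz
    by_cases hi : ∃ i, u i = z
    · obtain ⟨i, hi⟩ := hi
      obtain ⟨w, hw⟩ := hzc.1
      obtain ⟨z0, -, hz0, q, hq, hqz, hpq⟩ := hS.cross {z} hz rfl hw.1 hw.2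
      rw [Set.mem_singleton_iff] at hz0
      rw [hz0] at hpq
      obtain ⟨d, hd, I, hI, hdis, h⟩ := ih _ hlt hzc (Function.update u i q) (by
        intro j
        by_cases hji : j = i
        · subst hji; simpa using ⟨hq, hqz⟩
        · rw [Function.update_of_ne hji]
          exact ⟨hu j, fun hj => hji (hzi j i hj hi)⟩) rfl
      have hzI : ∀ j, ∀ x ∈ I j, x ≠ z := fun j x hx => ((hI j) hx).1.2
      refine ⟨d, hd.1, Function.update I i (insert z (I i)), ?_, ?_, ?_⟩
      · intro j
        by_cases hji : j = i
        · subst hji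
          rw [Function.update_self]
          refine Set.insert_subset ⟨hz, fun h => hd.2 h.symm⟩ ?_
          exact fun x hx => ⟨((hI _) hx).1.1, ((hI _) hx).2⟩
        · rw [Function.update_of_ne hji]
          exact fun x hx => ⟨((hI _) hx).1.1, ((hI _) hx).2⟩
      · intro j k x hj hk
        by_cases hji : j = i <;> by_cases hki : k = i
        · rw [hji, hki]
        · subst hji
          rw [Function.update_self] at hj
          rw [Function.update_of_ne hki] at hk
          rcases hj with rfl | hj
          · exact absurd rfl (hzI _ _ hk)
          · exact hdis _ _ x hj hk
        · subst hki
          rw [Function.update_self] at hk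
          rw [Function.update_of_ne hji] at hj
          rcases hk with rfl | hk
          · exact absurd rfl (hzI _ _ hj)
          · exact hdis _ _ x hj hk
        · rw [Function.update_of_ne hki] at hk
          rw [Function.update_of_ne hji] at hj
          exact hdis _ _ x hj hk
      · intro j
        by_cases hji : j = i
        · subst hji
          right
          have := h j
          rw [Function.update_self] at this ⊢
          rcases this with ⟨rfl, h0⟩ | ⟨h1, h2, x, hx, hxd⟩
          · rw [h0]
            simp only [insert_empty_eq]
            refine ⟨hi, .singleton _, _, rfl, hpq.symm⟩
          · exact ⟨Or.inl hi, h2.insert_of_adj h1 hpq, x, Or.inr hx, hxd⟩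
        · have := h j
          rw [Function.update_of_ne hji] at this ⊢
          exact this
    · obtain ⟨d, hd, I, hI, hdis, h⟩ := ih _ hlt hzc u (fun i => ⟨hu i, fun h => hi ⟨i, h⟩⟩) rfl
      exact ⟨d, hd.1, I, fun i x hx => ⟨((hI i) hx).1.1, ((hI i) hx).2⟩, hdis, h⟩
  by_cases h1 : ∀ i j, u i = z → u j = z → i = j
  · exact main z hz hzc h1
  · refine main z' hz' hzc' ?_
    push Not at h1
    obtain ⟨i, j, hi, hj, hij⟩ := h1
    intro k l hk hl
    have hki : k ≠ i := fun h => hzz (by rw [← hk, h, hi])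
    have hkj : k ≠ j := fun h => hzz (by rw [← hk, h, hj])
    have hli : l ≠ i := fun h => hzz (by rw [← hl, h, hi])
    have hlj : l ≠ j := fun h => hzz (by rw [← hl, h, hj])
    omega

end

section AcyclicSets

variable {ι : Type} {T : SimpleGraph ι}

theorem ConnSet.exists_path {S : Set ι} (hS : ConnSet T S) {x y : ι} (hx : x ∈ S) (hy : y ∈ S) :
    ∃ p : T.Path x y, ∀ z ∈ p.1.support, z ∈ S := by
  classical
  obtain ⟨p⟩ := (ConnSet.iff_induce.1 hS).preconnected ⟨x, hx⟩ ⟨y, hy⟩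
  refine ⟨(p.toPath.mapEmbedding (Embedding.induce S) :), ?_⟩
  intro z hz
  have hz' : z ∈ (p.toPath.1.map (Embedding.induce (G := T) S).toHom).support := hz
  rw [Walk.support_map, List.mem_map] at hz'
  obtain ⟨w, -, rfl⟩ := hz'
  exact w.2

theorem ConnSet.inter_of_isAcyclic (hT : T.IsAcyclic) {S S' : Set ι} (hS : ConnSet T S)
    (hS' : ConnSet T S') (hne : (S ∩ S').Nonempty) : ConnSet T (S ∩ S') := by
  refine ⟨hne, ?_⟩
  rintro A ⟨x, hx, hxA⟩ ⟨y, hy, hyA⟩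
  obtain ⟨p, hp⟩ := hS.exists_path hx.1 hy.1
  obtain ⟨p', hp'⟩ := hS'.exists_path hx.2 hy.2
  obtain rfl := (hT.subsingleton_path x y).elim p p'
  obtain ⟨d, hd, hd1, hd2⟩ := p.1.exists_boundary_dart A hxA hyA
  have h1 := p.1.dart_fst_mem_support_of_mem_darts hd
  have h2 := p.1.dart_snd_mem_support_of_mem_darts hd
  exact ⟨d.fst, ⟨hp _ h1, hp' _ h1⟩, hd1, d.snd, ⟨hp _ h2, hp' _ h2⟩, hd2, d.adj⟩

/-- Every edge of an acyclic graph is the only edge of some cut. -/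
theorem SimpleGraph.IsAcyclic.exists_cut (hT : T.IsAcyclic) {s t : ι} (h : T.Adj s t) :
    ∃ L : Set ι, s ∈ L ∧ t ∉ L ∧ ∀ x ∈ L, ∀ y, y ∉ L → T.Adj x y → x = s ∧ y = t := by
  have hb := isAcyclic_iff_forall_adj_isBridge.1 hT h
  rw [isBridge_iff] at hb
  refine ⟨{x | (T.deleteEdges {s(s, t)}).Reachable s x}, Reachable.refl _, hb, ?_⟩
  intro x hx y hy hxy
  by_contra hne
  have key : s(x, y) = s(s, t) := by
    by_contra hne'
    refine hy (Reachable.trans hx (Adj.reachable ?_))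
    rw [deleteEdges_adj]
    exact ⟨hxy, hne'⟩
  rw [Sym2.eq_iff] at key
  rcases key with key | ⟨rfl, rfl⟩
  · exact hne key
  · exact hb hx

theorem ConnSet.subset_or_of_cut {S L : Set ι} (hS : ConnSet T S) {s t : ι}
    (hL : ∀ x ∈ L, ∀ y, y ∉ L → T.Adj x y → x = s ∧ y = t) (hst : ¬ (s ∈ S ∧ t ∈ S)) :
    S ⊆ L ∨ ∀ x ∈ S, x ∉ L := by
  by_contra! hcon
  obtain ⟨h1, x, hx, hxL⟩ := hcon
  obtain ⟨y, hy, hyL⟩ := Set.not_subset.1 h1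
  obtain ⟨p, hp, hpL, q, hq, hqL, hpq⟩ := hS.cross L hx hxL hy hyL
  obtain ⟨rfl, rfl⟩ := hL p hpL q hqL hpq
  exact hst ⟨hp, hq⟩

/-- The Helly property for three subtrees. -/
theorem ConnSet.helly_three (hT : T.IsAcyclic) {A B C : Set ι} (hA : ConnSet T A)
    (hB : ConnSet T B) (hC : ConnSet T C) (hAB : (A ∩ B).Nonempty) (hAC : (A ∩ C).Nonempty)
    (hBC : (B ∩ C).Nonempty) : (A ∩ B ∩ C).Nonempty := by
  by_contra hcon
  have hno : ∀ x, x ∈ A → x ∈ B → x ∉ C := fun x h1 h2 h3 => hcon ⟨x, ⟨h1, h2⟩, h3⟩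
  obtain ⟨x, hxA, hxB⟩ := hAB
  obtain ⟨y, hyA, hyC⟩ := hAC
  have hI := hA.inter_of_isAcyclic hT (hB.union_of_inter hC hBC) ⟨x, hxA, Or.inl hxB⟩
  obtain ⟨s, hs, hsB, t, ht, htB, hst⟩ := hI.cross B ⟨hxA, Or.inl hxB⟩ hxB ⟨hyA, Or.inr hyC⟩
    (fun h => hno y hyA h hyC)
  obtain ⟨L, hsL, htL, hL⟩ := hT.exists_cut hst
  obtain ⟨z, hzB, hzC⟩ := hBC
  have h1 : z ∈ L := (hB.subset_or_of_cut hL (fun h => htB h.2)).elim (fun h => h hzB)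
    (fun h => absurd hsL (h s hsB))
  have h2 : z ∉ L := (hC.subset_or_of_cut hL (fun h => hno s hs.1 hsB h.1)).elim
    (fun h => absurd (h (ht.2.resolve_left htB)) htL) (fun h => h z hzC)
  exact h2 h1

theorem ConnSet.helly_four (hT : T.IsAcyclic) {A : Fin 4 → Set ι} (hA : ∀ i, ConnSet T (A i))
    (h : ∀ i j, i < j → (A i ∩ A j).Nonempty) : ∃ x, ∀ i, x ∈ A i := by
  have h3 : ∀ i j, i < j → j < 3 → ((A i ∩ A 3) ∩ (A j ∩ A 3)).Nonempty := by
    intro i j hij hj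
    obtain ⟨x, ⟨h1, h2⟩, h3⟩ := (hA i).helly_three hT (hA j) (hA 3) (h i j hij)
      (h i 3 (hij.trans hj)) (h j 3 hj)
    exact ⟨x, ⟨h1, h3⟩, h2, h3⟩
  have hc : ∀ i, i < 3 → ConnSet T (A i ∩ A 3) := fun i hi =>
    (hA i).inter_of_isAcyclic hT (hA 3) (h i 3 hi)
  obtain ⟨x, ⟨⟨h0, h3'⟩, h1, -⟩, h2, -⟩ := (hc 0 (by decide)).helly_three hT (hc 1 (by decide))
    (hc 2 (by decide)) (h3 0 1 (by decide) (by decide)) (h3 0 2 (by decide) (by decide))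
    (h3 1 2 (by decide) (by decide))
  refine ⟨x, fun i => ?_⟩
  fin_cases i <;> assumption

end AcyclicSets

namespace TreeDecomp

variable {V : Type} {G : SimpleGraph V} (D : TreeDecomp G)

/-- The nodes whose bags meet `X`. -/
def nodes (X : Set V) : Set D.ι := {t | ∃ v ∈ X, v ∈ D.bag t}

theorem connSet_nodes_singleton (v : V) : ConnSet D.tree (D.nodes {v}) := by
  rw [ConnSet.iff_induce]
  have : D.nodes {v} = {x | v ∈ D.bag x} := by
    ext t
    simp [nodes]
  rw [this]
  exact D.bag_conn v

theorem mem_nodes_singleton {v : V} {t : D.ι} : t ∈ D.nodes {v} ↔ v ∈ D.bag t := by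
  simp [nodes]

theorem connSet_nodes {X : Set V} (hX : ConnSet G X) : ConnSet D.tree (D.nodes X) := by
  obtain ⟨v, hv⟩ := hX.1
  obtain ⟨t, ht⟩ := D.bag_cover v
  refine ⟨⟨t, v, hv, ht⟩, ?_⟩
  rintro A ⟨t, ⟨x, hx, hxt⟩, htA⟩ ⟨t', ⟨x', hx', hxt'⟩, htA'⟩
  by_contra! hcon
  have h1 : ∀ u ∈ X, ∀ s s', u ∈ D.bag s → u ∈ D.bag s' → s ∈ A → s' ∈ A := by
    intro u hu s s' hs hs' hsA
    by_contra hsA'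
    obtain ⟨p, hp, hpA, q, hq, hqA, hpq⟩ := (D.connSet_nodes_singleton u).cross A
      (D.mem_nodes_singleton.2 hs) hsA (D.mem_nodes_singleton.2 hs') hsA'
    exact hcon p ⟨u, hu, D.mem_nodes_singleton.1 hp⟩ hpA q ⟨u, hu, D.mem_nodes_singleton.1 hq⟩
      hqA hpq
  obtain ⟨p, hp, ⟨s, hsA, hs⟩, q, hq, hqA, hpq⟩ := hX.cross {u | ∃ s ∈ A, u ∈ D.bag s} hx
    ⟨t, htA, hxt⟩ hx' (fun ⟨s, hs, hxs⟩ => htA' (h1 x' hx' s t' hxs hxt' hs))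
  obtain ⟨r, hpr, hqr⟩ := D.bag_edge hpq
  exact hqA ⟨r, h1 p hp s r hs hpr hsA, hqr⟩

theorem nodes_inter_nonempty {X Y : Set V} (h : Touch G X Y) : (D.nodes X ∩ D.nodes Y).Nonempty := by
  obtain ⟨u, hu, v, hv, h⟩ := h
  obtain ⟨t, h1, h2⟩ := D.bag_edge h
  exact ⟨t, ⟨u, hu, h1⟩, v, hv, h2⟩

theorem bag_of_four (hw : ∀ x, (D.bag x).ncard ≤ 3) [Finite V] {t : D.ι} {a b c d : V}
    (ha : a ∈ D.bag t) (hb : b ∈ D.bag t) (hc : c ∈ D.bag t) (hd : d ∈ D.bag t) (hab : a ≠ b)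
    (hac : a ≠ c) (had : a ≠ d) (hbc : b ≠ c) (hbd : b ≠ d) : c = d := by
  by_contra hcd
  have h4 : ({a, b, c, d} : Set V).ncard = 4 := by
    rw [Set.ncard_insert_of_notMem (by simp; tauto), Set.ncard_insert_of_notMem (by simp; tauto),
      Set.ncard_pair hcd]
  have := Set.ncard_le_ncard (s := {a, b, c, d}) (t := D.bag t)
    (by rintro x (rfl | rfl | rfl | rfl) <;> assumption) (Set.toFinite _)
  have := hw t
  omega

theorem not_isMinorOf_K4 [Finite V] (hw : ∀ x, (D.bag x).ncard ≤ 3) : ¬ IsMinorOf K4 G := by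
  rw [isMinorOf_iff]
  rintro ⟨f, hc, hd, ht⟩
  obtain ⟨t, h⟩ := ConnSet.helly_four D.isTree.isAcyclic (fun i => D.connSet_nodes (hc i))
    (fun i j hij => D.nodes_inter_nonempty (ht i j hij.ne))
  choose v hv hvt using h
  have hne : ∀ i j, i ≠ j → v i ≠ v j := fun i j hij h => hij (hd i j _ (hv i) (h ▸ hv j))
  exact hne 2 3 (by decide) (D.bag_of_four hw (hvt 0) (hvt 1) (hvt 2) (hvt 3)
    (hne _ _ (by decide)) (hne _ _ (by decide)) (hne _ _ (by decide)) (hne _ _ (by decide))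
    (hne _ _ (by decide)))

end TreeDecomp

theorem exists_three_of_isMinorOf_D3 {V : Type} [Finite V] {G : SimpleGraph V}
    (h : IsMinorOf D3 G) : ∃ (x y : V) (A : Fin 3 → Set V), x ≠ y ∧ (∀ i, ConnSet G (A i)) ∧
      (∀ i j z, z ∈ A i → z ∈ A j → i = j) ∧ (∀ i, x ∉ A i ∧ y ∉ A i) ∧
      ∀ i, ∃ b ∈ A i, ∃ c ∈ A i, b ≠ c ∧ G.Adj x b ∧ G.Adj y c := by
  rw [isMinorOf_iff] at h
  obtain ⟨f, hc, hd, ht⟩ := h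
  have half : ∀ (r : Fin 8) (m : Fin 3 → Fin 8), (∀ i, D3.Adj r (m i)) → ∃ x ∈ f r,
      ∃ P : Fin 3 → Set V, (∀ i, ConnSet G (P i)) ∧ (∀ i, f (m i) ⊆ P i) ∧
      (∀ i, P i ⊆ f (m i) ∪ (f r \ {x})) ∧ (∀ i j z, z ∈ P i → z ∈ P j → z ∈ f r → i = j) ∧
      ∀ i, ∃ b ∈ P i, G.Adj x b := by
    intro r m hm
    choose u hu v hv huv using fun i => ht r (m i) (hm i)
    obtain ⟨x, hx, I, hI, hdis, h⟩ := exists_median (hc r) u hu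
    have hmr : ∀ i z, z ∈ f (m i) → z ∉ f r := fun i z h1 h2 => (hm i).ne (hd _ _ z h2 h1)
    refine ⟨x, hx, fun i => f (m i) ∪ I i, ?_, fun i => Set.subset_union_left, ?_, ?_, ?_⟩
    · intro i
      rcases h i with ⟨-, h0⟩ | ⟨h1, h2, -⟩
      · simpa only [h0, Set.union_empty] using hc (m i)
      · exact (hc (m i)).union_of_adj h2 (hv i) h1 (huv i).symm
    · exact fun i => Set.union_subset_union_right _ (hI i)
    · rintro i j z (h1 | h1) (h2 | h2) h3
      · exact absurd h3 (hmr _ _ h1)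
      · exact absurd h3 (hmr _ _ h1)
      · exact absurd h3 (hmr _ _ h2)
      · exact hdis _ _ _ h1 h2
    · intro i
      rcases h i with ⟨h1, -⟩ | ⟨-, -, z, hz, hxz⟩
      · exact ⟨v i, Or.inl (hv i), h1 ▸ huv i⟩
      · exact ⟨z, Or.inr hz, hxz⟩
  obtain ⟨x, hx, P, hPc, hfP, hPf, hPd, hPb⟩ := half 0 ![2, 4, 6] (by
    intro i; fin_cases i <;> simp [D3])
  obtain ⟨y, hy, Q, hQc, hfQ, hQf, hQd, hQb⟩ := half 1 ![3, 5, 7] (by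
    intro i; fin_cases i <;> simp [D3])
  have hinj : ∀ i j : Fin 3, (![2, 4, 6] : Fin 3 → Fin 8) i ≠ ![3, 5, 7] j := by decide
  have hinj1 : ∀ i j : Fin 3, (![2, 4, 6] : Fin 3 → Fin 8) i = ![2, 4, 6] j → i = j := by decide
  have hinj2 : ∀ i j : Fin 3, (![3, 5, 7] : Fin 3 → Fin 8) i = ![3, 5, 7] j → i = j := by decide
  have h0 : ∀ i : Fin 3, (![2, 4, 6] : Fin 3 → Fin 8) i ≠ 0 ∧
      (![2, 4, 6] : Fin 3 → Fin 8) i ≠ 1 := by decide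
  have h1 : ∀ i : Fin 3, (![3, 5, 7] : Fin 3 → Fin 8) i ≠ 0 ∧
      (![3, 5, 7] : Fin 3 → Fin 8) i ≠ 1 := by decide
  have hPQ : ∀ i j z, z ∈ P i → z ∉ Q j := by
    intro i j z hz hz'
    rcases hPf i hz with h | h <;> rcases hQf j hz' with h' | h'
    · exact hinj i j (hd _ _ z h h')
    · exact (h0 i).2 (hd _ _ z h h'.1)
    · exact (h1 j).1 (hd _ _ z h' h.1)
    · exact absurd (hd _ _ z h.1 h'.1) (by decide)
  have hPP : ∀ i j z, z ∈ P i → z ∈ P j → i = j := by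
    intro i j z hz hz'
    rcases hPf i hz with h | h
    · rcases hPf j hz' with h' | h'
      · exact hinj1 i j (hd _ _ z h h')
      · exact hPd i j z hz hz' h'.1
    · exact hPd i j z hz hz' h.1
  have hQQ : ∀ i j z, z ∈ Q i → z ∈ Q j → i = j := by
    intro i j z hz hz'
    rcases hQf i hz with h | h
    · rcases hQf j hz' with h' | h'
      · exact hinj2 i j (hd _ _ z h h')
      · exact hQd i j z hz hz' h'.1
    · exact hQd i j z hz hz' h.1
  refine ⟨x, y, fun i => P i ∪ Q i, ?_, ?_, ?_, ?_, ?_⟩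
  · rintro rfl
    exact absurd (hd _ _ _ hx hy) (by decide)
  · intro i
    obtain ⟨u, hu, v, hv, huv⟩ := ht (![2, 4, 6] i) (![3, 5, 7] i) (by
      fin_cases i <;> simp [D3])
    exact (hPc i).union_of_adj (hQc i) (hfP i hu) (hfQ i hv) huv
  · rintro i j z (h | h) (h' | h')
    · exact hPP i j z h h'
    · exact absurd h' (hPQ _ _ _ h)
    · exact absurd h (hPQ _ _ _ h')
    · exact hQQ i j z h h'
  · intro i
    constructor
    · rintro (h | h)
      · rcases hPf i h with h | h
        · exact (h0 i).1 (hd _ _ _ h hx)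
        · exact h.2 rfl
      · rcases hQf i h with h | h
        · exact (h1 i).1 (hd _ _ _ h hx)
        · exact absurd (hd _ _ _ h.1 hx) (by decide)
    · rintro (h | h)
      · rcases hPf i h with h | h
        · exact (h0 i).2 (hd _ _ _ h hy)
        · exact absurd (hd _ _ _ h.1 hy) (by decide)
      · rcases hQf i h with h | h
        · exact (h1 i).2 (hd _ _ _ h hy)
        · exact h.2 rfl
  · intro i
    obtain ⟨b, hb, hxb⟩ := hPb i
    obtain ⟨c, hc, hyc⟩ := hQb i
    exact ⟨b, Or.inl hb, c, Or.inr hc, fun h => hPQ _ _ _ hb (h ▸ hc), hxb, hyc⟩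

/-- A connected graph of maximum degree two has at most two vertices of degree at most one. -/
theorem not_three_ends {ι : Type} [Finite ι] {T : SimpleGraph ι} {Q : Set ι} (hQ : ConnSet T Q)
    (hdeg : ∀ t ∈ Q, {s | s ∈ Q ∧ T.Adj t s}.ncard ≤ 2) {q : Fin 3 → ι} (hq : ∀ i, q i ∈ Q)
    (hinj : Function.Injective q) (hdeg1 : ∀ i, {s | s ∈ Q ∧ T.Adj (q i) s}.ncard ≤ 1) :
    False := by
  obtain ⟨d, hd, I, hI, hdis, h⟩ := exists_median hQ q hq
  have hnb : ∀ i, q i ≠ d → ∃ x ∈ I i, T.Adj d x := fun i hi =>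
    (h i).elim (fun h => absurd h.1 hi) (fun h => h.2.2)
  by_cases hdq : ∃ i, q i = d
  · obtain ⟨i, rfl⟩ := hdq
    obtain ⟨j, k, hji, hki, hjk⟩ : ∃ j k : Fin 3, j ≠ i ∧ k ≠ i ∧ j ≠ k := by
      fin_cases i
      · exact ⟨1, 2, by decide⟩
      · exact ⟨0, 2, by decide⟩
      · exact ⟨0, 1, by decide⟩
    obtain ⟨x, hx, hdx⟩ := hnb j (fun h => hji (hinj h))
    obtain ⟨y, hy, hdy⟩ := hnb k (fun h => hki (hinj h))
    have := Set.ncard_le_one (Set.toFinite _) |>.1 (hdeg1 i) x ⟨((hI j) hx).1, hdx⟩ y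
      ⟨((hI k) hy).1, hdy⟩
    exact hjk (hdis _ _ x hx (this ▸ hy))
  · push Not at hdq
    choose x hx hdx using fun i => hnb i (hdq i)
    have h3 : ({x 0, x 1, x 2} : Set ι).ncard = 3 := by
      have hne : ∀ i j, i ≠ j → x i ≠ x j := fun i j hij h => hij (hdis _ _ _ (hx i) (h ▸ hx j))
      rw [Set.ncard_eq_three]
      exact ⟨x 0, x 1, x 2, hne _ _ (by decide), hne _ _ (by decide), hne _ _ (by decide), rfl⟩
    have hle := Set.ncard_le_ncard (s := {x 0, x 1, x 2}) (t := {s | s ∈ Q ∧ T.Adj d s}) (by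
      rintro z (rfl | rfl | rfl)
      exacts [⟨((hI _) (hx _)).1, hdx _⟩, ⟨((hI _) (hx _)).1, hdx _⟩, ⟨((hI _) (hx _)).1, hdx _⟩])
      (Set.toFinite _)
    have := hdeg d hd
    omega

namespace TreeDecomp

variable {V : Type} {G : SimpleGraph V} (D : TreeDecomp G)

theorem not_isMinorOf_D3 [Finite V] (hw : ∀ x, (D.bag x).ncard ≤ 3)
    (hp : ∀ v : V, IsPathSet D.tree {x | v ∈ D.bag x}) : ¬ IsMinorOf D3 G := by
  intro hm
  obtain ⟨x, y, A, hxy, hA, hdis, hxyA, hbc⟩ := exists_three_of_isMinorOf_D3 hm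
  choose b hb c hc hne hxb hyc using hbc
  have hac := D.isTree.isAcyclic
  have hTx := D.connSet_nodes_singleton x
  have hTy := D.connSet_nodes_singleton y
  have hTA := fun i => D.connSet_nodes (hA i)
  have hxA : ∀ i, (D.nodes {x} ∩ D.nodes (A i)).Nonempty := fun i =>
    D.nodes_inter_nonempty ⟨x, rfl, b i, hb i, hxb i⟩
  have hyA : ∀ i, (D.nodes {y} ∩ D.nodes (A i)).Nonempty := fun i =>
    D.nodes_inter_nonempty ⟨y, rfl, c i, hc i, hyc i⟩
  have hnx : ∀ i, ∀ a ∈ A i, x ≠ a := fun i a ha h => (hxyA i).1 (h ▸ ha)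
  have hny : ∀ i, ∀ a ∈ A i, y ≠ a := fun i a ha h => (hxyA i).2 (h ▸ ha)
  have hQne : (D.nodes {x} ∩ D.nodes {y}).Nonempty := by
    by_contra hcon
    obtain ⟨t, ht⟩ := ConnSet.helly_four hac
      (A := ![D.nodes {x}, D.nodes (A 0) ∪ D.nodes {y}, D.nodes (A 1) ∪ D.nodes {y},
        D.nodes (A 2) ∪ D.nodes {y}]) (by
      have hu : ∀ i, ConnSet D.tree (D.nodes (A i) ∪ D.nodes {y}) := fun i =>
        (hTA i).union_of_inter hTy ((hyA i).mono fun _ h => ⟨h.2, h.1⟩)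
      intro i
      fin_cases i
      exacts [hTx, hu 0, hu 1, hu 2]) (by
      have h1 : ∀ i, (D.nodes {x} ∩ (D.nodes (A i) ∪ D.nodes {y})).Nonempty := fun i =>
        (hxA i).mono fun _ h => ⟨h.1, Or.inl h.2⟩
      have h2 : ∀ i j, ((D.nodes (A i) ∪ D.nodes {y}) ∩ (D.nodes (A j) ∪ D.nodes {y})).Nonempty :=
        fun i j => hTy.1.mono fun _ h => ⟨Or.inr h, Or.inr h⟩
      intro i j hij
      fin_cases i <;> fin_cases j <;>
        first | exact absurd hij (by decide) | exact h1 _ | exact h2 _ _)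
    have h0 : t ∈ D.nodes {x} := ht 0
    have hy' : t ∉ D.nodes {y} := fun h => hcon ⟨t, h0, h⟩
    obtain ⟨a1, ha1, hat1⟩ := (ht 1).resolve_right hy'
    obtain ⟨a2, ha2, hat2⟩ := (ht 2).resolve_right hy'
    obtain ⟨a3, ha3, hat3⟩ := (ht 3).resolve_right hy'
    have hne' : ∀ i j, i ≠ j → ∀ a ∈ A i, ∀ a' ∈ A j, a ≠ a' := fun i j hij a ha a' ha' h =>
      hij (hdis i j a ha (h ▸ ha'))
    exact hne' 1 2 (by decide) a2 ha2 a3 ha3 (D.bag_of_four hw (D.mem_nodes_singleton.1 h0) hat1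
      hat2 hat3 (hnx _ _ ha1) (hnx _ _ ha2) (hnx _ _ ha3) (hne' 0 1 (by decide) _ ha1 _ ha2)
      (hne' 0 2 (by decide) _ ha1 _ ha3))
  set Q := D.nodes {x} ∩ D.nodes {y} with hQ
  have hQc : ConnSet D.tree Q := hTx.inter_of_isAcyclic hac hTy hQne
  have huniq : ∀ t ∈ Q, ∀ i j, ∀ a ∈ A i, ∀ a' ∈ A j, a ∈ D.bag t → a' ∈ D.bag t → a = a' := by
    intro t ht i j a ha a' ha' hat hat'
    exact D.bag_of_four hw (D.mem_nodes_singleton.1 ht.1) (D.mem_nodes_singleton.1 ht.2) hat hat'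
      hxy (hnx i a ha) (hnx j a' ha') (hny i a ha) (hny j a' ha')
  have hIne : ∀ i, (D.nodes (A i) ∩ Q).Nonempty := by
    intro i
    obtain ⟨t, ⟨h1, h2⟩, h3⟩ := hTx.helly_three hac hTy (hTA i) hQne (hxA i) (hyA i)
    exact ⟨t, h3, h1, h2⟩
  have hout : ∀ i, ∃ r ∈ D.nodes (A i), (r ∈ D.nodes {x} ∨ r ∈ D.nodes {y}) ∧ r ∉ Q := by
    intro i
    by_contra! hcon
    have hI := (hTA i).inter_of_isAcyclic hac hQc (hIne i)
    obtain ⟨s0, hs0, hbs0⟩ := D.bag_edge (hxb i)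
    obtain ⟨s1, hs1, hcs1⟩ := D.bag_edge (hyc i)
    have hs0A : s0 ∈ D.nodes (A i) := ⟨b i, hb i, hbs0⟩
    have hs1A : s1 ∈ D.nodes (A i) := ⟨c i, hc i, hcs1⟩
    have hs0Q := hcon s0 hs0A (Or.inl (D.mem_nodes_singleton.2 hs0))
    have hs1Q := hcon s1 hs1A (Or.inr (D.mem_nodes_singleton.2 hs1))
    obtain ⟨s, hs, hbs, s', hs', hbs', hss⟩ := hI.cross {t | b i ∈ D.bag t} ⟨hs0A, hs0Q⟩ hbs0
      ⟨hs1A, hs1Q⟩ (fun h => hne i (huniq s1 hs1Q i i _ (hb i) _ (hc i) h hcs1))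
    obtain ⟨q, hq, hqs'⟩ := hs'.1
    obtain ⟨L, hsL, hsL', hL⟩ := hac.exists_cut hss
    have hside : ∀ p ∈ A i, ¬ (p ∈ D.bag s ∧ p ∈ D.bag s') := by
      rintro p hp ⟨h1, h2⟩
      have := huniq s hs.2 i i _ (hb i) p hp hbs h1
      exact hbs' (this ▸ h2)
    have hor : ∀ p ∈ A i, D.nodes {p} ⊆ L ∨ ∀ t ∈ D.nodes {p}, t ∉ L := fun p hp =>
      (D.connSet_nodes_singleton p).subset_or_of_cut hL fun h => hside p hp
        ⟨D.mem_nodes_singleton.1 h.1, D.mem_nodes_singleton.1 h.2⟩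
    obtain ⟨p, hp, hpL, p', hp', hpL', hpp⟩ := (hA i).cross {p | D.nodes {p} ⊆ L} (hb i)
      ((hor _ (hb i)).resolve_right fun h => h s (D.mem_nodes_singleton.2 hbs) hsL) hq
      (fun h => hsL' (h (D.mem_nodes_singleton.2 hqs')))
    obtain ⟨t, ht, ht'⟩ := D.bag_edge hpp
    exact (hor p' hp').resolve_left hpL' t (D.mem_nodes_singleton.2 ht')
      (hpL (D.mem_nodes_singleton.2 ht))
  have hend : ∀ i, ∃ t ∈ Q, t ∈ D.nodes (A i) ∧ ∃ r, D.tree.Adj t r ∧ r ∉ Q ∧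
      (r ∈ D.nodes {x} ∨ r ∈ D.nodes {y}) := by
    intro i
    obtain ⟨r, hr, hrxy, hrQ⟩ := hout i
    have hU := hTx.union_of_inter hTy hQne
    obtain ⟨t, htA, htQ⟩ := hIne i
    have hU' := (hTA i).inter_of_isAcyclic hac hU ⟨t, htA, Or.inl htQ.1⟩
    obtain ⟨t', ht', htQ', r', hr', hrQ', htr⟩ := hU'.cross Q ⟨htA, Or.inl htQ.1⟩ htQ
      ⟨hr, hrxy⟩ hrQ
    exact ⟨t', htQ', ht'.1, r', htr, hrQ', hr'.2⟩
  choose q hqQ hqA r hqr hrQ hrxy using hend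
  have := D.finι
  have hdx : ∀ v t, t ∈ D.nodes {v} → {s | s ∈ D.nodes {v} ∧ D.tree.Adj t s}.ncard ≤ 2 := by
    intro v t ht
    have := (hp v).2 t (D.mem_nodes_singleton.1 ht)
    simp only [D.mem_nodes_singleton]
    exact this
  refine not_three_ends hQc (q := q) (fun t ht => ?_) hqQ ?_ (fun i => ?_)
  · refine (Set.ncard_le_ncard ?_ (Set.toFinite _)).trans (hdx x t ht.1)
    exact fun s hs => ⟨hs.1.1, hs.2⟩
  · intro i j hij
    obtain ⟨a, ha, hat⟩ := hqA i
    obtain ⟨a', ha', hat'⟩ := hqA j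
    rw [← hij] at hat'
    have := huniq _ (hqQ i) i j a ha a' ha' hat hat'
    exact hdis i j a ha (this ▸ ha')
  · have key : ∀ v, q i ∈ D.nodes {v} → Q ⊆ D.nodes {v} → r i ∈ D.nodes {v} →
        {s | s ∈ Q ∧ D.tree.Adj (q i) s}.ncard ≤ 1 := by
      intro v hv hQv hrv
      have h1 : (insert (r i) {s | s ∈ Q ∧ D.tree.Adj (q i) s}).ncard ≤ 2 := by
        refine (Set.ncard_le_ncard ?_ (Set.toFinite _)).trans (hdx v _ hv)
        exact Set.insert_subset ⟨hrv, hqr i⟩ fun s hs => ⟨hQv hs.1, hs.2⟩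
      rw [Set.ncard_insert_of_notMem (fun h => hrQ i h.1)] at h1
      omega
    rcases hrxy i with h | h
    · exact key x (hqQ i).1 (fun _ h => h.1) h
    · exact key y (hqQ i).2 (fun _ h => h.2) h

end TreeDecomp

theorem not_isMinorOf_of_sptw_le {V : Type} [Finite V] {G : SimpleGraph V} (h : sptw G ≤ 2) :
    ¬ IsMinorOf K4 G ∧ ¬ IsMinorOf D3 G := by
  have h1 : ∀ v : V, ConnSet (⊥ : SimpleGraph Unit) {_x | v ∈ (Set.univ : Set V)} := by
    intro v
    convert ConnSet.singleton ()
    ext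
    simp
  have hne : {k | ∃ td : SpaghettiTD G, ∀ x, (td.bag x).ncard ≤ k + 1}.Nonempty := by
    refine ⟨Nat.card V, ⟨⟨Unit, inferInstance, ⊥, ?_, fun _ => Set.univ, ?_, ?_, ?_⟩, ?_⟩, ?_⟩
    · exact IsTree.of_subsingleton
    · exact fun v => ⟨(), trivial⟩
    · exact fun u v _ => ⟨(), trivial, trivial⟩
    · intro v
      exact ConnSet.iff_induce.1 (h1 v)
    · intro v
      refine ⟨ConnSet.iff_induce.1 (h1 v), ?_⟩
      intro x _
      simp
    · intro _
      simp [Set.ncard_univ]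
  obtain ⟨D, hD⟩ := Nat.sInf_mem hne
  have hw : ∀ x, (D.bag x).ncard ≤ 3 := fun x => (hD x).trans (Nat.add_le_add_right h 1)
  exact ⟨D.toTreeDecomp.not_isMinorOf_K4 hw, D.toTreeDecomp.not_isMinorOf_D3 hw D.bag_path⟩

section Bridging

variable {V : Type} {G : SimpleGraph V}

/-- `X` is a connected set avoiding `c` and `d` but adjacent to both. -/
structure Joins (G : SimpleGraph V) (c d : V) (X : Set V) : Prop where
  conn : ConnSet G X
  left_notMem : c ∉ X
  right_notMem : d ∉ X
  left : ∃ x ∈ X, G.Adj c x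
  right : ∃ x ∈ X, G.Adj d x

theorem Joins.symm {c d : V} {X : Set V} (h : Joins G c d X) : Joins G d c X :=
  ⟨h.conn, h.right_notMem, h.left_notMem, h.right, h.left⟩

/-- `c` and `d` are distinct and joined by three disjoint connected sets. -/
def Theta (G : SimpleGraph V) (c d : V) : Prop :=
  c ≠ d ∧ ∃ I : Fin 3 → Set V, (∀ i, Joins G c d (I i)) ∧ ∀ i j x, x ∈ I i → x ∈ I j → i = j

theorem Theta.symm {c d : V} (h : Theta G c d) : Theta G d c :=
  ⟨h.1.symm, h.2.imp fun _ hI => ⟨fun i => (hI.1 i).symm, hI.2⟩⟩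

theorem Theta.mono {G' : SimpleGraph V} (hle : G ≤ G') {c d : V} (h : Theta G c d) :
    Theta G' c d := by
  obtain ⟨hne, I, hI, hdis⟩ := h
  refine ⟨hne, I, fun i => ⟨(hI i).conn.mono fun _ _ _ _ h => hle h, (hI i).left_notMem,
    (hI i).right_notMem, ?_, ?_⟩, hdis⟩
  · exact (hI i).left.imp fun x h => ⟨h.1, hle h.2⟩
  · exact (hI i).right.imp fun x h => ⟨h.1, hle h.2⟩

theorem ConnSet.exists_touching {D I R : Set V} (hD : ConnSet G D) (hI : ConnSet G I)
    (hID : I ⊆ D) (hIR : ∀ x ∈ I, x ∉ R) {r : V} (hrR : r ∈ R) (hrD : r ∈ D) :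
    ∃ X, ConnSet G X ∧ I ⊆ X ∧ X ⊆ D ∧ (∀ x ∈ X, x ∉ R) ∧ ∃ p ∈ X, ∃ q ∈ R, G.Adj p q := by
  obtain ⟨x, hx⟩ := hI.1
  have hx' : x ∉ {z | ¬ (z ∈ D ∧ z ∉ R)} := fun h => h ⟨hID hx, hIR x hx⟩
  have hmem : ∀ z ∈ compSet G {z | ¬ (z ∈ D ∧ z ∉ R)} x, z ∈ D ∧ z ∉ R := fun z hz =>
    not_not.1 (notMem_of_mem_compSet hz)
  refine ⟨compSet G {z | ¬ (z ∈ D ∧ z ∉ R)} x, connSet_compSet hx', ?_, fun z hz => (hmem z hz).1,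
    fun z hz => (hmem z hz).2, ?_⟩
  · exact subset_compSet hI (fun y hy h => h ⟨hID hy, hIR y hy⟩) hx (mem_compSet_self hx')
  · obtain ⟨p, -, hp, q, hqD, hq, hpq⟩ := hD.cross _ (hID hx) (mem_compSet_self hx') hrD
      (fun h => (hmem r h).2 hrR)
    refine ⟨p, hp, q, ?_, hpq⟩
    by_contra hqR
    exact hq (mem_compSet_of_adj hp hpq (not_not.2 ⟨hqD, hqR⟩))

theorem isMinorOf_K4_of_joins_adj {c d : V} (hcd : G.Adj c d) {I J D : Set V}
    (hI : Joins G c d I) (hJ : Joins G c d J) (hIJ : ∀ x ∈ I, x ∉ J) (hD : ConnSet G D)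
    (hcD : c ∉ D) (hdD : d ∉ D) (hID : I ⊆ D) {r : V} (hrJ : r ∈ J) (hrD : r ∈ D) :
    IsMinorOf K4 G := by
  obtain ⟨X, hX, hIX, hXD, hXJ, p, hp, q, hq, hpq⟩ := hD.exists_touching hI.conn hID hIJ hrJ hrD
  refine isMinorOf_K4_of_sets (.singleton c) (.singleton d) hX hJ.conn ?_ ?_ ?_ ?_ ?_
    (Set.disjoint_left.2 hXJ) ⟨c, rfl, d, rfl, hcd⟩ ?_ ?_ ?_ ?_ ⟨p, hp, q, hq, hpq⟩
  · simpa using hcd.ne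
  · simpa using fun h => hcD (hXD h)
  · simpa using hJ.left_notMem
  · simpa using fun h => hdD (hXD h)
  · simpa using hJ.right_notMem
  · exact ⟨c, rfl, hI.left.imp fun x h => ⟨hIX h.1, h.2⟩⟩
  · exact ⟨c, rfl, hJ.left⟩
  · exact ⟨d, rfl, hI.right.imp fun x h => ⟨hIX h.1, h.2⟩⟩
  · exact ⟨d, rfl, hJ.right⟩

theorem isMinorOf_K4_of_joins {c d : V} (hcd : c ≠ d) {I : Fin 3 → Set V}
    (hI : ∀ i, Joins G c d (I i)) (hdis : ∀ i j x, x ∈ I i → x ∈ I j → i = j) {D : Set V}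
    (hD : ConnSet G D) (hcD : c ∉ D) (hdD : d ∉ D) {i j : Fin 3} (hij : i ≠ j) (hID : I i ⊆ D)
    {r : V} (hrJ : r ∈ I j) (hrD : r ∈ D) : IsMinorOf K4 G := by
  obtain ⟨X, hX, hIX, hXD, hXR, p, hp, q, ⟨k, hki, hq⟩, hpq⟩ := hD.exists_touching
    (R := {x | ∃ k, k ≠ i ∧ x ∈ I k}) (hI i).conn hID
    (fun x hx ⟨k, hk, hxk⟩ => hk (hdis k i x hxk hx)) ⟨j, hij.symm, hrJ⟩ hrD
  obtain ⟨l, hli, hlk⟩ := (by decide : ∀ i k : Fin 3, ∃ l : Fin 3, l ≠ i ∧ l ≠ k) i k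
  have hcX : c ∉ X := fun h => hcD (hXD h)
  have hdX : d ∉ X := fun h => hdD (hXD h)
  obtain ⟨z, hz, hcz⟩ := (hI l).left
  refine isMinorOf_K4_of_sets ((hI l).conn.insert_of_adj hz hcz) (.singleton d) hX (hI k).conn
    ?_ ?_ ?_ ?_ ?_ ?_ ?_ ?_ ?_ ?_ ?_ ⟨p, hp, q, hq, hpq⟩
  · simpa [hcd.symm] using (hI l).right_notMem
  · rw [Set.disjoint_left]
    rintro x (rfl | hx) hxX
    · exact hcX hxX
    · exact hXR x hxX ⟨l, hli, hx⟩
  · rw [Set.disjoint_left]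
    rintro x (rfl | hx) hxX
    · exact (hI k).left_notMem hxX
    · exact hlk (hdis _ _ x hx hxX)
  · simpa using hdX
  · simpa using (hI k).right_notMem
  · rw [Set.disjoint_left]
    exact fun x hx hxk => hXR x hx ⟨k, hki, hxk⟩
  · obtain ⟨w, hw, hdw⟩ := (hI l).right
    exact ⟨w, Or.inr hw, d, rfl, hdw.symm⟩
  · exact ⟨c, Or.inl rfl, (hI i).left.imp fun x h => ⟨hIX h.1, h.2⟩⟩
  · exact ⟨c, Or.inl rfl, (hI k).left⟩
  · exact ⟨d, rfl, (hI i).right.imp fun x h => ⟨hIX h.1, h.2⟩⟩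
  · exact ⟨d, rfl, (hI k).right⟩

theorem ConnSet.of_sup_edge {a b : V} {S : Set V} (h : ConnSet (G ⊔ edge a b) S)
    (hab : a ∈ S → b ∈ S → ∃ K ⊆ S, ConnSet G K ∧ a ∈ K ∧ b ∈ K) : ConnSet G S := by
  refine ⟨h.1, ?_⟩
  rintro A ⟨x, hx, hxA⟩ ⟨y, hy, hyA⟩
  obtain ⟨p, hp, hpA, q, hq, hqA, hpq⟩ := h.cross A hx hxA hy hyA
  rw [sup_adj, edge_adj] at hpq
  rcases hpq with hpq | ⟨⟨rfl, rfl⟩ | ⟨rfl, rfl⟩, -⟩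
  · exact ⟨p, hp, hpA, q, hq, hqA, hpq⟩
  · obtain ⟨K, hKS, hK, hpK, hqK⟩ := hab hp hq
    obtain ⟨p', hp', hpA', q', hq', hqA', hpq'⟩ := hK.cross A hpK hpA hqK hqA
    exact ⟨p', hKS hp', hpA', q', hKS hq', hqA', hpq'⟩
  · obtain ⟨K, hKS, hK, hqK, hpK⟩ := hab hq hp
    obtain ⟨p', hp', hpA', q', hq', hqA', hpq'⟩ := hK.cross A hpK hpA hqK hqA
    exact ⟨p', hKS hp', hpA', q', hKS hq', hqA', hpq'⟩

/-- Branch sets using the extra edge `ab` can be rerouted through a connected set attached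
exactly to `a` and `b`. -/
theorem exists_reroute {a b : V} {D : Set V} (hab : a ≠ b) (hD : Joins G a b D)
    (hN : ∀ x ∈ D, ∀ y, G.Adj x y → y ∈ D ∨ y = a ∨ y = b) {W : Type} {f : W → Set V}
    (hf : ∀ w, ConnSet (G ⊔ edge a b) (f w)) (hdis : ∀ w w' x, x ∈ f w → x ∈ f w' → w = w')
    {i : W} (hai : a ∈ f i) (hfD : ∀ w, w ≠ i → ¬ f w ⊆ D) :
    ∃ f' : W → Set V, (∀ w, ConnSet G (f' w)) ∧ (∀ w w' x, x ∈ f' w → x ∈ f' w' → w = w') ∧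
      (∀ w w', w ≠ w' → Touch (G ⊔ edge a b) (f w) (f w') → Touch G (f' w) (f' w')) ∧
      ∀ w, w ≠ i → f' w ⊆ f w := by
  classical
  have haw : ∀ w, w ≠ i → a ∉ f w := fun w hw h => hw (hdis w i a h hai)
  have hfc : ∀ w, w ≠ i → ConnSet G (f w) := fun w hw =>
    (hf w).of_sup_edge fun h => absurd h (haw w hw)
  have hbw : ∀ w, w ≠ i → ∀ x ∈ f w, x ∈ D → b ∈ f w := by
    intro w hw x hx hxD
    obtain ⟨y, hy, hyD⟩ := Set.not_subset.1 (hfD w hw)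
    obtain ⟨p, hp, hpD, q, hq, hqD, hpq⟩ := (hfc w hw).cross D hx hxD hy hyD
    rcases hN p hpD q hpq with h | rfl | rfl
    · exact absurd h hqD
    · exact absurd hq (haw w hw)
    · exact hq
  obtain ⟨da, hda, hada⟩ := hD.left
  obtain ⟨db, hdb, hbdb⟩ := hD.right
  refine ⟨fun w => if w = i then f i ∪ D else f w \ D, ?_, ?_, ?_, ?_⟩
  · intro w
    by_cases hw : w = i
    · simp only [if_pos hw]
      have h1 : ConnSet (G ⊔ edge a b) (f i ∪ D) :=
        (hf i).union_of_adj (hD.conn.mono fun _ _ _ _ h => Or.inl h) hai hda (Or.inl hada)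
      refine h1.of_sup_edge fun _ hb => ⟨insert b (insert a D), ?_, ?_, by simp, by simp⟩
      · rintro x (rfl | rfl | hx)
        exacts [hb, Or.inl hai, Or.inr hx]
      · exact (hD.conn.insert_of_adj hda hada).insert_of_adj (Or.inr hdb) hbdb
    · simp only [if_neg hw]
      refine (hfc w hw).diff_hanging (K := {b}) ?_ ?_ ?_
      · obtain ⟨y, hy, hyD⟩ := Set.not_subset.1 (hfD w hw)
        exact ⟨y, hy, hyD⟩
      · intro x hx y hy hxy
        rcases hN x hx y hxy with h | rfl | rfl
        exacts [absurd h hy.2, absurd hy.1 (haw w hw), rfl]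
      · rintro x rfl y rfl _ _ h
        exact absurd rfl h
  · intro w w' x hx hx'
    by_cases hw : w = i <;> by_cases hw' : w' = i <;> simp only [hw, hw', if_true, if_false] at hx hx' ⊢
    · rcases hx with h | h
      · exact absurd (hdis _ _ x hx'.1 h) hw'
      · exact absurd h hx'.2
    · rcases hx' with h | h
      · exact absurd (hdis _ _ x hx.1 h) hw
      · exact absurd h hx.2
    · exact hdis _ _ x hx.1 hx'.1
  · have key : ∀ w', w' ≠ i → Touch (G ⊔ edge a b) (f i) (f w') → Touch G (f i ∪ D) (f w' \ D) := by
      rintro w' hw' ⟨u, hu, v, hv, huv⟩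
      rw [sup_adj, edge_adj] at huv
      by_cases hvD : v ∈ D
      · exact ⟨db, Or.inr hdb, b, ⟨hbw w' hw' v hv hvD, hD.right_notMem⟩, hbdb.symm⟩
      rcases huv with huv | ⟨⟨rfl, rfl⟩ | ⟨rfl, rfl⟩, -⟩
      · exact ⟨u, Or.inl hu, v, ⟨hv, hvD⟩, huv⟩
      · exact ⟨db, Or.inr hdb, v, ⟨hv, hvD⟩, hbdb.symm⟩
      · exact absurd hv (haw w' hw')
    intro w w' hww ht
    by_cases hw : w = i
    · subst hw
      simp only [if_true, if_neg hww.symm]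
      exact key w' hww.symm ht
    by_cases hw' : w' = i
    · subst hw'
      simp only [if_true, if_neg hw]
      exact (key w hw ht.symm).symm
    simp only [if_neg hw, if_neg hw']
    obtain ⟨u, hu, v, hv, huv⟩ := ht
    have main : ∀ w w' u v, w ≠ i → w' ≠ i → w ≠ w' → u ∈ f w → v ∈ f w' → G.Adj u v →
        u ∉ D := by
      intro w w' u v hw hw' hww hu hv huv huD
      have hb := hbw w hw u hu huD
      rcases hN u huD v huv with h | rfl | rfl
      · exact hww (hdis _ _ b hb (hbw w' hw' v hv h))
      · exact haw w' hw' hv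
      · exact hww (hdis _ _ _ hb hv)
    rw [sup_adj, edge_adj] at huv
    rcases huv with huv | ⟨⟨rfl, rfl⟩ | ⟨rfl, rfl⟩, -⟩
    · exact ⟨u, ⟨hu, main w w' u v hw hw' hww hu hv huv⟩, v,
        ⟨hv, main w' w v u hw' hw hww.symm hv hu huv.symm⟩, huv⟩
    · exact absurd hu (haw w hw)
    · exact absurd hv (haw w' hw')
  · intro w hw
    simp only [if_neg hw]
    exact Set.sdiff_subset

theorem touch_of_sup_edge {a b : V} {X Y : Set V} (h : Touch (G ⊔ edge a b) X Y)
    (ha : a ∉ X ∪ Y ∨ b ∉ X ∪ Y) : Touch G X Y := by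
  obtain ⟨u, hu, v, hv, huv⟩ := h
  rw [sup_adj, edge_adj] at huv
  rcases huv with huv | ⟨⟨rfl, rfl⟩ | ⟨rfl, rfl⟩, -⟩
  · exact ⟨u, hu, v, hv, huv⟩
  · simp [hu, hv] at ha
  · simp [hu, hv] at ha

/-- In a `K₄`-minor-free graph, for every vertex `x` there is a connected set attached exactly to
a pair `a`, `b` in theta position, avoiding the component of `x`. -/
theorem Theta.exists_attached {a b : V} (h : Theta G a b) (hK : ¬ IsMinorOf K4 G) (x : V) :
    ∃ D, Joins G a b D ∧ (∀ z ∈ D, ∀ y, G.Adj z y → y ∈ D ∨ y = a ∨ y = b) ∧ x ∉ D := by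
  obtain ⟨hab, I, hI, hdis⟩ := h
  have key : ∀ i, ∃ D, I i ⊆ D ∧ Joins G a b D ∧
      (∀ z ∈ D, ∀ y, G.Adj z y → y ∈ D ∨ y = a ∨ y = b) := by
    intro i
    obtain ⟨z, hz⟩ := (hI i).conn.1
    have hav : ∀ y ∈ I i, y ∉ ({a, b} : Set V) := by
      rintro y hy (rfl | rfl)
      · exact (hI i).left_notMem hy
      · exact (hI i).right_notMem hy
    have hsub := subset_compSet (hI i).conn hav hz (mem_compSet_self (hav z hz))
    refine ⟨compSet G {a, b} z, hsub, ⟨connSet_compSet (hav z hz), ?_, ?_, ?_, ?_⟩, ?_⟩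
    · exact fun h => notMem_of_mem_compSet h (Or.inl rfl)
    · exact fun h => notMem_of_mem_compSet h (Or.inr rfl)
    · exact (hI i).left.imp fun y hy => ⟨hsub hy.1, hy.2⟩
    · exact (hI i).right.imp fun y hy => ⟨hsub hy.1, hy.2⟩
    · intro u hu y huy
      by_contra! hcon
      exact hcon.1 (mem_compSet_of_adj hu huy (by simp [hcon.2]))
  obtain ⟨D, hID, hD, hN⟩ := key 0
  obtain ⟨D', hID', hD', hN'⟩ := key 1
  by_cases hx : x ∈ D
  · refine ⟨D', hD', hN', fun hx' => ?_⟩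
    obtain ⟨r, hr⟩ := (hI 1).conn.1
    refine hK (isMinorOf_K4_of_joins hab hI hdis (hD.conn.union_of_inter hD'.conn ⟨x, hx, hx'⟩)
      ?_ ?_ (i := 0) (j := 1) (by decide) (fun z hz => Or.inl (hID hz)) hr (Or.inr (hID' hr)))
    · rintro (h | h)
      exacts [hD.left_notMem h, hD'.left_notMem h]
    · rintro (h | h)
      exacts [hD.right_notMem h, hD'.right_notMem h]
  · exact ⟨D, hD, hN, hx⟩

end Bridging

section AddEdge

variable {V : Type} {G : SimpleGraph V}

theorem Theta.not_isMinorOf_K4_sup_edge {a b : V} (h : Theta G a b) (hK : ¬ IsMinorOf K4 G) :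
    ¬ IsMinorOf K4 (G ⊔ edge a b) := by
  intro hK'
  apply hK
  rw [isMinorOf_iff] at hK' ⊢
  obtain ⟨f, hf, hdis, ht⟩ := hK'
  by_cases hai : ∃ i, a ∈ f i
  swap
  · push Not at hai
    refine ⟨f, fun w => (hf w).of_sup_edge fun h => absurd h (hai w), hdis, fun w w' hw =>
      touch_of_sup_edge (ht w w' hw) (Or.inl ?_)⟩
    rintro (h | h)
    exacts [hai _ h, hai _ h]
  obtain ⟨i, hai⟩ := hai
  obtain ⟨k, hak, hbk⟩ : ∃ k, a ∉ f k ∧ b ∉ f k := by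
    by_contra! hcon
    obtain ⟨k, l, hki, hli, hkl⟩ := (by decide : ∀ i : Fin 4, ∃ k l : Fin 4, k ≠ i ∧ l ≠ i ∧ k ≠ l) i
    have hb : ∀ k, k ≠ i → b ∈ f k := fun k hk => hcon k fun h => hk (hdis _ _ _ h hai)
    exact hkl (hdis _ _ _ (hb k hki) (hb l hli))
  obtain ⟨x, hx⟩ := (hf k).1
  obtain ⟨D, hD, hN, hxD⟩ := h.exists_attached hK x
  have hkD : ∀ y ∈ f k, y ∉ D := by
    intro y hy hyD
    obtain ⟨p, hp, hpD, q, hq, hqD, hpq⟩ := ((hf k).of_sup_edge (G := G) fun h => absurd h hak).cross D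
      hy hyD hx hxD
    rcases hN p hpD q hpq with h | rfl | rfl
    exacts [hqD h, hak hq, hbk hq]
  obtain ⟨f', hc', hd', ht', -⟩ := exists_reroute h.1 hD hN hf hdis hai (by
    intro w hw hwD
    by_cases hwk : w = k
    · subst hwk
      exact hxD (hwD hx)
    · obtain ⟨u, hu, v, hv, huv⟩ := ht w k hwk
      rw [sup_adj, edge_adj] at huv
      rcases huv with huv | ⟨⟨rfl, rfl⟩ | ⟨rfl, rfl⟩, -⟩
      · rcases hN u (hwD hu) v huv with h | rfl | rfl
        exacts [hkD v hv h, hak hv, hbk hv]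
      · exact hbk hv
      · exact hak hv)
  exact ⟨f', hc', hd', fun w w' hw => ht' w w' hw.ne (ht w w' hw)⟩

theorem Theta.of_sup_edge_aux {a b c d : V} (h : Theta G a b) (hK : ¬ IsMinorOf K4 G)
    {I : Fin 3 → Set V} (hcd : c ≠ d) (hI : ∀ i, Joins (G ⊔ edge a b) c d (I i))
    (hdis : ∀ i j x, x ∈ I i → x ∈ I j → i = j) {i : Fin 3} (hai : a ∈ I i) : Theta G c d := by
  obtain ⟨k, hki, hbk⟩ : ∃ k, k ≠ i ∧ b ∉ I k := by
    by_contra! hcon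
    obtain ⟨k, l, hki, hli, hkl⟩ := (by decide : ∀ i : Fin 3, ∃ k l : Fin 3, k ≠ i ∧ l ≠ i ∧ k ≠ l) i
    exact hkl (hdis _ _ _ (hcon k hki) (hcon l hli))
  have hak : a ∉ I k := fun h => hki (hdis _ _ _ h hai)
  have hca : c ≠ a := fun h => (hI i).left_notMem (h ▸ hai)
  have hda : d ≠ a := fun h => (hI i).right_notMem (h ▸ hai)
  obtain ⟨x, hx⟩ := (hI k).conn.1
  obtain ⟨D, hD, hN, hxD⟩ := h.exists_attached hK x
  have hN' : ∀ p ∈ D, ∀ q, (G ⊔ edge a b).Adj p q → q ∈ D ∨ q = a ∨ q = b := by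
    intro p hp q hpq
    rw [sup_adj, edge_adj] at hpq
    rcases hpq with hpq | ⟨⟨rfl, rfl⟩ | ⟨rfl, rfl⟩, -⟩
    exacts [hN p hp q hpq, Or.inr (Or.inr rfl), Or.inr (Or.inl rfl)]
  have hkD : ∀ y ∈ I k, y ∉ D := by
    intro y hy hyD
    obtain ⟨p, hp, hpD, q, hq, hqD, hpq⟩ := (hI k).conn.cross D hy hyD hx hxD
    rcases hN' p hpD q hpq with h | rfl | rfl
    exacts [hqD h, hak hq, hbk hq]
  have hend : ∀ y ∈ I k, ∀ z, (G ⊔ edge a b).Adj z y → z ∉ D := by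
    intro y hy z hzy hz
    rcases hN' z hz y hzy with h | rfl | rfl
    exacts [hkD y hy h, hak hy, hbk hy]
  have hcD : c ∉ D := by
    obtain ⟨y, hy, hcy⟩ := (hI k).left
    exact hend y hy c hcy
  have hdD : d ∉ D := by
    obtain ⟨y, hy, hcy⟩ := (hI k).right
    exact hend y hy d hcy
  have hout : ∀ t j, cond t c d ∉ I j := by
    rintro (_ | _) j
    exacts [(hI j).right_notMem, (hI j).left_notMem]
  have hf : ∀ w : Bool ⊕ Fin 3, ConnSet (G ⊔ edge a b)
      (Sum.elim (fun t => ({cond t c d} : Set V)) I w) := by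
    rintro (t | j)
    · exact .singleton _
    · exact (hI j).conn
  have hfdis : ∀ (w w' : Bool ⊕ Fin 3) (x : V),
      x ∈ Sum.elim (fun t => ({cond t c d} : Set V)) I w →
      x ∈ Sum.elim (fun t => ({cond t c d} : Set V)) I w' → w = w' := by
    rintro (t | j) (t' | j') z hz hz'
    · obtain rfl : z = _ := hz
      have : cond t c d = cond t' c d := hz'
      revert this
      cases t <;> cases t' <;> simp [hcd, hcd.symm]
    · obtain rfl : z = _ := hz
      exact absurd hz' (hout t j')
    · obtain rfl : z = _ := hz'
      exact absurd hz (hout t' j)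
    · rw [hdis j j' z hz hz']
  obtain ⟨f', hc', hd', ht', hsub⟩ := exists_reroute (i := Sum.inr i) h.1 hD hN hf hfdis hai (by
    rintro (t | j) hw hsub
    · have : cond t c d ∈ D := hsub rfl
      cases t
      exacts [hdD this, hcD this]
    · obtain ⟨z, hz, hcz⟩ := (hI j).left
      obtain ⟨z', hz', hdz⟩ := (hI j).right
      have hcb := ((hN' z (hsub hz) c hcz.symm).resolve_left hcD).resolve_left hca
      have hdb := ((hN' z' (hsub hz') d hdz.symm).resolve_left hdD).resolve_left hda
      exact hcd (hcb.trans hdb.symm))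
  have hmem : ∀ t, f' (Sum.inl t) = {cond t c d} := fun t =>
    (Set.Nonempty.subset_singleton_iff (hc' (Sum.inl t)).1).1 (hsub (Sum.inl t) (by simp))
  have hout' : ∀ t i, cond t c d ∉ f' (Sum.inr i) := by
    intro t i hi
    have := hd' (Sum.inl t) (Sum.inr i) (cond t c d) (by rw [hmem]; rfl) hi
    simp at this
  have htt : ∀ t i, ∃ x ∈ f' (Sum.inr i), G.Adj (cond t c d) x := by
    intro t i
    obtain ⟨u, hu, v, hv, huv⟩ := ht' (Sum.inl t) (Sum.inr i) (by simp) (by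
      cases t
      · exact ⟨d, rfl, (hI i).right⟩
      · exact ⟨c, rfl, (hI i).left⟩)
    rw [hmem] at hu
    obtain rfl : u = _ := hu
    exact ⟨v, hv, huv⟩
  exact ⟨hcd, fun i => f' (Sum.inr i), fun i => ⟨hc' _, hout' true i, hout' false i, htt true i,
    htt false i⟩, fun i j x h h' => Sum.inr_injective (hd' _ _ x h h')⟩

theorem Theta.of_sup_edge {a b c d : V} (h : Theta G a b) (hK : ¬ IsMinorOf K4 G)
    (hcd : Theta (G ⊔ edge a b) c d) : Theta G c d := by
  obtain ⟨hne, I, hI, hdis⟩ := hcd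
  by_cases ha : ∃ i, a ∈ I i
  · obtain ⟨i, hi⟩ := ha
    exact h.of_sup_edge_aux hK hne hI hdis hi
  by_cases hb : ∃ i, b ∈ I i
  · obtain ⟨i, hi⟩ := hb
    rw [edge_comm] at hI
    exact h.symm.of_sup_edge_aux hK hne hI hdis hi
  push Not at ha hb
  by_cases hs : s(a, b) = s(c, d)
  · rw [Sym2.eq_iff] at hs
    rcases hs with ⟨rfl, rfl⟩ | ⟨rfl, rfl⟩
    exacts [h, h.symm]
  refine ⟨hne, I, fun i => ?_, hdis⟩
  have key : ∀ e, (∃ x ∈ I i, (G ⊔ edge a b).Adj e x) → ∃ x ∈ I i, G.Adj e x := by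
    rintro e ⟨x, hx, hex⟩
    rw [sup_adj, edge_adj] at hex
    rcases hex with hex | ⟨⟨rfl, rfl⟩ | ⟨rfl, rfl⟩, -⟩
    exacts [⟨x, hx, hex⟩, absurd hx (hb i), absurd hx (ha i)]
  exact ⟨(hI i).conn.of_sup_edge fun h => absurd h (ha i), (hI i).left_notMem,
    (hI i).right_notMem, key c (hI i).left, key d (hI i).right⟩

theorem reachable_induce_iff {a b : V} {x y : {x | x ≠ a ∧ x ≠ b}} :
    (G.induce {x | x ≠ a ∧ x ≠ b}).Reachable x y ↔ y.1 ∈ compSet G {a, b} x := by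
  constructor
  · rintro ⟨p⟩
    by_contra hy
    have hx : x.1 ∉ ({a, b} : Set V) := fun h => h.elim x.2.1 x.2.2
    obtain ⟨d, -, h1, h2⟩ := p.exists_boundary_dart {z | z.1 ∈ compSet G {a, b} x}
      (mem_compSet_self hx) hy
    exact h2 (mem_compSet_of_adj h1 d.adj fun h => h.elim d.snd.2.1 d.snd.2.2)
  · rintro ⟨D, ⟨hD, hxD, hZ⟩, hyD⟩
    by_contra hcon
    obtain ⟨p, hp, ⟨hp', hpr⟩, q, hq, hqr, hpq⟩ := hD.cross
      {z | ∃ hz : z ∈ {x | x ≠ a ∧ x ≠ b}, (G.induce {x | x ≠ a ∧ x ≠ b}).Reachable x ⟨z, hz⟩}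
      hxD ⟨x.2, Reachable.refl _⟩ hyD (fun ⟨_, h⟩ => hcon h)
    have hq' : q ∈ {x | x ≠ a ∧ x ≠ b} := by
      refine ⟨?_, ?_⟩ <;> rintro rfl
      · exact (hZ ▸ ⟨hq, by simp⟩ : q ∈ (∅ : Set V))
      · exact (hZ ▸ ⟨hq, by simp⟩ : q ∈ (∅ : Set V))
    exact hqr ⟨hq', hpr.trans (Adj.reachable hpq)⟩

theorem joins_compSet (h2 : ∀ v, ConnSet G {x | x ≠ v}) {a b x : V} (hab : a ≠ b)
    (hxa : x ≠ a) (hxb : x ≠ b) : Joins G a b (compSet G {a, b} x) := by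
  have hx : x ∉ ({a, b} : Set V) := by simp [hxa, hxb]
  have ha : a ∉ compSet G {a, b} x := fun h => notMem_of_mem_compSet h (Or.inl rfl)
  have hb : b ∉ compSet G {a, b} x := fun h => notMem_of_mem_compSet h (Or.inr rfl)
  have key : ∀ e f, e ≠ f → ({a, b} : Set V) = {e, f} → x ≠ f →
      ∃ y ∈ compSet G {a, b} x, G.Adj e y := by
    intro e f hef hs hxf
    obtain ⟨p, -, hp, q, hqf, hq, hpq⟩ := (h2 f).cross (compSet G {a, b} x) (x := x) (y := e) hxf
      (mem_compSet_self hx) hef (fun h => notMem_of_mem_compSet h (by rw [hs]; simp))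
    have : q ∈ ({a, b} : Set V) := by
      by_contra hcon
      exact hq (mem_compSet_of_adj hp hpq hcon)
    rw [hs] at this
    obtain rfl : q = e := this.resolve_right hqf
    exact ⟨p, hp, hpq.symm⟩
  exact ⟨connSet_compSet hx, ha, hb, key a b hab rfl hxb,
    key b a hab.symm (Set.pair_comm a b) hxa⟩

theorem mem_compSet_symm {Z : Set V} {x y : V} (h : y ∈ compSet G Z x) : x ∈ compSet G Z y := by
  obtain ⟨D, ⟨h1, h2, h3⟩, h4⟩ := h
  exact ⟨D, ⟨h1, h4, h3⟩, h2⟩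

theorem mem_compSet_trans {Z : Set V} {x y z : V} (h : y ∈ compSet G Z x)
    (h' : z ∈ compSet G Z y) : z ∈ compSet G Z x := by
  obtain ⟨D, ⟨h1, h2, h3⟩, h4⟩ := h'
  exact subset_compSet h1 (fun w hw hwZ => (h3 ▸ ⟨hw, hwZ⟩ : w ∈ (∅ : Set V))) h2 h h4

theorem theta_of_three_components [Finite V] (h2 : ∀ v, ConnSet G {x | x ≠ v}) {a b : V}
    (hab : a ≠ b)
    (h3 : 3 ≤ Nat.card (G.induce {x | x ≠ a ∧ x ≠ b}).ConnectedComponent) : Theta G a b := by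
  have := Fintype.ofFinite (G.induce {x | x ≠ a ∧ x ≠ b}).ConnectedComponent
  rw [Nat.card_eq_fintype_card] at h3
  obtain ⟨e⟩ := Function.Embedding.nonempty_of_card_le (α := Fin 3) (by simpa using h3)
  choose x hx using fun i => (e i).exists_rep
  refine ⟨hab, fun i => compSet G {a, b} (x i), fun i => joins_compSet h2 hab (x i).2.1 (x i).2.2, ?_⟩
  intro i j z hi hj
  apply e.injective
  rw [← hx i, ← hx j]
  exact ConnectedComponent.sound (reachable_induce_iff.2 (mem_compSet_trans hi (mem_compSet_symm hj)))

theorem Theta.three_components [Finite V] (hK : ¬ IsMinorOf K4 G) {a b : V} (h : Theta G a b) :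
    3 ≤ Nat.card (G.induce {x | x ≠ a ∧ x ≠ b}).ConnectedComponent := by
  obtain ⟨hab, I, hI, hdis⟩ := h
  choose x hx using fun i => (hI i).conn.1
  have hx' : ∀ i, ∀ y ∈ I i, y ∈ {x | x ≠ a ∧ x ≠ b} := fun i y hy =>
    ⟨fun h => (hI i).left_notMem (h ▸ hy), fun h => (hI i).right_notMem (h ▸ hy)⟩
  have hx2 : ∀ i, ∀ y ∈ I i, y ∉ ({a, b} : Set V) := fun i y hy => by simpa using hx' i y hy
  have : Function.Injective fun i =>
      (G.induce {x | x ≠ a ∧ x ≠ b}).connectedComponentMk ⟨x i, hx' i _ (hx i)⟩ := by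
    intro i j hij
    by_contra hne
    have := reachable_induce_iff.1 (ConnectedComponent.exact hij)
    refine hK (isMinorOf_K4_of_joins hab hI hdis (connSet_compSet (hx2 i _ (hx i))) ?_ ?_ hne
      (subset_compSet (hI i).conn (hx2 i) (hx i) (mem_compSet_self (hx2 i _ (hx i)))) (hx j) this)
    · exact fun h => notMem_of_mem_compSet h (Or.inl rfl)
    · exact fun h => notMem_of_mem_compSet h (Or.inr rfl)
  simpa using Nat.card_le_card_of_injective _ this

/-- The cell completion of a `2`-connected graph without `K₄` minor has no `K₄` minor, and all its
theta pairs are theta pairs of the original graph. -/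
theorem cellCompletion_spec [Finite V] (h2 : ∀ v, ConnSet G {x | x ≠ v})
    (hK : ¬ IsMinorOf K4 G) : G ≤ cellCompletion G ∧ ¬ IsMinorOf K4 (cellCompletion G) ∧
      (∀ c d, Theta (cellCompletion G) c d → Theta G c d) ∧
      (∀ c d, Theta (cellCompletion G) c d → (cellCompletion G).Adj c d) ∧
      ∀ c d, (cellCompletion G).Adj c d → G.Adj c d ∨ Theta G c d := by
  have hadj : ∀ c d, (cellCompletion G).Adj c d ↔ G.Adj c d ∨ Theta G c d := by
    intro c d
    rw [cellCompletion, fromRel_adj]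
    constructor
    · rintro ⟨hne, (h | h) | (h | h)⟩
      exacts [Or.inl h, Or.inr (theta_of_three_components h2 hne h), Or.inl h.symm,
        Or.inr (theta_of_three_components h2 hne.symm h).symm]
    · rintro (h | h)
      exacts [⟨h.ne, Or.inl (Or.inl h)⟩, ⟨h.1, Or.inl (Or.inr (h.three_components hK))⟩]
  have hle : G ≤ cellCompletion G := fun c d h => (hadj c d).2 (Or.inl h)
  obtain ⟨G1, -, ⟨hle1, hle2, hK1, hT1⟩, hmax⟩ := Set.Finite.exists_le_maximal
    (s := {G1 : SimpleGraph V | G ≤ G1 ∧ G1 ≤ cellCompletion G ∧ ¬ IsMinorOf K4 G1 ∧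
      ∀ c d, Theta G1 c d → Theta G c d}) (Set.toFinite _) (a := G)
    ⟨le_rfl, hle, hK, fun _ _ h => h⟩
  have heq : G1 = cellCompletion G := by
    refine le_antisymm hle2 fun a b hab => ?_
    rcases (hadj a b).1 hab with h | h
    · exact hle1 h
    · have h1 := h.mono hle1
      have : G1 ⊔ edge a b ≤ G1 := hmax (y := G1 ⊔ edge a b) ⟨hle1.trans le_sup_left, ?_,
        h1.not_isMinorOf_K4_sup_edge hK1, fun c d hcd => hT1 c d (h1.of_sup_edge hK1 hcd)⟩ le_sup_left
      · exact this (Or.inr ((edge_adj ..).2 ⟨Or.inl ⟨rfl, rfl⟩, h.1⟩))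
      · refine sup_le hle2 fun c d hcd => ?_
        rw [edge_adj] at hcd
        rcases hcd with ⟨⟨rfl, rfl⟩ | ⟨rfl, rfl⟩, -⟩
        exacts [hab, hab.symm]
  subst heq
  exact ⟨hle, hK1, hT1, fun c d h => (hadj c d).2 (Or.inr (hT1 c d h)), fun c d => (hadj c d).1⟩

end AddEdge

theorem cycGraph_adj_iff {n : ℕ} (hn : 3 ≤ n) (a b : ZMod n) :
    (cycGraph n).Adj a b ↔ a.val + 1 = b.val ∨ b.val + 1 = a.val ∨ (a.val = 0 ∧ b.val + 1 = n) ∨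
      (b.val = 0 ∧ a.val + 1 = n) := by
  have : NeZero n := ⟨by omega⟩
  have : Fact (1 < n) := ⟨by omega⟩
  have key : ∀ a b : ZMod n, a = b + 1 ↔ b.val + 1 = a.val ∨ (a.val = 0 ∧ b.val + 1 = n) := by
    intro a b
    rw [← (ZMod.val_injective n).eq_iff, ZMod.val_add, ZMod.val_one]
    have ha := ZMod.val_lt a
    have hb := ZMod.val_lt b
    by_cases h : b.val + 1 = n
    · rw [h, Nat.mod_self]; omega
    · rw [Nat.mod_eq_of_lt (by omega)]; omega
  rw [cycGraph, fromRel_adj, key, key, ← (ZMod.val_injective n).ne_iff]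
  omega

/-- The vertices `x 0, …, x (n - 1)` form a chordless cycle, in this order. -/
structure CycSeq {V : Type} (H : SimpleGraph V) (n : ℕ) (x : ℕ → V) : Prop where
  three_le : 3 ≤ n
  inj : ∀ i < n, ∀ j < n, x i = x j → i = j
  adj : ∀ i < n, ∀ j < n, (H.Adj (x i) (x j) ↔ i + 1 = j ∨ j + 1 = i ∨ (i = 0 ∧ j + 1 = n) ∨
    (j = 0 ∧ i + 1 = n))

section CycSeq

variable {V : Type} {H : SimpleGraph V}

theorem CycSeq.nonempty_iso {n : ℕ} {x : ℕ → V} (h : CycSeq H n x) :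
    Nonempty (H.induce (x '' Set.Iio n) ≃g cycGraph n) := by
  have h3 := h.three_le
  have : NeZero n := ⟨by omega⟩
  have hlt := fun z : ZMod n => ZMod.val_lt z
  refine ⟨RelIso.symm ⟨Equiv.ofBijective (fun z => ⟨x z.val, z.val, hlt z, rfl⟩) ⟨?_, ?_⟩, ?_⟩⟩
  · intro z w hzw
    exact ZMod.val_injective n (h.inj _ (hlt z) _ (hlt w) (Subtype.ext_iff.1 hzw))
  · rintro ⟨_, i, hi, rfl⟩
    refine ⟨(i : ZMod n), Subtype.ext ?_⟩
    simp only [ZMod.val_cast_of_lt hi]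
  · intro a b
    rw [cycGraph_adj_iff h3]
    exact h.adj _ (hlt a) _ (hlt b)

theorem CycSeq.isChordlessCycle {n : ℕ} {x : ℕ → V} (h : CycSeq H n x) :
    IsChordlessCycle H (x '' Set.Iio n) :=
  ⟨n, h.three_le, h.nonempty_iso⟩

theorem cycSeq_of_iso {n : ℕ} (hn : 3 ≤ n) {S : Set V} (e : cycGraph n ≃g H.induce S) :
    CycSeq H n (fun i => (e (i : ZMod n)).1) ∧
      S = (fun i : ℕ => (e (i : ZMod n)).1) '' Set.Iio n := by
  have : NeZero n := ⟨by omega⟩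
  refine ⟨⟨hn, ?_, ?_⟩, ?_⟩
  · intro i hi j hj hij
    have := e.injective (Subtype.ext hij)
    rw [← ZMod.val_cast_of_lt hi, this, ZMod.val_cast_of_lt hj]
  · intro i hi j hj
    have : H.Adj (e (i : ZMod n)).1 (e (j : ZMod n)).1 ↔ (cycGraph n).Adj (i : ZMod n) j :=
      e.map_adj_iff
    rw [this, cycGraph_adj_iff hn, ZMod.val_cast_of_lt hi, ZMod.val_cast_of_lt hj]
  · ext v
    constructor
    · intro hv
      refine ⟨(e.symm ⟨v, hv⟩).val, ZMod.val_lt _, ?_⟩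
      simp
    · rintro ⟨i, -, rfl⟩
      exact (e _).2

theorem cycGraph_adj_of {n : ℕ} {a b : ZMod n} (h : (cycGraph n).Adj a b) :
    b = a + 1 ∨ b = a - 1 := by
  rw [cycGraph, fromRel_adj] at h
  rcases h.2 with h | h
  · exact Or.inr (by rw [h]; ring)
  · exact Or.inl h

theorem cycGraph_adj_add_one {n : ℕ} (hn : 3 ≤ n) (c : ZMod n) : (cycGraph n).Adj c (c + 1) := by
  have : Fact (1 < n) := ⟨by omega⟩
  rw [cycGraph, fromRel_adj]
  exact ⟨by simp, Or.inr rfl⟩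

theorem exists_cycGraph_iso {n : ℕ} {c d : ZMod n} (h : (cycGraph n).Adj c d) :
    ∃ r : cycGraph n ≃g cycGraph n, r 0 = c ∧ r 1 = d := by
  rcases cycGraph_adj_of h with rfl | rfl
  · refine ⟨⟨Equiv.addRight c, ?_⟩, zero_add c, add_comm 1 c⟩
    intro z w
    have h1 : ∀ z w : ZMod n, z + c = w + c + 1 ↔ z = w + 1 := by
      intro z w
      constructor <;> intro h <;> linear_combination h
    simp only [cycGraph, fromRel_adj, Equiv.coe_addRight, ne_eq, add_left_inj, h1]
  · refine ⟨⟨Equiv.subLeft c, ?_⟩, sub_zero c, rfl⟩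
    intro z w
    have h1 : ∀ z w : ZMod n, c - z = c - w + 1 ↔ w = z + 1 := by
      intro z w
      constructor <;> intro h <;> linear_combination h
    simp only [cycGraph, fromRel_adj, Equiv.subLeft_apply, ne_eq, sub_right_inj, h1]
    rw [or_comm]

theorem IsChordlessCycle.exists_cycSeq_of_adj {S : Set V} (hS : IsChordlessCycle H S) {a b : V}
    (ha : a ∈ S) (hb : b ∈ S) (hab : H.Adj a b) :
    ∃ n x, CycSeq H n x ∧ S = x '' Set.Iio n ∧ x 0 = a ∧ x 1 = b := by
  obtain ⟨n, hn, ⟨e⟩⟩ := hS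
  have hadj : (cycGraph n).Adj (e ⟨a, ha⟩) (e ⟨b, hb⟩) := e.map_adj_iff.2 hab
  obtain ⟨r, hr0, hr1⟩ := exists_cycGraph_iso hadj
  obtain ⟨h1, h2⟩ := cycSeq_of_iso hn (r.trans e.symm)
  exact ⟨n, _, h1, h2, by simp [hr0], by simp [hr1]⟩

theorem IsChordlessCycle.exists_cycSeq {S : Set V} (hS : IsChordlessCycle H S) {a : V}
    (ha : a ∈ S) : ∃ n x, CycSeq H n x ∧ S = x '' Set.Iio n ∧ x 0 = a := by
  obtain ⟨n, hn, ⟨e⟩⟩ := hS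
  have hadj := cycGraph_adj_add_one hn (e ⟨a, ha⟩)
  obtain ⟨n', x, h1, h2, h3, -⟩ := IsChordlessCycle.exists_cycSeq_of_adj ⟨n, hn, ⟨e⟩⟩ ha
    (b := (e.symm (e ⟨a, ha⟩ + 1)).1) (e.symm _).2 (by
      have := (e.symm.map_adj_iff).2 hadj
      rw [e.symm_apply_apply] at this
      exact this)
  exact ⟨n', x, h1, h2, h3⟩

theorem CycSeq.connSet_segment {n : ℕ} {x : ℕ → V} (h : CycSeq H n x) {i j : ℕ} (hij : i ≤ j)
    (hj : j < n) : ConnSet H (x '' Set.Icc i j) := by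
  induction j, hij using Nat.le_induction with
  | base => simpa using ConnSet.singleton (x i)
  | succ j hij ih =>
    have : Set.Icc i (j + 1) = insert (j + 1) (Set.Icc i j) := by
      ext k
      simp only [Set.mem_Icc, Set.mem_insert_iff]
      omega
    rw [this, Set.image_insert_eq]
    refine (ih (by omega)).insert_of_adj (u := x j) ⟨j, ⟨hij, le_rfl⟩, rfl⟩ ?_
    exact (h.adj _ hj _ (by omega)).2 (by simp)

theorem IsChordlessCycle.connSet_diff_singleton {S : Set V} (hS : IsChordlessCycle H S) {a : V}
    (ha : a ∈ S) : ConnSet H (S \ {a}) := by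
  obtain ⟨n, x, h, rfl, rfl⟩ := hS.exists_cycSeq ha
  have h3 := h.three_le
  convert h.connSet_segment (i := 1) (j := n - 1) (by omega) (by omega) using 1
  ext v
  constructor
  · rintro ⟨⟨i, hi, rfl⟩, h0⟩
    rw [Set.mem_Iio] at hi
    refine ⟨i, ⟨?_, by omega⟩, rfl⟩
    by_contra hi0
    obtain rfl : i = 0 := by omega
    exact h0 rfl
  · rintro ⟨i, ⟨hi, hi'⟩, rfl⟩
    refine ⟨⟨i, by simp; omega, rfl⟩, fun h0 => ?_⟩
    have := h.inj i (by omega) 0 (by omega) h0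
    omega

theorem IsChordlessCycle.joins_of_adj {S : Set V} (hS : IsChordlessCycle H S) {a b : V}
    (ha : a ∈ S) (hb : b ∈ S) (hab : H.Adj a b) : Joins H a b (S \ {a, b}) := by
  obtain ⟨n, x, h, rfl, rfl, rfl⟩ := hS.exists_cycSeq_of_adj ha hb hab
  have h3 := h.three_le
  have hmem : ∀ i, 2 ≤ i → i < n → x i ∈ x '' Set.Iio n \ {x 0, x 1} := by
    intro i hi hin
    refine ⟨⟨i, hin, rfl⟩, ?_⟩
    rintro (h0 | h0)
    · have := h.inj i (by omega) 0 (by omega) h0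
      omega
    · have := h.inj i (by omega) 1 (by omega) h0
      omega
  refine ⟨?_, by simp, by simp, ⟨x (n - 1), hmem _ (by omega) (by omega), ?_⟩,
    ⟨x 2, hmem _ (by omega) (by omega), ?_⟩⟩
  · convert h.connSet_segment (i := 2) (j := n - 1) (by omega) (by omega) using 1
    ext v
    constructor
    · rintro ⟨⟨i, hi, rfl⟩, h0⟩
      rw [Set.mem_Iio] at hi
      refine ⟨i, ⟨?_, by omega⟩, rfl⟩
      by_contra hi0
      have : i = 0 ∨ i = 1 := by omega
      rcases this with rfl | rfl <;> simp at h0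
    · rintro ⟨i, ⟨hi, hi'⟩, rfl⟩
      exact hmem i hi (by omega)
  · rw [h.adj _ (by omega) _ (by omega)]; omega
  · rw [h.adj _ (by omega) _ (by omega)]; omega

theorem IsChordlessCycle.exists_arcs {S : Set V} (hS : IsChordlessCycle H S) {a b : V}
    (ha : a ∈ S) (hb : b ∈ S) (hne : a ≠ b) (hab : ¬ H.Adj a b) :
    ∃ I J, Joins H a b I ∧ Joins H a b J ∧ (∀ z ∈ I, z ∉ J) ∧ I ⊆ S ∧ J ⊆ S := by
  obtain ⟨n, x, h, rfl, rfl⟩ := hS.exists_cycSeq ha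
  obtain ⟨k, hk, rfl⟩ := hb
  rw [Set.mem_Iio] at hk
  have h3 := h.three_le
  rw [h.adj _ (by omega) _ hk] at hab
  have hk0 : k ≠ 0 := fun h => hne (by rw [h])
  have hinj : ∀ i j, i ≤ j → j < n → ∀ m < n, x m ∈ x '' Set.Icc i j → i ≤ m ∧ m ≤ j := by
    rintro i j hij hj m hm ⟨l, hl, hlm⟩
    obtain rfl := h.inj l (hl.2.trans_lt hj) m hm hlm
    exact hl
  refine ⟨x '' Set.Icc 1 (k - 1), x '' Set.Icc (k + 1) (n - 1),
    ⟨h.connSet_segment (by omega) (by omega), ?_, ?_, ⟨x 1, ⟨1, by simp; omega, rfl⟩, ?_⟩,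
      ⟨x (k - 1), ⟨k - 1, by simp; omega, rfl⟩, ?_⟩⟩,
    ⟨h.connSet_segment (by omega) (by omega), ?_, ?_,
      ⟨x (n - 1), ⟨n - 1, by simp; omega, rfl⟩, ?_⟩, ⟨x (k + 1), ⟨k + 1, by simp; omega, rfl⟩, ?_⟩⟩,
    ?_, ?_, ?_⟩
  · intro h0; have := hinj _ _ (by omega) (by omega) 0 (by omega) h0; omega
  · intro h0; have := hinj _ _ (by omega) (by omega) k (by omega) h0; omega
  · rw [h.adj _ (by omega) _ (by omega)]; omega
  · rw [h.adj _ (by omega) _ (by omega)]; omega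
  · intro h0; have := hinj _ _ (by omega) (by omega) 0 (by omega) h0; omega
  · intro h0; have := hinj _ _ (by omega) (by omega) k (by omega) h0; omega
  · rw [h.adj _ (by omega) _ (by omega)]; omega
  · rw [h.adj _ (by omega) _ (by omega)]; omega
  · rintro _ ⟨i, ⟨hi, hi'⟩, rfl⟩ h0
    have := hinj _ _ (by omega) (by omega) i (by omega) h0
    omega
  · refine Set.image_mono fun i hi => ?_
    simp only [Set.mem_Icc, Set.mem_Iio] at *
    omega
  · refine Set.image_mono fun i hi => ?_
    simp only [Set.mem_Icc, Set.mem_Iio] at *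
    omega

theorem isChordlessCycle_of_degree_two [Finite V] {S : Set V} (hS : ConnSet H S)
    (hdeg : ∀ v ∈ S, {w | w ∈ S ∧ H.Adj v w}.ncard = 2) : IsChordlessCycle H S := by
  set K := H.induce S with hK
  have hdeg' : ∀ v : S, (K.neighborSet v).ncard = 2 := by
    intro v
    rw [← Set.ncard_image_of_injective _ Subtype.val_injective, ← hdeg v v.2]
    congr 1
    ext w
    constructor
    · rintro ⟨w, hw, rfl⟩
      exact ⟨w.2, hw⟩
    · rintro ⟨hw, hvw⟩
      exact ⟨⟨w, hw⟩, hvw, rfl⟩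
  obtain ⟨v0, hv0⟩ := hS.1
  have hcyc : K.IsCycles := fun v _ => hdeg' v
  have hconn := ConnSet.iff_induce.1 hS
  obtain ⟨p, hp, hpv⟩ := hcyc.exists_cycle_toSubgraph_verts_eq_connectedComponentSupp
    (v := ⟨v0, hv0⟩) (c := K.connectedComponentMk ⟨v0, hv0⟩) rfl (by
      refine Set.nonempty_of_ncard_ne_zero ?_
      rw [hdeg']; simp)
  have hall : ∀ w : S, w ∈ p.support := by
    intro w
    rw [← Walk.mem_verts_toSubgraph, hpv]
    exact ConnectedComponent.sound (hconn.preconnected w _)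
  have h3 := hp.three_le_length
  have hinj : ∀ i < p.length, ∀ j < p.length, p.getVert i = p.getVert j → i = j :=
    fun i hi j hj hij => hp.getVert_injOn' (by simp; omega) (by simp; omega) hij
  have hlast : p.getVert p.length = p.getVert 0 := by simp
  have hnb : ∀ i < p.length, ∀ j < p.length, ∀ k < p.length, j ≠ k →
      K.Adj (p.getVert i) (p.getVert j) → K.Adj (p.getVert i) (p.getVert k) →
      ∀ m < p.length, K.Adj (p.getVert i) (p.getVert m) → m = j ∨ m = k := by
    intro i hi j hj k hk hjk h1 h2 m hm h
    by_contra! hcon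
    have h3 : ({p.getVert j, p.getVert k, p.getVert m} : Set S).ncard = 3 := by
      rw [Set.ncard_eq_three]
      exact ⟨_, _, _, fun h => hjk (hinj _ hj _ hk h), fun h => hcon.1 (hinj _ hj _ hm h).symm,
        fun h => hcon.2 (hinj _ hk _ hm h).symm, rfl⟩
    have := Set.ncard_le_ncard (s := {p.getVert j, p.getVert k, p.getVert m})
      (t := K.neighborSet (p.getVert i)) (by rintro z (rfl | rfl | rfl) <;> assumption)
      (Set.toFinite _)
    rw [hdeg'] at this
    omega
  have hsucc : ∀ i, i + 1 < p.length → K.Adj (p.getVert i) (p.getVert (i + 1)) := fun i hi =>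
    p.adj_getVert_succ (by omega)
  have hl : K.Adj (p.getVert (p.length - 1)) (p.getVert 0) := by
    have := p.adj_getVert_succ (i := p.length - 1) (by omega)
    rwa [Nat.sub_add_cancel (by omega), hlast] at this
  have hlt : ∀ i j, i < j → j < p.length →
      (K.Adj (p.getVert i) (p.getVert j) ↔ i + 1 = j ∨ (i = 0 ∧ j + 1 = p.length)) := by
    intro i j hij hj
    constructor
    · intro h
      rcases Nat.eq_zero_or_pos i with rfl | hi
      · rcases hnb 0 (by omega) 1 (by omega) (p.length - 1) (by omega) (by omega)
          (hsucc 0 (by omega)) hl.symm j hj h with h | h <;> omega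
      · have h1 := hsucc (i - 1) (by omega)
        rw [Nat.sub_add_cancel hi] at h1
        rcases hnb i (by omega) (i - 1) (by omega) (i + 1) (by omega) (by omega)
          h1.symm (hsucc i (by omega)) j hj h with h | h <;> omega
    · rintro (rfl | ⟨rfl, h⟩)
      · exact hsucc i hj
      · obtain rfl : j = p.length - 1 := by omega
        exact hl.symm
  have hseq : CycSeq H p.length (fun i => (p.getVert i).1) := by
    refine ⟨h3, fun i hi j hj hij => hinj i hi j hj (Subtype.ext hij), fun i hi j hj => ?_⟩
    change K.Adj (p.getVert i) (p.getVert j) ↔ _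
    rcases lt_trichotomy i j with h | rfl | h
    · rw [hlt i j h hj]; omega
    · have : ¬ K.Adj (p.getVert i) (p.getVert i) := K.loopless.irrefl _
      simp only [this, false_iff]; omega
    · rw [adj_comm, hlt j i h hi]; omega
  convert hseq.isChordlessCycle
  ext v
  constructor
  · intro hv
    obtain ⟨i, hi, hil⟩ := Walk.mem_support_iff_exists_getVert.1 (hall ⟨v, hv⟩)
    rcases hil.lt_or_eq with h | h
    · exact ⟨i, h, by simp only [hi]⟩
    · refine ⟨0, by simp; omega, ?_⟩
      rw [h, hlast] at hi
      simp only [hi]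
  · rintro ⟨i, -, rfl⟩
    exact (p.getVert i).2

end CycSeq

/-- The sets of vertices obtained by successively gluing chordless cycles of `H` along edges. -/
inductive CycleTree {V : Type} (H : SimpleGraph V) : Set V → Prop
  | cycle {S : Set V} (hS : IsChordlessCycle H S) : CycleTree H S
  | glue {A S : Set V} {a b : V} (hA : CycleTree H A) (hS : IsChordlessCycle H S)
      (hab : H.Adj a b) (hAS : A ∩ S = {a, b})
      (hcross : ∀ x ∈ A, ∀ y ∈ S, x ∉ S → y ∉ A → ¬ H.Adj x y) : CycleTree H (A ∪ S)

/-- `A` has at least three vertices and stays connected when any one vertex is deleted. -/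
def TwoConnSet {V : Type} (H : SimpleGraph V) (A : Set V) : Prop :=
  3 ≤ A.ncard ∧ ∀ v ∈ A, ConnSet H (A \ {v})

/-- The edge `ab` separates the set `A` into the nonempty parts `C` and `D`. -/
structure EdgeSep {V : Type} (H : SimpleGraph V) (A : Set V) (a b : V) (C D : Set V) : Prop where
  adj : H.Adj a b
  mem_iff : ∀ x, x ∈ A ↔ x = a ∨ x = b ∨ x ∈ C ∨ x ∈ D
  left_notMem : a ∉ C ∧ a ∉ D
  right_notMem : b ∉ C ∧ b ∉ D
  disj : ∀ x ∈ C, x ∉ D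
  nonempty : C.Nonempty ∧ D.Nonempty
  not_adj : ∀ x ∈ C, ∀ y ∈ D, ¬ H.Adj x y

section

variable {V : Type} {H : SimpleGraph V} {A C D : Set V} {a b : V}

theorem EdgeSep.symm (h : EdgeSep H A a b C D) : EdgeSep H A a b D C :=
  ⟨h.adj, fun x => by rw [h.mem_iff]; tauto, h.left_notMem.symm, h.right_notMem.symm,
    fun x hD hC => h.disj x hC hD, h.nonempty.symm, fun x hx y hy hxy => h.not_adj y hy x hx hxy.symm⟩

theorem EdgeSep.twoConnSet [Finite V] (h : EdgeSep H A a b C D) (hA : TwoConnSet H A) :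
    TwoConnSet H (insert a (insert b C)) := by
  obtain ⟨c, hc⟩ := h.nonempty.1
  have hca : c ≠ a := fun e => h.left_notMem.1 (e ▸ hc)
  have hcb : c ≠ b := fun e => h.right_notMem.1 (e ▸ hc)
  have hab := h.adj.ne
  have hsub : ({a, b, c} : Set V) ⊆ insert a (insert b C) := by
    rintro x (rfl | rfl | rfl)
    · simp
    · simp
    · simp [hc]
  have h3 : ({a, b, c} : Set V).ncard = 3 :=
    Set.ncard_eq_three.2 ⟨a, b, c, hab, hca.symm, hcb.symm, rfl⟩
  refine ⟨h3 ▸ Set.ncard_le_ncard hsub (Set.toFinite _), fun v hv => ?_⟩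
  have hvA : v ∈ A := by
    rw [h.mem_iff]
    rcases hv with rfl | rfl | hv <;> tauto
  have heq : insert a (insert b C) \ {v} = (A \ {v}) \ D := by
    ext x
    have := h.mem_iff x
    have h1 : x = a → x ∉ D := fun e => e ▸ h.left_notMem.2
    have h2 : x = b → x ∉ D := fun e => e ▸ h.right_notMem.2
    have h3 := h.disj x
    simp only [Set.mem_sdiff, Set.mem_insert_iff, Set.mem_singleton_iff]
    tauto
  rw [heq]
  refine (hA.2 v hvA).diff_hanging (K := {a, b}) ?_ ?_ ?_
  · rw [← heq]
    by_cases h1 : a = v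
    · exact ⟨b, by simp, fun e => hab (h1.trans (Eq.symm e))⟩
    · exact ⟨a, by simp, h1⟩
  · rintro x hx y ⟨⟨hy, -⟩, hyD⟩ hxy
    rcases (h.mem_iff y).1 hy with rfl | rfl | hy | hy
    · simp
    · simp
    · exact absurd hxy.symm (h.not_adj y hy x hx)
    · exact absurd hy hyD
  · rintro x (rfl | rfl) y (rfl | rfl) - - hne
    · exact absurd rfl hne
    · exact h.adj
    · exact h.adj.symm
    · exact absurd rfl hne

theorem exists_edgeSep [Finite V] (hK : ¬ IsMinorOf K4 H) (hsat : ∀ c d, Theta H c d → H.Adj c d)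
    (hA : TwoConnSet H A) {c : V} (hc : c ∈ A) (hdeg : 3 ≤ {w | w ∈ A ∧ H.Adj c w}.ncard) :
    ∃ a b C D, EdgeSep H A a b C D := by
  obtain ⟨t, ht, ht3⟩ := Set.exists_subset_card_eq hdeg
  obtain ⟨u0, u1, u2, h01, h02, h12, rfl⟩ := Set.ncard_eq_three.1 ht3
  set u : Fin 3 → V := ![u0, u1, u2] with hu
  have hinj : ∀ i j, u i = u j → i = j := by
    intro i j hij
    fin_cases i <;> fin_cases j <;> simp_all
  have huA : ∀ i, u i ∈ A ∧ H.Adj c (u i) := by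
    intro i
    fin_cases i <;> exact ht (by simp [hu])
  obtain ⟨d, hd, I, hIS, hdis, hI⟩ := exists_median (hA.2 c hc) u
    (fun i => ⟨(huA i).1, (huA i).2.ne'⟩)
  have hcd : c ≠ d := fun e => hd.2 e.symm
  have hj : ∀ i, u i = d ∨ Joins H c d (I i) := by
    intro i
    rcases hI i with h | ⟨h1, h2, h3⟩
    · exact Or.inl h.1
    · exact Or.inr ⟨h2, fun h => (hIS i h).1.2 rfl, fun h => (hIS i h).2 rfl,
        ⟨_, h1, (huA i).2⟩, h3⟩
  have key : H.Adj c d ∧ ∃ i j, i ≠ j ∧ Joins H c d (I i) ∧ Joins H c d (I j) := by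
    by_cases hex : ∃ i, u i = d
    · obtain ⟨i, hi⟩ := hex
      refine ⟨hi ▸ (huA i).2, i + 1, i + 2, by fin_cases i <;> decide, ?_, ?_⟩
      · refine (hj _).resolve_left fun h => ?_
        have := hinj _ _ (h.trans hi.symm)
        revert this; fin_cases i <;> decide
      · refine (hj _).resolve_left fun h => ?_
        have := hinj _ _ (h.trans hi.symm)
        revert this; fin_cases i <;> decide
    · have hall : ∀ i, Joins H c d (I i) := fun i => (hj i).resolve_left fun h => hex ⟨i, h⟩
      exact ⟨hsat c d ⟨hcd, I, hall, hdis⟩, 0, 1, by decide, hall 0, hall 1⟩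
  obtain ⟨hadj, i, j, hij, hIi, hIj⟩ := key
  obtain ⟨x, hx⟩ := hIi.conn.1
  obtain ⟨y, hy⟩ := hIj.conn.1
  set Z : Set V := {z | ¬ (z ∈ A ∧ z ≠ c ∧ z ≠ d)} with hZ
  have hIZ : ∀ k, ∀ z ∈ I k, z ∉ Z := fun k z hz h => h ⟨(hIS k hz).1.1, (hIS k hz).1.2, (hIS k hz).2⟩
  have hCZ : ∀ z ∈ compSet H Z x, z ∈ A ∧ z ≠ c ∧ z ≠ d := fun z hz =>
    not_not.1 (notMem_of_mem_compSet hz)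
  have hxC : x ∈ compSet H Z x := mem_compSet_self (hIZ i x hx)
  refine ⟨c, d, compSet H Z x, {z | z ∈ A ∧ z ≠ c ∧ z ≠ d ∧ z ∉ compSet H Z x}, hadj, ?_, ?_, ?_, ?_,
    ⟨⟨x, hxC⟩, y, (hIS j hy).1.1, (hIS j hy).1.2, (hIS j hy).2, ?_⟩, ?_⟩
  · intro z
    constructor
    · intro hz
      simp only [Set.mem_ofPred_eq]
      tauto
    · rintro (rfl | rfl | h | h)
      exacts [hc, hd.1, (hCZ z h).1, h.1]
  · exact ⟨fun h => (hCZ _ h).2.1 rfl, fun h => h.2.1 rfl⟩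
  · exact ⟨fun h => (hCZ _ h).2.2 rfl, fun h => h.2.2.1 rfl⟩
  · exact fun z hz h => h.2.2.2 hz
  · intro hyC
    exact hK (isMinorOf_K4_of_joins_adj hadj hIi hIj (fun z hz hz' => hij (hdis i j z hz hz'))
      (connSet_compSet (hIZ i x hx)) (fun h => (hCZ _ h).2.1 rfl) (fun h => (hCZ _ h).2.2 rfl)
      (subset_compSet hIi.conn (hIZ i) hx hxC) hy hyC)
  · rintro z hz w ⟨hwA, hwc, hwd, hwC⟩ hzw
    exact hwC (mem_compSet_of_adj hz hzw fun h => h ⟨hwA, hwc, hwd⟩)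

theorem TwoConnSet.isChordlessCycle [Finite V] (hA : TwoConnSet H A)
    (hdeg : ∀ c ∈ A, {w | w ∈ A ∧ H.Adj c w}.ncard ≤ 2) : IsChordlessCycle H A := by
  have hex : ∀ v ∈ A, ∀ T : Set V, T.ncard ≤ 2 → ∃ w ∈ A, w ∉ T := by
    intro v hv T hT
    by_contra! hcon
    have := Set.ncard_le_ncard (s := A) (t := T) hcon (Set.toFinite _)
    have := hA.1
    omega
  have h2 : ∀ v w : V, ({v, w} : Set V).ncard ≤ 2 := fun v w => by
    simpa using Set.ncard_insert_le v {w}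
  have hnb : ∀ v ∈ A, ∀ z, z ≠ v → ∃ w ∈ A, w ≠ z ∧ H.Adj v w := by
    intro v hv z hz
    have hp : ({v, z} : Set V).ncard ≤ 2 := h2 v z
    obtain ⟨w, hw, hwT⟩ := hex v hv {v, z} hp
    simp only [Set.mem_insert_iff, Set.mem_singleton_iff, not_or] at hwT
    by_cases hzA : z ∈ A
    · obtain ⟨p, hp, rfl, q, hq, -, hpq⟩ := (hA.2 z hzA).cross {v} (x := v) ⟨hv, hz.symm⟩ rfl
        (y := w) ⟨hw, hwT.2⟩ hwT.1
      exact ⟨q, hq.1, hq.2, hpq⟩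
    · obtain ⟨w', hw', hwT'⟩ := hex v hv {v, w} (h2 v w)
      simp only [Set.mem_insert_iff, Set.mem_singleton_iff, not_or] at hwT'
      obtain ⟨p, hp, rfl, q, hq, -, hpq⟩ := (hA.2 w hw).cross {v} (x := v)
        ⟨hv, Ne.symm hwT.1⟩ rfl (y := w') ⟨hw', hwT'.2⟩ hwT'.1
      exact ⟨q, hq.1, fun e => hzA (e ▸ hq.1), hpq⟩
  refine isChordlessCycle_of_degree_two ?_ ?_
  · obtain ⟨v, hv, -⟩ : ∃ v ∈ A, True := by
      have := Set.nonempty_of_ncard_ne_zero (s := A) (by have := hA.1; omega)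
      exact this.imp fun v hv => ⟨hv, trivial⟩
    obtain ⟨w, hw, hwv⟩ := hex v hv {v} (by simp)
    obtain ⟨q, hq, -, hvq⟩ := hnb v hv w hwv
    have := (hA.2 v hv).insert_of_adj (u := q) ⟨hq, hvq.ne'⟩ hvq
    rwa [Set.insert_sdiff_singleton, Set.insert_eq_of_mem hv] at this
  · intro v hv
    refine le_antisymm (hdeg v hv) ?_
    obtain ⟨w, hw, hwv⟩ := hex v hv {v} (by simp)
    obtain ⟨p, hp, -, hvp⟩ := hnb v hv w hwv
    obtain ⟨q, hq, hqp, hvq⟩ := hnb v hv p hvp.ne'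
    rw [← Set.ncard_pair hqp]
    refine Set.ncard_le_ncard ?_ (Set.toFinite _)
    rintro x (rfl | rfl)
    exacts [⟨hq, hvq⟩, ⟨hp, hvp⟩]

theorem EdgeSep.refine {a' b' : V} {C' D' : Set V} (h : EdgeSep H A a b C D)
    (h' : EdgeSep H (insert a (insert b C)) a' b' C' D') :
    ∃ a'' b'' C'' D'', EdgeSep H A a'' b'' C'' D'' ∧ C'' ⊂ C := by
  wlog hC' : a ∉ C' ∧ b ∉ C' generalizing C' D'
  · refine this h'.symm ?_
    by_contra hcon
    have h1 : a ∈ C' → b ∉ D' := fun h1 h2 => h'.not_adj _ h1 _ h2 h.adj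
    have h2 : b ∈ C' → a ∉ D' := fun h1 h2 => h'.not_adj _ h1 _ h2 h.adj.symm
    have h3 := h'.disj a
    have h4 := h'.disj b
    tauto
  have hmem := h'.mem_iff
  have hsub : C' ⊆ C := by
    intro x hx
    rcases (hmem x).2 (by simp [hx]) with rfl | rfl | h
    exacts [absurd hx hC'.1, absurd hx hC'.2, h]
  have hA' : ∀ x, x ∈ insert a (insert b C) → x ∈ A := by
    intro x hx
    rw [h.mem_iff]
    rcases hx with rfl | rfl | hx <;> tauto
  refine ⟨a', b', C', {x | x ∈ A ∧ x ≠ a' ∧ x ≠ b' ∧ x ∉ C'}, ⟨h'.adj, ?_, ?_, ?_, ?_, ?_, ?_⟩, hsub, ?_⟩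
  · intro x
    have h1 := hA' x
    rw [hmem] at h1
    simp only [Set.mem_ofPred_eq]
    tauto
  · exact ⟨h'.left_notMem.1, fun h => h.2.1 rfl⟩
  · exact ⟨h'.right_notMem.1, fun h => h.2.2.1 rfl⟩
  · exact fun x hx h => h.2.2.2 hx
  · refine ⟨h'.nonempty.1, ?_⟩
    obtain ⟨z, hz⟩ := h'.nonempty.2
    exact ⟨z, hA' z ((hmem z).2 (by tauto)), fun e => h'.left_notMem.2 (e ▸ hz),
      fun e => h'.right_notMem.2 (e ▸ hz), fun e => h'.disj z e hz⟩
  · rintro x hx y ⟨hyA, hya, hyb, hyC⟩ hxy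
    rcases (h.mem_iff y).1 hyA with rfl | rfl | hy | hy
    · exact h'.not_adj x hx y (by have := (hmem y).1 (by simp); tauto) hxy
    · exact h'.not_adj x hx y (by have := (hmem y).1 (by simp); tauto) hxy
    · exact h'.not_adj x hx y (by have := (hmem y).1 (by simp [hy]); tauto) hxy
    · exact h.not_adj x (hsub hx) y hy hxy
  · intro hCC
    obtain ⟨z, hz⟩ := h'.nonempty.2
    have hCsub : ∀ x ∈ C, x ∈ C' := fun x hx => hCC hx
    have ha' : a' = a ∨ a' = b := by
      rcases (hmem a').2 (by simp) with h1 | h1 | h1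
      exacts [Or.inl h1, Or.inr h1, absurd (hCsub _ h1) h'.left_notMem.1]
    have hb' : b' = a ∨ b' = b := by
      rcases (hmem b').2 (by simp) with h1 | h1 | h1
      exacts [Or.inl h1, Or.inr h1, absurd (hCsub _ h1) h'.right_notMem.1]
    have hne := h'.adj.ne
    have hza : z ≠ a' := fun e => h'.left_notMem.2 (e ▸ hz)
    have hzb : z ≠ b' := fun e => h'.right_notMem.2 (e ▸ hz)
    rcases (hmem z).2 (by simp [hz]) with h1 | h1 | h1
    · subst h1
      rcases ha' with h2 | h2 <;> rcases hb' with h3 | h3 <;> simp_all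
    · subst h1
      rcases ha' with h2 | h2 <;> rcases hb' with h3 | h3 <;> simp_all
    · exact h'.disj z (hCsub z h1) hz

theorem TwoConnSet.cycleTree [Finite V] (hK : ¬ IsMinorOf K4 H)
    (hsat : ∀ c d, Theta H c d → H.Adj c d) (hA : TwoConnSet H A) : CycleTree H A := by
  induction hn : A.ncard using Nat.strong_induction_on generalizing A with
  | _ n ih =>
    subst hn
    by_cases hdeg : ∀ c ∈ A, {w | w ∈ A ∧ H.Adj c w}.ncard ≤ 2
    · exact .cycle (hA.isChordlessCycle hdeg)
    push Not at hdeg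
    obtain ⟨c, hc, hdeg⟩ := hdeg
    obtain ⟨a0, b0, C0, D0, h0⟩ := exists_edgeSep hK hsat hA hc hdeg
    obtain ⟨C, -, ⟨a, b, D, h⟩, hmin⟩ := Set.Finite.exists_le_minimal
      (s := {C | ∃ a b D, EdgeSep H A a b C D}) (Set.toFinite _) ⟨a0, b0, D0, h0⟩
    have hS : IsChordlessCycle H (insert a (insert b C)) := by
      refine (h.twoConnSet hA).isChordlessCycle fun c hc => ?_
      by_contra! hcon
      obtain ⟨a', b', C', D', h'⟩ := exists_edgeSep hK hsat (h.twoConnSet hA) hc hcon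
      obtain ⟨a'', b'', C'', D'', h'', hss⟩ := h.refine h'
      exact hss.2 (hmin ⟨a'', b'', D'', h''⟩ hss.1)
    obtain ⟨x, hx⟩ := h.nonempty.1
    have hxa : x ≠ a := fun e => h.left_notMem.1 (e ▸ hx)
    have hxb : x ≠ b := fun e => h.right_notMem.1 (e ▸ hx)
    have hlt : (insert a (insert b D)).ncard < A.ncard := by
      refine Set.ncard_lt_ncard ⟨fun z hz => ?_, fun hsub => ?_⟩ (Set.toFinite _)
      · rw [h.mem_iff]
        rcases hz with rfl | rfl | hz <;> tauto
      · rcases hsub ((h.mem_iff x).2 (by tauto)) with h1 | h1 | h1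
        exacts [hxa h1, hxb h1, h.disj x hx h1]
    have := ih _ hlt (h.symm.twoConnSet hA) rfl
    have hg := CycleTree.glue this hS h.adj ?_ ?_
    · convert hg using 1
      ext z
      rw [h.mem_iff]
      simp only [Set.mem_union, Set.mem_insert_iff]
      tauto
    · ext z
      have := h.disj z
      simp only [Set.mem_inter_iff, Set.mem_insert_iff, Set.mem_singleton_iff]
      tauto
    · rintro z hz w hw hzS hwD hzw
      simp only [Set.mem_insert_iff, not_or] at *
      exact h.not_adj w (by tauto) z (by tauto) hzw.symm

end

theorem isChordlessCycle_range {V : Type} {H : SimpleGraph V} {n : ℕ} (hn : 3 ≤ n)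
    (f : cycGraph n ↪g H) : IsChordlessCycle H (Set.range f) :=
  ⟨n, hn, ⟨f.isoInduceRange.symm⟩⟩

theorem IsChordlessCycle.image {V W : Type} {G : SimpleGraph V} {H : SimpleGraph W} {S : Set V}
    (hS : IsChordlessCycle G S) (e : G ↪g H) : IsChordlessCycle H (e '' S) := by
  obtain ⟨n, hn, ⟨f⟩⟩ := hS
  have := isChordlessCycle_range hn ((f.symm.toEmbedding.trans (Embedding.induce S)).trans e)
  convert this using 1
  ext z
  constructor
  · rintro ⟨v, hv, rfl⟩
    exact ⟨f ⟨v, hv⟩, by simp⟩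
  · rintro ⟨x, rfl⟩
    exact ⟨_, (f.symm x).2, rfl⟩

theorem CycleTree.image {V W : Type} {G : SimpleGraph V} {H : SimpleGraph W} {A : Set V}
    (hA : CycleTree G A) (e : G ↪g H) : CycleTree H (e '' A) := by
  induction hA with
  | cycle hS => exact .cycle (hS.image e)
  | glue hA hS hab hAS hcross ih =>
    rw [Set.image_union]
    refine .glue ih (hS.image e) (e.map_adj_iff.2 hab) ?_ ?_
    · rw [← Set.image_inter e.injective, hAS, Set.image_pair]
    · rintro _ ⟨x, hx, rfl⟩ _ ⟨y, hy, rfl⟩ hxS hyA h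
      exact hcross x hx y hy (fun h => hxS ⟨x, h, rfl⟩) (fun h => hyA ⟨y, h, rfl⟩)
        (e.map_adj_iff.1 h)

theorem IsTreeOfCycles.of_iso {V W : Type} {G : SimpleGraph V} {H : SimpleGraph W}
    (hG : IsTreeOfCycles G) (e : H ≃g G) : IsTreeOfCycles H := by
  cases hG with
  | cycle _ n hn e' => exact .cycle _ n hn ⟨e.trans e'.some⟩
  | glue G hG n hn a b hab _ e' => exact .glue G hG n hn a b hab _ ⟨e.trans e'.some⟩

section

variable {V : Type} {G : SimpleGraph V} {n : ℕ} {a b : V}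

theorem glueCycle_adj_inl_inl {u v : V} :
    (glueCycle G n a b).Adj (Sum.inl u) (Sum.inl v) ↔ G.Adj u v := by
  rw [glueCycle, fromRel_adj]
  constructor
  · rintro ⟨-, h | h⟩
    exacts [h, h.symm]
  · intro h
    exact ⟨fun e => h.ne (Sum.inl.inj e), Or.inl h⟩

theorem glueCycle_adj_inl_inr {u : V} {x : {x : ZMod n // x ≠ 0 ∧ x ≠ 1}} :
    (glueCycle G n a b).Adj (Sum.inl u) (Sum.inr x) ↔
      (u = a ∧ (cycGraph n).Adj 0 x.1) ∨ (u = b ∧ (cycGraph n).Adj 1 x.1) := by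
  rw [glueCycle, fromRel_adj]
  simp

theorem glueCycle_adj_inr_inr {x y : {x : ZMod n // x ≠ 0 ∧ x ≠ 1}} :
    (glueCycle G n a b).Adj (Sum.inr x) (Sum.inr y) ↔ (cycGraph n).Adj x.1 y.1 := by
  rw [glueCycle, fromRel_adj]
  constructor
  · rintro ⟨-, h | h⟩
    exacts [h, h.symm]
  · intro h
    exact ⟨fun e => h.ne (congrArg Subtype.val (Sum.inr.inj e)), Or.inl h⟩

/-- The glued cycle is an induced subgraph of the result of the gluing. -/
theorem exists_embedding_glueCycle (hn : 3 ≤ n) (hab : G.Adj a b) :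
    ∃ f : cycGraph n ↪g glueCycle G n a b, f 0 = Sum.inl a ∧ f 1 = Sum.inl b ∧
      ∀ x : {x : ZMod n // x ≠ 0 ∧ x ≠ 1}, f x.1 = Sum.inr x := by
  classical
  have hadj01 : (cycGraph n).Adj 0 1 := by simpa using cycGraph_adj_add_one hn 0
  have h01 := hadj01.ne
  let f : ZMod n → V ⊕ {x : ZMod n // x ≠ 0 ∧ x ≠ 1} := fun x =>
    if h0 : x = 0 then Sum.inl a else if h1 : x = 1 then Sum.inl b else Sum.inr ⟨x, h0, h1⟩
  have f0 : f 0 = Sum.inl a := by simp [f]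
  have f1 : f 1 = Sum.inl b := by simp [f, h01.symm]
  have f2 : ∀ x (h0 : x ≠ 0) (h1 : x ≠ 1), f x = Sum.inr ⟨x, h0, h1⟩ := by
    intro x h0 h1
    simp [f, h0, h1]
  have key0 : ∀ y, (glueCycle G n a b).Adj (f 0) (f y) ↔ (cycGraph n).Adj 0 y := by
    intro y
    by_cases h0 : y = 0
    · simp [h0]
    by_cases h1 : y = 1
    · rw [h1, f0, f1, glueCycle_adj_inl_inl]
      exact iff_of_true hab hadj01
    · rw [f0, f2 y h0 h1, glueCycle_adj_inl_inr]
      simp [hab.ne]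
  have key1 : ∀ y, (glueCycle G n a b).Adj (f 1) (f y) ↔ (cycGraph n).Adj 1 y := by
    intro y
    by_cases h0 : y = 0
    · rw [h0, adj_comm, key0, adj_comm]
    by_cases h1 : y = 1
    · simp [h1]
    · rw [f1, f2 y h0 h1, glueCycle_adj_inl_inr]
      simp [hab.ne']
  refine ⟨⟨⟨f, ?_⟩, ?_⟩, f0, f1, fun x => f2 x.1 x.2.1 x.2.2⟩
  · intro x y hxy
    simp only [f] at hxy
    split_ifs at hxy with h1 h2 h3 h4 h5 h6 <;> simp_all [hab.ne, hab.ne']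
  · intro x y
    change (glueCycle G n a b).Adj (f x) (f y) ↔ _
    by_cases h0 : x = 0
    · rw [h0, key0]
    by_cases h1 : x = 1
    · rw [h1, key1]
    by_cases h0' : y = 0
    · rw [h0', adj_comm, key0, adj_comm]
    by_cases h1' : y = 1
    · rw [h1', adj_comm, key1, adj_comm]
    rw [f2 x h0 h1, f2 y h0' h1', glueCycle_adj_inr_inr]

theorem IsTreeOfCycles.cycleTree {V : Type} {G : SimpleGraph V} (hG : IsTreeOfCycles G) :
    CycleTree G Set.univ := by
  induction hG with
  | cycle G n hn e =>
    have := isChordlessCycle_range hn e.some.symm.toEmbedding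
    rw [Set.range_eq_univ.2 (show Function.Surjective e.some.symm.toEmbedding from
      e.some.symm.surjective)] at this
    exact .cycle this
  | @glue V W G hG n hn a b hab H e ih =>
    suffices CycleTree (glueCycle G n a b) Set.univ by
      have := this.image e.some.symm.toEmbedding
      rwa [Set.image_univ, Set.range_eq_univ.2 (show Function.Surjective e.some.symm.toEmbedding from
        e.some.symm.surjective)] at this
    obtain ⟨f, f0, f1, f2⟩ := exists_embedding_glueCycle hn hab
    have hf : ∀ u, Sum.inl u ∈ Set.range f ↔ u = a ∨ u = b := by
      intro u
      constructor
      · rintro ⟨x, hx⟩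
        by_cases h0 : x = 0
        · rw [h0, f0] at hx
          exact Or.inl (Sum.inl.inj hx).symm
        by_cases h1 : x = 1
        · rw [h1, f1] at hx
          exact Or.inr (Sum.inl.inj hx).symm
        · rw [f2 ⟨x, h0, h1⟩] at hx
          cases hx
      · rintro (rfl | rfl)
        exacts [⟨0, f0⟩, ⟨1, f1⟩]
    let i : G ↪g glueCycle G n a b := ⟨⟨Sum.inl, Sum.inl_injective⟩, glueCycle_adj_inl_inl⟩
    have hA : CycleTree (glueCycle G n a b) (Set.range Sum.inl) := by
      rw [← Set.image_univ]
      exact ih.image i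
    have := CycleTree.glue hA (isChordlessCycle_range hn f) (glueCycle_adj_inl_inl.2 hab) ?_ ?_
    · convert this using 1
      refine (Set.eq_univ_of_forall ?_).symm
      rintro (u | x)
      exacts [Or.inl ⟨u, rfl⟩, Or.inr ⟨x.1, f2 x⟩]
    · ext z
      rcases z with u | x
      · simp only [Set.mem_inter_iff, hf]
        simp
      · simp
    · rintro _ ⟨u, rfl⟩ (v | x) hv hu hv'
      · exact absurd ⟨v, rfl⟩ hv'
      · rw [hf, not_or] at hu
        rw [glueCycle_adj_inl_inr]
        tauto

theorem CycleTree.isTreeOfCycles {V : Type} {H : SimpleGraph V} {A : Set V}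
    (hA : CycleTree H A) : IsTreeOfCycles (H.induce A) := by
  induction hA with
  | cycle hS =>
    obtain ⟨n, hn, e⟩ := hS
    exact .cycle _ n hn e
  | @glue A S a b hA hS hab hAS hcross ih =>
    have haA : a ∈ A ∩ S := by simp [hAS]
    have hbA : b ∈ A ∩ S := by simp [hAS]
    obtain ⟨n, hn, ⟨e⟩⟩ := hS
    obtain ⟨r, hr0, hr1⟩ := exists_cycGraph_iso (c := e ⟨a, haA.2⟩) (d := e ⟨b, hbA.2⟩)
      (e.map_adj_iff.2 hab)
    let g : cycGraph n ≃g H.induce S := r.trans e.symm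
    have g0 : (g 0).1 = a := by simp [g, hr0]
    have g1 : (g 1).1 = b := by simp [g, hr1]
    have hg : ∀ x, (g x).1 ∈ A → x = 0 ∨ x = 1 := by
      intro x hx
      have : (g x).1 ∈ A ∩ S := ⟨hx, (g x).2⟩
      rw [hAS] at this
      rcases this with h | h
      · exact Or.inl (g.injective (Subtype.ext (h.trans g0.symm)))
      · exact Or.inr (g.injective (Subtype.ext (Eq.trans h g1.symm)))
    have hga : ∀ x y, H.Adj (g x).1 (g y).1 ↔ (cycGraph n).Adj x y := fun x y => g.map_adj_iff
    let φ : A ⊕ {x : ZMod n // x ≠ 0 ∧ x ≠ 1} → V := Sum.elim Subtype.val fun x => (g x.1).1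
    have hinl : ∀ (u : A) (x : {x : ZMod n // x ≠ 0 ∧ x ≠ 1}), H.Adj u.1 (g x.1).1 ↔
        (glueCycle (H.induce A) n ⟨a, haA.1⟩ ⟨b, hbA.1⟩).Adj (Sum.inl u) (Sum.inr x) := by
      intro u x
      rw [glueCycle_adj_inl_inr, ← hga, ← hga, g0, g1]
      constructor
      · intro h
        by_contra hcon
        have hu : u.1 ∉ S := by
          intro hu
          have : u.1 ∈ A ∩ S := ⟨u.2, hu⟩
          rw [hAS] at this
          rcases this with h1 | h1
          · exact hcon (Or.inl ⟨Subtype.ext h1, h1 ▸ h⟩)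
          · exact hcon (Or.inr ⟨Subtype.ext h1, Set.mem_singleton_iff.1 h1 ▸ h⟩)
        exact hcross u u.2 _ (g x.1).2 hu (fun h => (hg _ h).elim x.2.1 x.2.2) h
      · rintro (⟨rfl, h⟩ | ⟨rfl, h⟩) <;> exact h
    let f : glueCycle (H.induce A) n ⟨a, haA.1⟩ ⟨b, hbA.1⟩ ↪g H := ⟨⟨φ, by
      rintro (u | x) (v | y) h
      · exact congrArg _ (Subtype.ext h)
      · exact absurd (hg y.1 ((show u.1 = (g y.1).1 from h) ▸ u.2)) (by have := y.2; tauto)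
      · exact absurd (hg x.1 ((show (g x.1).1 = v.1 from h) ▸ v.2)) (by have := x.2; tauto)
      · exact congrArg _ (Subtype.ext (g.injective (Subtype.ext h)))⟩, by
      rintro (u | x) (v | y)
      · exact (glueCycle_adj_inl_inl (G := H.induce A)).symm
      · exact hinl u y
      · exact (adj_comm _ _ _).trans ((hinl v x).trans (adj_comm _ _ _))
      · exact (hga _ _).trans glueCycle_adj_inr_inr.symm⟩
    refine .glue (H.induce A) ih n hn ⟨a, haA.1⟩ ⟨b, hbA.1⟩ hab _ ⟨?_⟩
    have hrange : Set.range f = A ∪ S := by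
      ext z
      constructor
      · rintro ⟨u | x, rfl⟩
        exacts [Or.inl u.2, Or.inr (g x.1).2]
      · rintro (hz | hz)
        · exact ⟨Sum.inl ⟨z, hz⟩, rfl⟩
        · by_cases hzA : z ∈ A
          · exact ⟨Sum.inl ⟨z, hzA⟩, rfl⟩
          · have hgz : (g (g.symm ⟨z, hz⟩)).1 = z := by simp
            refine ⟨Sum.inr ⟨g.symm ⟨z, hz⟩, fun h => ?_, fun h => ?_⟩, hgz⟩
            · rw [h, g0] at hgz
              exact hzA (hgz ▸ haA.1)
            · rw [h, g1] at hgz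
              exact hzA (hgz ▸ hbA.1)
    rw [← hrange]
    exact f.isoInduceRange.symm

end

section

variable {V : Type} {H : SimpleGraph V}

/-- Two vertices of a chordless cycle attached to a common outer connected set are adjacent. -/
theorem IsChordlessCycle.adj_of_attached (hsat : ∀ c d, Theta H c d → H.Adj c d) {S K : Set V}
    (hS : IsChordlessCycle H S) (hK : ConnSet H K) (hKS : ∀ z ∈ K, z ∉ S) {c d : V} (hc : c ∈ S)
    (hd : d ∈ S) (hcd : c ≠ d) (hcK : ∃ z ∈ K, H.Adj c z) (hdK : ∃ z ∈ K, H.Adj d z) :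
    H.Adj c d := by
  by_contra hadj
  obtain ⟨I, J, hI, hJ, hIJ, hIS, hJS⟩ := hS.exists_arcs hc hd hcd hadj
  have hKj : Joins H c d K := ⟨hK, fun h => hKS c h hc, fun h => hKS d h hd, hcK, hdK⟩
  refine hadj (hsat c d ⟨hcd, ![I, J, K], ?_, ?_⟩)
  · intro i
    fin_cases i
    exacts [hI, hJ, hKj]
  · intro i j x hi hj
    fin_cases i <;> fin_cases j <;>
      simp only [Fin.zero_eta, Fin.mk_one, Fin.reduceFinMk, Matrix.cons_val_zero,
        Matrix.cons_val_one, Matrix.cons_val] at hi hj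
    exacts [rfl, absurd hj (hIJ x hi), absurd (hIS hi) (hKS x hj), absurd hi (hIJ x hj), rfl,
      absurd (hJS hi) (hKS x hj), absurd (hIS hj) (hKS x hi), absurd (hJS hj) (hKS x hi), rfl]

theorem IsChordlessCycle.subset_pair_of_notMem (hK4 : ¬ IsMinorOf K4 H)
    (hsat : ∀ c d, Theta H c d → H.Adj c d) {S S' : Set V} (hS : IsChordlessCycle H S)
    (hS' : IsChordlessCycle H S') {u v : V} (huv : H.Adj u v) (hu : u ∈ S) (hv : v ∈ S)
    (hu' : u ∈ S') (hv' : v ∈ S') {x : V} (hx : x ∈ S) (hx' : x ∉ S') :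
    ∀ z ∈ S, z ∈ S' → z = u ∨ z = v := by
  set K := compSet H S' x with hKdef
  have hxK : x ∈ K := mem_compSet_self hx'
  have hK : ConnSet H K := connSet_compSet hx'
  have hKS : ∀ z ∈ K, z ∉ S' := fun z hz => notMem_of_mem_compSet hz
  have hadj : ∀ c ∈ S', ∀ d ∈ S', c ≠ d → (∃ z ∈ K, H.Adj c z) → (∃ z ∈ K, H.Adj d z) →
      H.Adj c d := fun c hc d hd => hS'.adj_of_attached hsat hK hKS hc hd
  have hthree : ∀ c ∈ S', ∀ d ∈ S', ∀ e ∈ S', c ≠ d → c ≠ e → d ≠ e → (∃ z ∈ K, H.Adj c z) →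
      (∃ z ∈ K, H.Adj d z) → (∃ z ∈ K, H.Adj e z) → False := by
    rintro c hc d hd e he hcd hce hde hcK hdK heK
    have hh : ∀ c ∈ S', Disjoint {c} K := fun c hc =>
      Set.disjoint_singleton_left.2 fun h => hKS c h hc
    exact hK4 (isMinorOf_K4_of_sets (.singleton c) (.singleton d) (.singleton e) hK
      (by simpa using hcd) (by simpa using hce) (hh c hc) (by simpa using hde) (hh d hd) (hh e he)
      ⟨c, rfl, d, rfl, hadj c hc d hd hcd hcK hdK⟩ ⟨c, rfl, e, rfl, hadj c hc e he hce hcK heK⟩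
      ⟨c, rfl, hcK⟩ ⟨d, rfl, e, rfl, hadj d hd e he hde hdK heK⟩ ⟨d, rfl, hdK⟩ ⟨e, rfl, heK⟩)
  have hleave : ∀ T : Set V, ConnSet H T → x ∈ T → ∀ y ∈ T, y ∉ K →
      ∃ c ∈ T, c ∈ S' ∧ ∃ z ∈ K, H.Adj c z := by
    intro T hT hxT y hyT hyK
    obtain ⟨p, hp, hpK, q, hq, hqK, hpq⟩ := hT.cross K hxT hxK hyT hyK
    refine ⟨q, hq, ?_, p, hpK, hpq.symm⟩
    by_contra hqS
    exact hqK (mem_compSet_of_adj hpK hpq hqS)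
  have hmemN : ∀ u v, u ∈ S → v ∈ S → u ∈ S' → v ∈ S' → u ≠ v → ∃ z ∈ K, H.Adj u z := by
    intro u v hu hv hu' hv' huv
    by_contra hcon
    have huK : u ∉ K := fun h => hKS u h hu'
    have hne : ∀ c, (∃ z ∈ K, H.Adj c z) → u ≠ c := by
      rintro c hc rfl
      exact hcon hc
    have hxne : ∀ c ∈ S', x ≠ c := by
      rintro c hc rfl
      exact hx' hc
    obtain ⟨c, hc, hcS, hcK⟩ := hleave _ (hS.connSet_diff_singleton hv) ⟨hx, hxne v hv'⟩ u
      ⟨hu, huv⟩ huK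
    obtain ⟨d, hd, hdS, hdK⟩ := hleave _ (hS.connSet_diff_singleton hc.1) ⟨hx, hxne c hcS⟩ u
      ⟨hu, hne c hcK⟩ huK
    have hcd := hadj c hcS d hdS (Ne.symm hd.2) hcK hdK
    obtain ⟨e, he, heS, heK⟩ := hleave _ (hS.joins_of_adj hc.1 hd.1 hcd).conn
      ⟨hx, by simp [hxne c hcS, hxne d hdS]⟩ u ⟨hu, by simp [hne c hcK, hne d hdK]⟩ huK
    have he2 := he.2
    simp only [Set.mem_insert_iff, Set.mem_singleton_iff, not_or] at he2
    exact hthree c hcS d hdS e heS hcd.ne (Ne.symm he2.1) (Ne.symm he2.2) hcK hdK heK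
  have huN := hmemN u v hu hv hu' hv' huv.ne
  have hvN := hmemN v u hv hu hv' hu' huv.ne'
  intro z hz hz'
  by_contra! hcon
  obtain ⟨e, he, heS, heK⟩ := hleave _ (hS.joins_of_adj hu hv huv).conn
    ⟨hx, by rintro (rfl | rfl) <;> contradiction⟩ z ⟨hz, by simp [hcon]⟩ fun h => hKS z h hz'
  have he2 := he.2
  simp only [Set.mem_insert_iff, Set.mem_singleton_iff, not_or] at he2
  exact hthree u hu' v hv' e heS huv.ne (Ne.symm he2.1) (Ne.symm he2.2) huN hvN heK

theorem IsChordlessCycle.subset_pair_of_ne (hK4 : ¬ IsMinorOf K4 H)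
    (hsat : ∀ c d, Theta H c d → H.Adj c d) {S S' : Set V} (hS : IsChordlessCycle H S)
    (hS' : IsChordlessCycle H S') (hne : S ≠ S') {u v : V} (huv : H.Adj u v) (hu : u ∈ S)
    (hv : v ∈ S) (hu' : u ∈ S') (hv' : v ∈ S') : ∀ z ∈ S, z ∈ S' → z = u ∨ z = v := by
  by_cases hsub : S ⊆ S'
  · obtain ⟨x, hx', hx⟩ := Set.not_subset.1 fun h => hne (hsub.antisymm h)
    exact fun z hz hz' => hS'.subset_pair_of_notMem hK4 hsat hS huv hu' hv' hu hv hx' hx z hz' hz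
  · obtain ⟨x, hx, hx'⟩ := Set.not_subset.1 hsub
    exact hS.subset_pair_of_notMem hK4 hsat hS' huv hu hv hu' hv' hx hx'

theorem IsChordlessCycle.notMem_compSet (hK4 : ¬ IsMinorOf K4 H)
    (hsat : ∀ c d, Theta H c d → H.Adj c d) {S S' : Set V} (hS : IsChordlessCycle H S)
    (hS' : IsChordlessCycle H S') (hne : S ≠ S') {u v : V} (huv : H.Adj u v) (hu : u ∈ S)
    (hv : v ∈ S) (hu' : u ∈ S') (hv' : v ∈ S') {x y : V} (hx : x ∈ S \ {u, v})
    (hy : y ∈ S' \ {u, v}) : y ∉ compSet H {u, v} x := by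
  intro hyx
  have hD := fun z (hz : z ∈ compSet H {u, v} x) => notMem_of_mem_compSet hz
  have hj := hS.joins_of_adj hu hv huv
  refine hK4 (isMinorOf_K4_of_joins_adj huv hj (hS'.joins_of_adj hu' hv' huv) ?_
    (connSet_compSet hx.2) (fun h => hD u h (by simp)) (fun h => hD v h (by simp))
    (subset_compSet hj.conn (fun z hz => hz.2) hx (mem_compSet_self hx.2)) hy hyx)
  intro z hz hz'
  exact hz.2 (hS.subset_pair_of_ne hK4 hsat hS' hne huv hu hv hu' hv' z hz.1 hz'.1)

theorem IsChordlessCycle.exists_ne_mem_compSet {S : Set V} (hS : IsChordlessCycle H S)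
    (hsimp : ¬ IsSimplicialTriangle H S) {u v : V} (huv : H.Adj u v) (hu : u ∈ S)
    (hv : v ∈ S) {x : V} (hx : x ∈ S \ {u, v}) : ∃ y ∈ compSet H {u, v} x, y ≠ x := by
  by_contra! hcon
  have hj := hS.joins_of_adj hu hv huv
  have hsub : S \ {u, v} ⊆ compSet H {u, v} x :=
    subset_compSet hj.conn (fun z hz => hz.2) hx (mem_compSet_self hx.2)
  have hx2 := hx.2
  simp only [Set.mem_insert_iff, Set.mem_singleton_iff, not_or] at hx2
  have hSeq : S = {u, v, x} := by
    ext z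
    constructor
    · intro hz
      by_cases hzuv : z ∈ ({u, v} : Set V)
      · rcases hzuv with rfl | rfl <;> simp
      · simp [hcon z (hsub ⟨hz, hzuv⟩)]
    · rintro (rfl | rfl | rfl)
      exacts [hu, hv, hx.1]
  have hnb : ∀ z, H.Adj x z → z = u ∨ z = v := by
    intro z hz
    by_contra hzuv
    exact hz.ne' (hcon z (mem_compSet_of_adj (mem_compSet_self hx.2) hz hzuv))
  refine hsimp ⟨hS, ?_, x, hx.1, ?_⟩
  · rw [hSeq]
    exact Set.ncard_eq_three.2 ⟨u, v, x, huv.ne, Ne.symm hx2.1, Ne.symm hx2.2, rfl⟩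
  · intro z hz w hw hzw
    rcases hnb z hz with rfl | rfl <;> rcases hnb w hw with rfl | rfl
    exacts [absurd rfl hzw, huv, huv.symm, absurd rfl hzw]

variable {G : SimpleGraph V}

/-- Components left by deleting two vertices stay connected when the added bridging edges of
`H` are removed. -/
theorem connSet_compSet_of_theta (hle : G ≤ H) (hadj : ∀ c d, H.Adj c d → G.Adj c d ∨ Theta G c d)
    {u v x : V} (hx : x ∉ ({u, v} : Set V)) : ConnSet G (compSet H {u, v} x) := by
  have hc : ConnSet H (compSet H {u, v} x) := connSet_compSet hx
  refine ⟨hc.1, ?_⟩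
  rintro A ⟨p, hp, hpA⟩ ⟨q, hq, hqA⟩
  obtain ⟨p, hp, hpA, q, hq, hqA, hpq⟩ := hc.cross A hp hpA hq hqA
  rcases hadj p q hpq with hpq | ⟨hne, I, hI, hdis⟩
  · exact ⟨p, hp, hpA, q, hq, hqA, hpq⟩
  have hk : ∃ k, u ∉ I k ∧ v ∉ I k := by
    by_contra! hcon
    have h0 := hcon 0
    have h1 := hcon 1
    have h2 := hcon 2
    have hu : ∀ i j, i ≠ j → u ∈ I i → u ∉ I j := fun i j hij h h' => hij (hdis i j u h h')
    have hv : ∀ i j, i ≠ j → v ∈ I i → v ∉ I j := fun i j hij h h' => hij (hdis i j v h h')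
    have a1 := hu 0 1 (by decide)
    have a2 := hu 0 2 (by decide)
    have a3 := hu 1 2 (by decide)
    have b1 := hv 0 1 (by decide)
    have b2 := hv 0 2 (by decide)
    have b3 := hv 1 2 (by decide)
    tauto
  obtain ⟨k, huk, hvk⟩ := hk
  obtain ⟨y, hy, hpy⟩ := (hI k).left
  obtain ⟨z, hz, hqz⟩ := (hI k).right
  have hconn : ConnSet G (insert q (insert p (I k))) :=
    ((hI k).conn.insert_of_adj hy hpy).insert_of_adj (u := z) (by simp [hz]) hqz
  have hsub : insert q (insert p (I k)) ⊆ compSet H {u, v} x := by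
    refine subset_compSet (y := p) (hconn.mono fun _ _ _ _ h => hle h) ?_ (by simp) hp
    rintro w (rfl | rfl | hw) hwuv
    · exact notMem_of_mem_compSet hq hwuv
    · exact notMem_of_mem_compSet hp hwuv
    · rcases hwuv with rfl | rfl <;> contradiction
  obtain ⟨p', hp', hpA', q', hq', hqA', hpq'⟩ := hconn.cross A (x := p) (by simp) hpA (y := q)
    (by simp) hqA
  exact ⟨p', hsub hp', hpA', q', hsub hq', hqA', hpq'⟩

theorem exists_split (h2 : ∀ v, ConnSet G {x | x ≠ v}) {u v : V} (huv : u ≠ v) {D : Set V}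
    (hD : ConnSet G D) (huD : u ∉ D) (hvD : v ∉ D)
    (hN : ∀ x ∈ D, ∀ y, G.Adj x y → y ∈ D ∨ y = u ∨ y = v) {x y : V} (hx : x ∈ D) (hy : y ∈ D)
    (hxy : y ≠ x) :
    ∃ P Q : Set V, P ⊆ D ∧ Q ⊆ D ∧ ConnSet G P ∧ ConnSet G Q ∧ (∀ z ∈ P, z ∉ Q) ∧ Touch G {u} P ∧
      Touch G P Q ∧ Touch G Q {v} := by
  have hnb : ∀ u v, u ≠ v → u ∉ D → v ∉ D →
      (∀ x ∈ D, ∀ y, G.Adj x y → y ∈ D ∨ y = u ∨ y = v) → ∃ p ∈ D, G.Adj u p := by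
    intro u v huv huD hvD hN
    obtain ⟨p, hp, hpD, q, hq, hqD, hpq⟩ := (h2 v).cross D (x := x) (fun h => hvD (h ▸ hx)) hx
      (y := u) huv huD
    rcases hN p hpD q hpq with h | rfl | rfl
    exacts [absurd h hqD, ⟨p, hpD, hpq.symm⟩, absurd rfl hq]
  have hN' : ∀ x ∈ D, ∀ y, G.Adj x y → y ∈ D ∨ y = v ∨ y = u := by
    intro x hx y hxy
    have := hN x hx y hxy
    tauto
  obtain ⟨p, hp, hup⟩ := hnb u v huv huD hvD hN
  obtain ⟨q, hq, hvq⟩ := hnb v u huv.symm hvD huD hN'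
  have hpq : ∃ p ∈ D, ∃ q ∈ D, p ≠ q ∧ G.Adj u p ∧ G.Adj v q := by
    by_cases hpq : p = q
    · subst hpq
      obtain ⟨r, hr, hrp⟩ : ∃ r ∈ D, r ≠ p := by
        by_cases h : x = p
        · exact ⟨y, hy, h ▸ hxy⟩
        · exact ⟨x, hx, h⟩
      obtain ⟨s, hs, hsD, t, ht, htD, hst⟩ := (h2 p).cross D (x := r) hrp hr (y := u)
        (fun h => huD (h ▸ hp)) huD
      rcases hN s hsD t hst with h | rfl | rfl
      exacts [absurd h htD, ⟨s, hsD, p, hp, hs, hst.symm, hvq⟩, ⟨p, hp, s, hsD, Ne.symm hs, hup, hst.symm⟩]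
    · exact ⟨p, hp, q, hq, hpq, hup, hvq⟩
  obtain ⟨p, hp, q, hq, hpq, hup, hvq⟩ := hpq
  set Z : Set V := {z | ¬ (z ∈ D ∧ z ≠ p)} with hZ
  have hqZ : q ∉ Z := fun h => h ⟨hq, hpq.symm⟩
  have hQ : ∀ z ∈ compSet G Z q, z ∈ D ∧ z ≠ p := fun z hz => not_not.1 (notMem_of_mem_compSet hz)
  have hqQ : q ∈ compSet G Z q := mem_compSet_self hqZ
  refine ⟨{p}, compSet G Z q, by simpa using hp, fun z hz => (hQ z hz).1, .singleton p,
    connSet_compSet hqZ, ?_, ⟨u, rfl, p, rfl, hup⟩, ?_, ⟨q, hqQ, v, rfl, hvq.symm⟩⟩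
  · rintro z rfl hz
    exact (hQ z hz).2 rfl
  · obtain ⟨s, hs, hsQ, t, ht, htQ, hst⟩ := hD.cross _ hq hqQ hp fun h => (hQ p h).2 rfl
    have htp : t = p := by
      by_contra htp
      exact htQ (mem_compSet_of_adj hsQ hst fun h => h ⟨ht, htp⟩)
    exact ⟨p, rfl, s, hsQ, htp ▸ hst.symm⟩

theorem ncard_nonsimplicial_le_two [Finite V] (h2 : ∀ v, ConnSet G {x | x ≠ v})
    (hD3 : ¬ IsMinorOf D3 G) (hK4 : ¬ IsMinorOf K4 H) (hle : G ≤ H)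
    (hsat : ∀ c d, Theta H c d → H.Adj c d) (hadj : ∀ c d, H.Adj c d → G.Adj c d ∨ Theta G c d)
    {u v : V} (huv : H.Adj u v) :
    {S : Set V | IsChordlessCycle H S ∧ u ∈ S ∧ v ∈ S ∧ ¬ IsSimplicialTriangle H S}.ncard ≤ 2 := by
  by_contra! hcon
  obtain ⟨t, ht, ht3⟩ := Set.exists_subset_card_eq (Nat.succ_le_of_lt hcon)
  obtain ⟨S0, S1, S2, h01, h02, h12, rfl⟩ := Set.ncard_eq_three.1 ht3
  set S : Fin 3 → Set V := ![S0, S1, S2] with hSdef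
  have hinj : ∀ i j, i ≠ j → S i ≠ S j := by
    intro i j hij
    fin_cases i <;> fin_cases j <;> simp_all [Ne.symm]
  have hS : ∀ i, IsChordlessCycle H (S i) ∧ u ∈ S i ∧ v ∈ S i ∧ ¬ IsSimplicialTriangle H (S i) := by
    intro i
    fin_cases i <;> exact ht (by simp [hSdef])
  have hx := fun i => ((hS i).1.joins_of_adj (hS i).2.1 (hS i).2.2.1 huv).conn.1
  choose x hx using hx
  have hmem : ∀ i, ∀ z ∈ compSet H {u, v} (x i), z ≠ u ∧ z ≠ v := by
    intro i z hz
    have := notMem_of_mem_compSet hz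
    simpa using this
  have hN : ∀ i, ∀ z ∈ compSet H {u, v} (x i), ∀ y, G.Adj z y →
      y ∈ compSet H {u, v} (x i) ∨ y = u ∨ y = v := by
    intro i z hz y hzy
    by_cases h : y ∈ ({u, v} : Set V)
    · exact Or.inr h
    · exact Or.inl (mem_compSet_of_adj hz (hle hzy) h)
  have hsplit : ∀ i, ∃ P Q : Set V, P ⊆ compSet H {u, v} (x i) ∧ Q ⊆ compSet H {u, v} (x i) ∧
      ConnSet G P ∧ ConnSet G Q ∧ (∀ z ∈ P, z ∉ Q) ∧ Touch G {u} P ∧ Touch G P Q ∧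
      Touch G Q {v} := by
    intro i
    obtain ⟨y, hy, hyx⟩ := (hS i).1.exists_ne_mem_compSet (hS i).2.2.2 huv (hS i).2.1 (hS i).2.2.1
      (hx i)
    exact exists_split h2 huv.ne (connSet_compSet_of_theta hle hadj (hx i).2)
      (fun h => (hmem i _ h).1 rfl) (fun h => (hmem i _ h).2 rfl) (hN i)
      (mem_compSet_self (hx i).2) hy hyx
  choose P Q hPD hQD hP hQ hPQ tu tPQ tv using hsplit
  refine hD3 (isMinorOf_D3_of_sets huv.ne hP hQ (fun i h => (hmem i _ (hPD i h)).1 rfl)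
    (fun i h => (hmem i _ (hQD i h)).1 rfl) (fun i h => (hmem i _ (hPD i h)).2 rfl)
    (fun i h => (hmem i _ (hQD i h)).2 rfl) hPQ ?_ tu tPQ tv)
  intro i j z hzi hzj
  by_contra hij
  have hzi' : z ∈ compSet H {u, v} (x i) := hzi.elim (fun h => hPD i h) fun h => hQD i h
  have hzj' : z ∈ compSet H {u, v} (x j) := hzj.elim (fun h => hPD j h) fun h => hQD j h
  refine (hS i).1.notMem_compSet hK4 hsat (hS j).1 (hinj i j hij) huv (hS i).2.1 (hS i).2.2.1
    (hS j).2.1 (hS j).2.2.1 (hx i) (hx j) ?_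
  exact subset_compSet (connSet_compSet (hx j).2) (fun y hy => notMem_of_mem_compSet hy) hzj' hzi'
    (mem_compSet_self (hx j).2)

theorem isChainTreeOfCycles_cellCompletion [Finite V] (hG : TwoConnected G)
    (hK4 : ¬ IsMinorOf K4 G) (hD3 : ¬ IsMinorOf D3 G) :
    IsChainTreeOfCycles (cellCompletion G) := by
  have h2 : ∀ v, ConnSet G {x | x ≠ v} := fun v => ConnSet.iff_induce.2 (hG.2 v)
  obtain ⟨hle, hK, -, hsat, hadj⟩ := cellCompletion_spec h2 hK4
  refine ⟨?_, fun u v huv => ncard_nonsimplicial_le_two h2 hD3 hK hle hsat hadj huv⟩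
  have hA : TwoConnSet (cellCompletion G) Set.univ := by
    refine ⟨by rw [Set.ncard_univ]; exact hG.1, fun v _ => ?_⟩
    have : (Set.univ \ {v} : Set V) = {x | x ≠ v} := by ext; simp
    rw [this]
    exact (h2 v).mono fun _ _ _ _ h => hle h
  exact (hA.cycleTree hK hsat).isTreeOfCycles.of_iso (induceUnivIso _).symm

theorem block_of_not_minor [Finite V] (hK4 : ¬ IsMinorOf K4 G) (hD3 : ¬ IsMinorOf D3 G)
    {S : Set V} (hS : IsBlock G S) :
    (TwoConnected (G.induce S) ∧ IsChainTreeOfCycles (cellCompletion (G.induce S))) ∨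
      (∃ a b : V, a ≠ b ∧ S = {a, b} ∧ G.Adj a b) ∨ (∃ a : V, S = {a}) := by
  obtain ⟨hne, hconn, hcut, -⟩ := hS
  have hpos := (Set.ncard_pos (Set.toFinite S)).2 hne
  rcases (by omega : S.ncard = 1 ∨ S.ncard = 2 ∨ 3 ≤ S.ncard) with h1 | h2 | h3
  · exact Or.inr (Or.inr (Set.ncard_eq_one.1 h1))
  · obtain ⟨a, b, hab, rfl⟩ := Set.ncard_eq_two.1 h2
    refine Or.inr (Or.inl ⟨a, b, hab, rfl, ?_⟩)
    obtain ⟨p, hp, rfl, q, hq, hqa, hpq⟩ := (ConnSet.iff_induce.2 hconn).cross {a} (x := a)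
      (by simp) rfl (y := b) (by simp) hab.symm
    rcases hq with rfl | rfl
    exacts [absurd rfl hqa, hpq]
  · refine Or.inl ?_
    have h2 : TwoConnected (G.induce S) := by
      refine ⟨h3, fun v => ?_⟩
      rw [← ConnSet.iff_induce, ConnSet.induce_iff]
      have heq : Subtype.val '' {x : S | x ≠ v} = S \ {v.1} := by
        ext z
        constructor
        · rintro ⟨z, hz, rfl⟩
          exact ⟨z.2, fun h => hz (Subtype.ext h)⟩
        · rintro ⟨hz, hzv⟩
          exact ⟨⟨z, hz⟩, fun h => hzv (congrArg Subtype.val h), rfl⟩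
      rw [heq, ConnSet.iff_induce]
      refine hcut v.1 v.2 ?_
      rw [← Set.ncard_pos (Set.toFinite _), Set.ncard_sdiff_singleton_of_mem v.2]
      omega
    exact ⟨h2, isChainTreeOfCycles_cellCompletion h2
      (fun h => hK4 (h.of_embedding (Embedding.induce S)))
      (fun h => hD3 (h.of_embedding (Embedding.induce S)))⟩

end

section insertNode

variable {ι : Type} {T : SimpleGraph ι}

theorem isTree_of_cuts (hconn : ConnSet T Set.univ)
    (hcut : ∀ s t, T.Adj s t → ∃ L : Set ι, s ∈ L ∧ t ∉ L ∧
      ∀ x ∈ L, ∀ y, y ∉ L → T.Adj x y → x = s ∧ y = t) : T.IsTree := by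
  refine ⟨ConnSet.univ_iff.1 hconn, isAcyclic_iff_forall_adj_isBridge.2 fun s t hst => ?_⟩
  rw [isBridge_iff]
  intro hr
  obtain ⟨L, hs, ht, hL⟩ := hcut s t hst
  obtain ⟨p⟩ := hr
  obtain ⟨d, hd, hd1, hd2⟩ := p.exists_boundary_dart L hs ht
  have := d.adj
  rw [deleteEdges_adj] at this
  obtain ⟨h1, h2⟩ := hL _ hd1 _ hd2 this.1
  exact this.2 (by rw [h1, h2]; rfl)

/-- Add a node to the tree `T`: as a leaf attached to `s` if `s = s'`, and as a subdivision node
of the edge `s s'` otherwise. -/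
def insertNode (T : SimpleGraph ι) (s s' : ι) : SimpleGraph (Option ι) where
  Adj p q := match p, q with
    | some x, some y => T.Adj x y ∧ ¬ ((x = s ∨ x = s') ∧ (y = s ∨ y = s'))
    | some x, none => x = s ∨ x = s'
    | none, some y => y = s ∨ y = s'
    | none, none => False
  symm := ⟨by
    rintro (_ | x) (_ | y) h
    · exact h
    · exact h
    · exact h
    · exact ⟨h.1.symm, fun h' => h.2 h'.symm⟩⟩
  loopless := ⟨by
    rintro (_ | x) h
    · exact h
    · exact T.loopless.irrefl x h.1⟩

variable {s s' : ι}

theorem insertNode_conn_image {N : Set ι} (hN : ConnSet T N) (h : s ∈ N → s' ∈ N → s = s') :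
    ConnSet (insertNode T s s') (some '' N) := by
  refine hN.map some fun x hx y hy hxy _ => ⟨hxy, ?_⟩
  rintro ⟨rfl | rfl, rfl | rfl⟩
  · exact hxy.ne rfl
  · exact hxy.ne (h hx hy)
  · exact hxy.ne (h hy hx).symm
  · exact hxy.ne rfl

theorem insertNode_conn_insert {N : Set ι} (hN : ConnSet T N) (hs : s ∈ N) (hs' : s' ∈ N) :
    ConnSet (insertNode T s s') (insert none (some '' N)) := by
  have hns : ∀ x, x = s ∨ x = s' → (insertNode T s s').Adj none (some x) := fun x hx => hx
  have hmem : ∀ x ∈ N, some x ∈ insert none (some '' N) := fun x hx => Or.inr ⟨x, hx, rfl⟩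
  refine ⟨⟨none, by simp⟩, ?_⟩
  rintro B ⟨p, hp, hpB⟩ ⟨q, hq, hqB⟩
  by_contra! hcon
  have hnone : ∀ x, x = s ∨ x = s' → (none ∈ B ↔ some x ∈ B) := by
    intro x hx
    have hxN : x ∈ N := by rcases hx with rfl | rfl <;> assumption
    by_contra hne
    by_cases hnB : none ∈ B
    · exact hcon none (by simp) hnB (some x) (hmem x hxN) (by tauto) (hns x hx)
    · exact hcon (some x) (hmem x hxN) (by tauto) none (by simp) hnB (hns x hx).symm
  have key : ∀ x ∈ N, (some x ∈ B ↔ none ∈ B) := by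
    intro x hx
    by_contra hne
    have hstep : ∃ x ∈ N, some x ∈ B ∧ ∃ y ∈ N, some y ∉ B ∧ T.Adj x y := by
      have h1 := hnone s (Or.inl rfl)
      by_cases hxB : some x ∈ B
      · exact hN.cross {x | some x ∈ B} hx hxB hs (show ¬ _ by tauto)
      · exact hN.cross {x | some x ∈ B} hs (show _ by tauto) hx hxB
    obtain ⟨y, hy, hyB, z, hz, hzB, hyz⟩ := hstep
    refine hcon (some y) (hmem y hy) hyB (some z) (hmem z hz) hzB ⟨hyz, ?_⟩
    rintro ⟨h1, h2⟩
    exact hzB ((hnone z h2).1 ((hnone y h1).2 hyB))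
  have hall : ∀ p ∈ insert none (some '' N), (p ∈ B ↔ none ∈ B) := by
    rintro _ (rfl | ⟨x, hx, rfl⟩)
    exacts [Iff.rfl, key x hx]
  exact hqB ((hall q hq).2 ((hall p hp).1 hpB))

theorem insertNode_isTree (hT : T.IsTree) (hss : s = s' ∨ T.Adj s s') :
    (insertNode T s s').IsTree := by
  have hconn : ConnSet T Set.univ := ConnSet.univ_iff.2 hT.connected
  have hcut := fun s t (h : T.Adj s t) => hT.isAcyclic.exists_cut h
  refine isTree_of_cuts ?_ ?_
  · convert insertNode_conn_insert hconn (Set.mem_univ s) (Set.mem_univ s') using 1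
    ext p
    cases p <;> simp
  have hnone : ∀ x, x = s ∨ x = s' → ∃ L : Set ι, x ∈ L ∧
      (∀ y, y = s ∨ y = s' → y ∈ L → y = x) ∧
      ∀ y ∈ L, ∀ z, z ∉ L → T.Adj y z → (y = s ∨ y = s') ∧ (z = s ∨ z = s') := by
    intro x hx
    rcases hss with rfl | hss
    · exact ⟨Set.univ, trivial, fun y hy _ => by rw [or_self] at hx hy; rw [hx, hy], fun y _ z hz => absurd trivial hz⟩
    rcases hx with rfl | rfl
    · obtain ⟨L, h1, h2, h3⟩ := hcut _ _ hss
      refine ⟨L, h1, ?_, fun y hy z hz hyz => ?_⟩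
      · rintro y (rfl | rfl) hy
        exacts [rfl, absurd hy h2]
      · obtain ⟨rfl, rfl⟩ := h3 y hy z hz hyz
        exact ⟨Or.inl rfl, Or.inr rfl⟩
    · obtain ⟨L, h1, h2, h3⟩ := hcut _ _ hss.symm
      refine ⟨L, h1, ?_, fun y hy z hz hyz => ?_⟩
      · rintro y (rfl | rfl) hy
        exacts [absurd hy h2, rfl]
      · obtain ⟨rfl, rfl⟩ := h3 y hy z hz hyz
        exact ⟨Or.inr rfl, Or.inl rfl⟩
  rintro (_ | x) (_ | y) hxy
  · exact hxy.elim
  · obtain ⟨L, h1, h2, h3⟩ := hnone y hxy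
    refine ⟨{p | p ∉ some '' L}, by simp, fun h => h ⟨y, h1, rfl⟩, ?_⟩
    rintro (_ | p) hp (_ | q) hq hpq
    · exact hpq.elim
    · simp only [Set.mem_ofPred_eq, not_not, Set.mem_image, Option.some.injEq, exists_eq_right] at hq
      exact ⟨rfl, congrArg some (h2 q hpq hq)⟩
    · simp at hq
    · simp only [Set.mem_ofPred_eq, not_not, Set.mem_image, Option.some.injEq,
        exists_eq_right] at hq hp
      exact absurd (h3 q hq p hp hpq.1.symm).symm hpq.2
  · obtain ⟨L, h1, h2, h3⟩ := hnone x hxy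
    refine ⟨some '' L, ⟨x, h1, rfl⟩, by simp, ?_⟩
    rintro _ ⟨p, hp, rfl⟩ (_ | q) hq hpq
    · exact ⟨congrArg some (h2 p hpq hp), rfl⟩
    · exact absurd (h3 p hp q (fun h => hq ⟨q, h, rfl⟩) hpq.1) hpq.2
  · obtain ⟨L, h1, h2, h3⟩ := hcut x y hxy.1
    have hLs : s ∈ L ↔ s' ∈ L := by
      rcases hss with rfl | hss
      · rfl
      by_contra hne
      by_cases hsL : s ∈ L
      · obtain ⟨rfl, rfl⟩ := h3 s hsL s' (by tauto) hss
        exact hxy.2 ⟨Or.inl rfl, Or.inr rfl⟩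
      · obtain ⟨rfl, rfl⟩ := h3 s' (by tauto) s hsL hss.symm
        exact hxy.2 ⟨Or.inr rfl, Or.inl rfl⟩
    refine ⟨{p | p.elim (s ∈ L) (· ∈ L)}, h1, h2, ?_⟩
    rintro (_ | p) hp (_ | q) hq hpq
    · exact hpq.elim
    · refine absurd ?_ hq
      rcases hpq with rfl | rfl
      exacts [hp, hLs.1 hp]
    · refine absurd ?_ hq
      rcases hpq with rfl | rfl
      exacts [hp, hLs.2 hp]
    · obtain ⟨rfl, rfl⟩ := h3 p hp q hq hpq.1
      exact ⟨rfl, rfl⟩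

end insertNode

section insertNodeDegree

variable {ι : Type} {T : SimpleGraph ι} {s s' : ι}

theorem ncard_insertNode_subdivide_le [Finite ι] (hss : T.Adj s s') (t : ι) {P : Option ι → Prop}
    {P₀ : ι → Prop} (h1 : ∀ r, P (some r) → P₀ r) (h2 : P none → P₀ s ∧ P₀ s') :
    {q | (insertNode T s s').Adj (some t) q ∧ P q}.ncard ≤ {r | T.Adj t r ∧ P₀ r}.ncard := by
  classical
  refine Set.ncard_le_ncard_of_injOn (fun q => q.elim (if t = s then s' else s) id) ?_ ?_
    (Set.toFinite _)
  · rintro (_ | r) ⟨hq, hP⟩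
    · obtain ⟨hs, hs'⟩ := h2 hP
      have hts : t = s ∨ t = s' := hq
      simp only [Option.elim]
      split_ifs with h
      · exact ⟨h ▸ hss, hs'⟩
      · exact ⟨(hts.resolve_left h) ▸ hss.symm, hs⟩
    · exact ⟨hq.1, h1 r hP⟩
  · have key : ∀ r, (insertNode T s s').Adj (some t) none →
        (insertNode T s s').Adj (some t) (some r) → r ≠ if t = s then s' else s := by
      rintro r ht hr rfl
      refine hr.2 ⟨ht, ?_⟩
      split_ifs
      exacts [Or.inr rfl, Or.inl rfl]
    rintro (_ | q) ⟨hq, _⟩ (_ | r) ⟨hr, _⟩ h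
    · rfl
    · exact absurd h.symm (key r hq hr)
    · exact absurd h (key q hr hq)
    · exact congrArg some h

theorem insertNode_attach_subset (t : ι) {P : Option ι → Prop} {P₀ : ι → Prop}
    (h1 : ∀ r, P (some r) → P₀ r) :
    {q | (insertNode T s s).Adj (some t) q ∧ P q} ⊆
      some '' {r | T.Adj t r ∧ P₀ r} ∪ {q | q = none ∧ t = s ∧ P q} := by
  rintro (_ | r) ⟨hq, hP⟩
  · exact Or.inr ⟨rfl, (or_self _).mp hq, hP⟩
  · exact Or.inl ⟨r, ⟨hq.1, h1 r hP⟩, rfl⟩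

end insertNodeDegree

section Core

variable {V : Type} {H : SimpleGraph V}

/-- A vertex is simplicial if its neighborhood is a clique. -/
def IsSimplicialVertex (H : SimpleGraph V) (v : V) : Prop := H.IsClique (H.neighborSet v)

/-- A tree decomposition of the vertex set `A` into triples, each contained in a chordless cycle,
in which nodes of simplicial triangles have degree at most two, and the other nodes have at most one
neighbor along each pair of vertices of their bag. -/
structure Core {ι : Type} (H : SimpleGraph V) (A : Set V) (T : SimpleGraph ι)
    (bag cyc : ι → Set V) : Prop where
  tree : T.IsTree
  bag_sub : ∀ t, bag t ⊆ A
  cover : ∀ v ∈ A, ∃ t, v ∈ bag t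
  conn : ∀ v ∈ A, ConnSet T {t | v ∈ bag t}
  card : ∀ t, (bag t).ncard = 3
  adj_card : ∀ s t, T.Adj s t → (bag s ∩ bag t).ncard = 2
  bag_cyc : ∀ t, bag t ⊆ cyc t
  chordless : ∀ t, IsChordlessCycle H (cyc t)
  inj : ∀ a b, H.Adj a b → ∀ t t', a ∈ bag t → b ∈ bag t → a ∈ bag t' → b ∈ bag t' →
    cyc t = cyc t' → t = t'
  nonsimp : ∀ t, ¬ IsSimplicialTriangle H (cyc t) → ∀ a ∈ bag t, ∀ b ∈ bag t, a ≠ b →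
    {s | T.Adj t s ∧ (a ∈ bag s ∧ b ∈ bag s)}.ncard ≤ 1
  simp_degree : ∀ t, IsSimplicialTriangle H (cyc t) → {s | T.Adj t s ∧ True}.ncard ≤ 2
  simp_private : ∀ t, IsSimplicialTriangle H (cyc t) → ∀ z ∈ bag t, IsSimplicialVertex H z →
    ∀ s, z ∈ bag s → s = t

variable {ι : Type} {A : Set V} {T : SimpleGraph ι} {bag cyc : ι → Set V}

theorem Core.insert [Finite ι] [Finite V] (h : Core H A T bag cyc) {s s' : ι} {a b w : V}
    {S : Set V} (hss : s = s' ∨ T.Adj s s') (has : a ∈ bag s) (hbs : b ∈ bag s) (has' : a ∈ bag s')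
    (hbs' : b ∈ bag s') (hab : a ≠ b) (hw : w ∉ A) (hS : IsChordlessCycle H S) (haS : a ∈ S)
    (hbS : b ∈ S) (hwS : w ∈ S)
    (hnew : H.Adj a b → ∀ t, cyc t = S → a ∈ bag t → b ∈ bag t → False)
    (hsimp : IsSimplicialTriangle H S ∨ IsSimplicialTriangle H (cyc s) →
      ¬ IsSimplicialVertex H a ∧ ¬ IsSimplicialVertex H b)
    (hdeg : (s ≠ s' ∧ IsSimplicialTriangle H S) ∨ (s = s' ∧
      (IsSimplicialTriangle H (cyc s) → {r | T.Adj s r ∧ True}.ncard ≤ 1) ∧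
      (¬ IsSimplicialTriangle H (cyc s) → ∀ r, T.Adj s r → a ∈ bag r → b ∉ bag r))) :
    Core H (insert w A) (insertNode T s s') (fun p => p.elim {a, b, w} bag)
      (fun p => p.elim S cyc) := by
  have haA : a ∈ A := h.bag_sub s has
  have hbA : b ∈ A := h.bag_sub s hbs
  have haw : a ≠ w := fun e => hw (e ▸ haA)
  have hbw : b ≠ w := fun e => hw (e ▸ hbA)
  have hwb : ∀ t, w ∉ bag t := fun t ht => hw (h.bag_sub t ht)
  have hN : ∀ t c, c ∈ bag t → c ∈ ({a, b, w} : Set V) → c = a ∨ c = b := by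
    rintro t c hc (rfl | rfl | rfl)
    exacts [Or.inl rfl, Or.inr rfl, absurd hc (hwb t)]
  have hpair : ∀ t c d, c ≠ d → c ∈ bag t → d ∈ bag t → c ∈ ({a, b, w} : Set V) →
      d ∈ ({a, b, w} : Set V) → (c = a ∧ d = b) ∨ (c = b ∧ d = a) := by
    intro t c d hcd hc hd hc' hd'
    rcases hN t c hc hc' with rfl | rfl <;> rcases hN t d hd hd' with rfl | rfl
    · exact absurd rfl hcd
    · exact Or.inl ⟨rfl, rfl⟩
    · exact Or.inr ⟨rfl, rfl⟩
    · exact absurd rfl hcd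
  have hinter : ∀ t, a ∈ bag t → b ∈ bag t → (({a, b, w} : Set V) ∩ bag t).ncard = 2 := by
    intro t ha hb
    rw [← Set.ncard_pair hab]
    congr 1
    ext c
    constructor
    · rintro ⟨hc, hct⟩
      exact hN t c hct hc
    · rintro (rfl | rfl)
      exacts [⟨by simp, ha⟩, ⟨by simp, hb⟩]
  have hboth : ∀ x, x = s ∨ x = s' → a ∈ bag x ∧ b ∈ bag x := by
    rintro x (rfl | rfl)
    exacts [⟨has, hbs⟩, ⟨has', hbs'⟩]
  refine ⟨insertNode_isTree h.tree hss, ?_, ?_, ?_, ?_, ?_, ?_, ?_, ?_, ?_, ?_, ?_⟩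
  · rintro (_ | t)
    · rintro c (rfl | rfl | rfl)
      exacts [Or.inr haA, Or.inr hbA, Or.inl rfl]
    · exact (h.bag_sub t).trans (Set.subset_insert _ _)
  · rintro v (rfl | hv)
    · exact ⟨none, by simp⟩
    · obtain ⟨t, ht⟩ := h.cover v hv
      exact ⟨some t, ht⟩
  · rintro v (rfl | hv)
    · convert ConnSet.singleton (G := insertNode T s s') none using 1
      ext (_ | t)
      · simp
      · simpa using hwb t
    · have hvw : v ≠ w := fun e => hw (e ▸ hv)
      by_cases hvab : v = a ∨ v = b
      · have h1 : v ∈ bag s := by rcases hvab with rfl | rfl <;> assumption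
        have h2 : v ∈ bag s' := by rcases hvab with rfl | rfl <;> assumption
        convert insertNode_conn_insert (h.conn v hv) h1 h2 using 1
        ext (_ | t)
        · simpa using or_assoc.1 (Or.inl hvab : (v = a ∨ v = b) ∨ v = w)
        · simp
      · convert insertNode_conn_image (s := s) (s' := s') (h.conn v hv) ?_ using 1
        · ext (_ | t)
          · simp only [Option.elim, Set.mem_ofPred_eq, Set.mem_insert_iff, Set.mem_singleton_iff]
            simp only [Set.mem_image, reduceCtorEq, and_false, exists_false, iff_false]
            tauto
          · simp
        · intro hvs hvs'
          by_contra hne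
          have h2 := h.adj_card s s' (hss.resolve_left hne)
          have h3 : ({v, a, b} : Set V) ⊆ bag s ∩ bag s' := by
            rintro c (rfl | rfl | rfl)
            exacts [⟨hvs, hvs'⟩, ⟨has, has'⟩, ⟨hbs, hbs'⟩]
          have h4 := Set.ncard_le_ncard h3
          rw [Set.ncard_eq_three.2 ⟨v, a, b, by tauto, by tauto, hab, rfl⟩] at h4
          omega
  · rintro (_ | t)
    · exact Set.ncard_eq_three.2 ⟨a, b, w, hab, haw, hbw, rfl⟩
    · exact h.card t
  · rintro (_ | x) (_ | y) hxy
    · exact hxy.elim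
    · exact hinter y (hboth y hxy).1 (hboth y hxy).2
    · rw [Set.inter_comm]
      exact hinter x (hboth x hxy).1 (hboth x hxy).2
    · exact h.adj_card x y hxy.1
  · rintro (_ | t)
    · rintro c (rfl | rfl | rfl) <;> assumption
    · exact h.bag_cyc t
  · rintro (_ | t)
    exacts [hS, h.chordless t]
  · have hcd : ∀ c d, H.Adj c d → ∀ t, c ∈ bag t → d ∈ bag t → c ∈ ({a, b, w} : Set V) →
        d ∈ ({a, b, w} : Set V) → cyc t = S → False := by
      intro c d hcd t hc hd hc' hd' ht
      rcases hpair t c d hcd.ne hc hd hc' hd' with ⟨rfl, rfl⟩ | ⟨rfl, rfl⟩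
      exacts [hnew hcd t ht hc hd, hnew hcd.symm t ht hd hc]
    rintro c d hadj (_ | t) (_ | t') h1 h2 h3 h4 h5
    · rfl
    · exact (hcd c d hadj t' h3 h4 h1 h2 h5.symm).elim
    · exact (hcd c d hadj t h1 h2 h3 h4 h5).elim
    · exact congrArg some (h.inj c d hadj t t' h1 h2 h3 h4 h5)
  · rintro (_ | t) ht c hc d hd hcd
    · obtain ⟨_, hS'⟩ | ⟨rfl, -⟩ := hdeg
      · exact absurd hS' ht
      refine (Set.ncard_le_ncard (t := {some s}) ?_).trans (Set.ncard_singleton _).le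
      rintro (_ | r) ⟨hr, -⟩
      · exact hr.elim
      · exact congrArg some ((or_self _).mp hr)
    · have hold := h.nonsimp t ht c hc d hd hcd
      obtain ⟨hne, hS'⟩ | ⟨rfl, -, h2⟩ := hdeg
      · refine (ncard_insertNode_subdivide_le (hss.resolve_left hne) t (fun _ h => h) ?_).trans hold
        rintro ⟨h1, h2⟩
        rcases hpair t c d hcd hc hd h1 h2 with ⟨rfl, rfl⟩ | ⟨rfl, rfl⟩
        exacts [⟨⟨has, hbs⟩, has', hbs'⟩, ⟨⟨hbs, has⟩, hbs', has'⟩]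
      · have hsub := insertNode_attach_subset (T := T) (s := s) t
          (P := fun q => c ∈ (q.elim {a, b, w} bag : Set V) ∧ d ∈ (q.elim {a, b, w} bag : Set V))
          (P₀ := fun r => c ∈ bag r ∧ d ∈ bag r) (fun _ h => h)
        refine (Set.ncard_le_ncard hsub).trans ?_
        by_cases hq : t = s ∧ (c ∈ ({a, b, w} : Set V) ∧ d ∈ ({a, b, w} : Set V))
        · obtain ⟨rfl, hq⟩ := hq
          have : {r | T.Adj t r ∧ (c ∈ bag r ∧ d ∈ bag r)} = ∅ := by
            ext r
            simp only [Set.mem_ofPred_eq, Set.mem_empty_iff_false, iff_false]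
            rintro ⟨hr, hcr, hdr⟩
            rcases hpair t c d hcd hc hd hq.1 hq.2 with ⟨rfl, rfl⟩ | ⟨rfl, rfl⟩
            exacts [h2 ht r hr hcr hdr, h2 ht r hr hdr hcr]
          rw [this, Set.image_empty, Set.empty_union]
          refine (Set.ncard_le_ncard (t := {none}) ?_).trans (Set.ncard_singleton _).le
          rintro q ⟨rfl, -⟩
          rfl
        · have : {q : Option ι | q = none ∧ t = s ∧ (c ∈ (q.elim {a, b, w} bag : Set V) ∧
              d ∈ (q.elim {a, b, w} bag : Set V))} = ∅ := by
            ext q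
            simp only [Set.mem_ofPred_eq, Set.mem_empty_iff_false, iff_false]
            rintro ⟨rfl, hq'⟩
            exact hq hq'
          rw [this, Set.union_empty, Set.ncard_image_of_injective _ (Option.some_injective _)]
          exact hold
  · rintro (_ | t) ht
    · have hle : ({some s, some s'} : Set (Option ι)).ncard ≤ 2 :=
        (Set.ncard_insert_le _ _).trans (by rw [Set.ncard_singleton])
      refine (Set.ncard_le_ncard (t := {some s, some s'}) ?_).trans hle
      rintro (_ | r) ⟨hr, -⟩
      · exact hr.elim
      · rcases hr with rfl | rfl <;> simp
    · have hold := h.simp_degree t ht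
      obtain ⟨hne, hS'⟩ | ⟨rfl, h1, -⟩ := hdeg
      · exact (ncard_insertNode_subdivide_le (hss.resolve_left hne) t (fun _ h => h)
          fun _ => ⟨trivial, trivial⟩).trans hold
      · have hsub := insertNode_attach_subset (T := T) (s := s) t
          (P := fun _ => True) (P₀ := fun _ => True) (fun _ h => h)
        refine (Set.ncard_le_ncard hsub).trans ((Set.ncard_union_le _ _).trans ?_)
        rw [Set.ncard_image_of_injective _ (Option.some_injective _)]
        by_cases hts : t = s
        · subst hts
          have h3 := h1 ht
          have : {q : Option ι | q = none ∧ t = t ∧ True}.ncard ≤ 1 := by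
            refine (Set.ncard_le_ncard (t := {none}) ?_).trans (Set.ncard_singleton _).le
            rintro q ⟨rfl, -⟩
            rfl
          omega
        · have : {q : Option ι | q = none ∧ t = s ∧ True} = ∅ := by
            ext q
            simp [hts]
          rw [this, Set.ncard_empty]
          exact hold
  · rintro (_ | t) ht z hz hzs (_ | r) hr
    · rfl
    · obtain rfl | rfl := hN r z hr hz
      exacts [absurd hzs (hsimp (Or.inl ht)).1, absurd hzs (hsimp (Or.inl ht)).2]
    · obtain rfl | rfl := hN t z hz hr
      · have := h.simp_private t ht _ hz hzs s has
        exact absurd hzs (hsimp (Or.inr (this ▸ ht))).1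
      · have := h.simp_private t ht _ hz hzs s hbs
        exact absurd hzs (hsimp (Or.inr (this ▸ ht))).2
    · exact congrArg some (h.simp_private t ht z hz hzs r hr)

end Core

theorem SimpleGraph.IsAcyclic.ncard_adj_le_one {ι : Type} [Finite ι] {T : SimpleGraph ι}
    (hT : T.IsAcyclic) {P : Set ι} {z : ι} (hz : ConnSet T (P \ {z})) :
    {r | r ∈ P ∧ T.Adj z r}.ncard ≤ 1 := by
  rw [Set.ncard_le_one]
  rintro r ⟨hrP, hr⟩ r' ⟨hrP', hr'⟩
  by_contra hrr
  obtain ⟨L, hzL, hrL, hL⟩ := hT.exists_cut hr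
  have hr'L : r' ∈ L := by
    by_contra hr'L
    exact hrr (hL z hzL r' hr'L hr').2.symm
  obtain ⟨p, hp, hpL, q, hq, hqL, hpq⟩ := hz.cross L ⟨hrP', hr'.ne'⟩ hr'L ⟨hrP, hr.ne'⟩ hrL
  exact hp.2 (hL p hpL q hqL hpq).1

theorem SimpleGraph.IsAcyclic.exists_ncard_adj_le_one {ι : Type} [Finite ι] {T : SimpleGraph ι}
    (hT : T.IsAcyclic) {P : Set ι} (hP : ConnSet T P) :
    ∃ z ∈ P, {r | r ∈ P ∧ T.Adj z r}.ncard ≤ 1 := by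
  obtain ⟨x, hx⟩ := hP.1
  by_cases h : ∃ y ∈ P, y ≠ x
  · obtain ⟨y, hy, hyx⟩ := h
    obtain ⟨z, hz, -, hzc⟩ := exists_noncut hP hx hy hyx
    exact ⟨z, hz, hT.ncard_adj_le_one hzc⟩
  · push Not at h
    refine ⟨x, hx, ?_⟩
    rw [Set.ncard_le_one]
    rintro r ⟨hr, -⟩ r' ⟨hr', -⟩
    rw [h r hr, h r' hr']

section Fan

variable {V : Type} {H : SimpleGraph V} {ι : Type} {A S : Set V} {T : SimpleGraph ι}
  {bag cyc : ι → Set V} {a b : V}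

theorem Core.mem_of_adj [Finite V] (h : Core H A T bag cyc) {t r : ι}
    (ht : IsSimplicialTriangle H (cyc t)) (hat : a ∈ bag t) (hbt : b ∈ bag t) (hab : a ≠ b)
    (ha : ¬ IsSimplicialVertex H a) (hb : ¬ IsSimplicialVertex H b) (htr : T.Adj t r) :
    a ∈ bag r ∧ b ∈ bag r := by
  obtain ⟨-, h3, z, hz, hzs⟩ := id ht
  have hbag : bag t = cyc t := Set.eq_of_subset_of_ncard_le (h.bag_cyc t) (by rw [h3, h.card t])
  rw [← hbag] at hz
  have hzr : z ∉ bag r := fun hr => htr.ne (h.simp_private t ht z hz hzs r hr).symm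
  have hza : z ≠ a := fun e => ha (e ▸ hzs)
  have hzb : z ≠ b := fun e => hb (e ▸ hzs)
  have hbt3 : ({a, b, z} : Set V) = bag t := by
    refine Set.eq_of_subset_of_ncard_le ?_ ?_
    · rintro c (rfl | rfl | rfl) <;> assumption
    · rw [h.card t, Set.ncard_eq_three.2 ⟨a, b, z, hab, hza.symm, hzb.symm, rfl⟩]
  have h2 : bag t ∩ bag r = {a, b} := by
    refine Set.eq_of_subset_of_ncard_le ?_ ?_
    · rintro c ⟨hc, hcr⟩
      rw [← hbt3] at hc
      rcases hc with rfl | rfl | rfl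
      exacts [Or.inl rfl, Or.inr rfl, absurd hcr hzr]
    · rw [h.adj_card t r htr, Set.ncard_pair hab]
  have h4 : a ∈ bag t ∩ bag r := h2 ▸ Or.inl rfl
  have h5 : b ∈ bag t ∩ bag r := h2 ▸ Or.inr rfl
  exact ⟨h4.2, h5.2⟩

theorem not_isSimplicialVertex_of_joins {C D : Set V} (hC : ∃ u ∈ C, H.Adj a u)
    (hD : ∃ v ∈ D, H.Adj a v) (hCD : ∀ u ∈ C, ∀ v ∈ D, u ≠ v ∧ ¬ H.Adj u v) :
    ¬ IsSimplicialVertex H a := by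
  obtain ⟨u, hu, hau⟩ := hC
  obtain ⟨v, hv, hav⟩ := hD
  intro h
  exact (hCD u hu v hv).2 (h hau hav (hCD u hu v hv).1)

theorem Core.exists_insert_position [Finite ι] [Finite V] (h : Core H A T bag cyc)
    (hcyc : ∀ t, cyc t ⊆ A) (hS : IsChordlessCycle H S) (hab : H.Adj a b)
    (hcov : ∃ t, a ∈ bag t ∧ b ∈ bag t) (hAS : A ∩ S = {a, b})
    (hcross : ∀ x ∈ A, ∀ y ∈ S, x ∉ S → y ∉ A → ¬ H.Adj x y)
    (hchain : {S : Set V | IsChordlessCycle H S ∧ a ∈ S ∧ b ∈ S ∧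
      ¬ IsSimplicialTriangle H S}.ncard ≤ 2) :
    (∀ t, cyc t ≠ S) ∧ ¬ IsSimplicialVertex H a ∧ ¬ IsSimplicialVertex H b ∧
    ∃ s s', (s = s' ∨ T.Adj s s') ∧ a ∈ bag s ∧ b ∈ bag s ∧ a ∈ bag s' ∧ b ∈ bag s' ∧
    ((s ≠ s' ∧ IsSimplicialTriangle H S) ∨ (s = s' ∧
      (IsSimplicialTriangle H (cyc s) → {r | T.Adj s r ∧ True}.ncard ≤ 1) ∧
      (¬ IsSimplicialTriangle H (cyc s) → ∀ r, T.Adj s r → a ∈ bag r → b ∉ bag r))) := by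
  have haAS : a ∈ A ∩ S := hAS ▸ Or.inl rfl
  have hbAS : b ∈ A ∩ S := hAS ▸ Or.inr rfl
  have hSA : ∀ y ∈ S \ {a, b}, y ∉ A := fun y hy hyA => hy.2 (hAS ▸ ⟨hyA, hy.1⟩)
  have hjS := hS.joins_of_adj haAS.2 hbAS.2 hab
  have hne : ∀ t, cyc t ≠ S := by
    rintro t rfl
    obtain ⟨y, hy, -⟩ := hjS.left
    exact hSA y hy (hcyc t hy.1)
  obtain ⟨t₀, hat₀, hbt₀⟩ := hcov
  have hjt := (h.chordless t₀).joins_of_adj (h.bag_cyc _ hat₀) (h.bag_cyc _ hbt₀) hab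
  have hsep : ∀ u ∈ cyc t₀ \ {a, b}, ∀ v ∈ S \ {a, b}, u ≠ v ∧ ¬ H.Adj u v := by
    intro u hu v hv
    have huS : u ∉ S := fun hS' => hu.2 (hAS ▸ ⟨hcyc t₀ hu.1, hS'⟩)
    exact ⟨fun e => huS (e ▸ hv.1), hcross u (hcyc t₀ hu.1) v hv.1 huS (hSA v hv)⟩
  have ha := not_isSimplicialVertex_of_joins hjt.left hjS.left hsep
  have hb := not_isSimplicialVertex_of_joins hjt.right hjS.right hsep
  refine ⟨hne, ha, hb, ?_⟩
  set P : Set ι := {t | a ∈ bag t} ∩ {t | b ∈ bag t} with hP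
  have hPc : ConnSet T P := (h.conn a haAS.1).inter_of_isAcyclic h.tree.isAcyclic (h.conn b hbAS.1)
    ⟨t₀, hat₀, hbt₀⟩
  have hnbr : ∀ t ∈ P, IsSimplicialTriangle H (cyc t) → ∀ r, T.Adj t r → r ∈ P := fun t ht hs r hr =>
    h.mem_of_adj hs ht.1 ht.2 hab.ne ha hb hr
  by_cases hsub : ∀ t ∈ P, t = t₀
  · refine ⟨t₀, t₀, Or.inl rfl, hat₀, hbt₀, hat₀, hbt₀, Or.inr ⟨rfl, fun hs => ?_, ?_⟩⟩
    · have : {r | T.Adj t₀ r ∧ True} = ∅ := by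
        ext r
        simp only [and_true, Set.mem_ofPred_eq, Set.mem_empty_iff_false, iff_false]
        exact fun hr => hr.ne (hsub r (hnbr t₀ ⟨hat₀, hbt₀⟩ hs r hr)).symm
      rw [this, Set.ncard_empty]
      exact Nat.zero_le _
    · exact fun _ r hr har hbr => hr.ne (hsub r ⟨har, hbr⟩).symm
  push Not at hsub
  obtain ⟨t₁, ht₁, hne₁⟩ := hsub
  by_cases hSs : IsSimplicialTriangle H S
  · obtain ⟨s, hs, -, s', hs', -, hss⟩ := hPc.cross {t | t = t₀} ⟨hat₀, hbt₀⟩ rfl ht₁ hne₁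
    exact ⟨s, s', Or.inr hss, hs.1, hs.2, hs'.1, hs'.2, Or.inl ⟨hss.ne, hSs⟩⟩
  have huniq : ∀ t ∈ P, ∀ t' ∈ P, ¬ IsSimplicialTriangle H (cyc t) →
      ¬ IsSimplicialTriangle H (cyc t') → t = t' := by
    intro t ht t' ht' hs hs'
    refine h.inj a b hab t t' ht.1 ht.2 ht'.1 ht'.2 ?_
    by_contra hcc
    have hsub3 : ({cyc t, cyc t', S} : Set (Set V)) ⊆ {S : Set V | IsChordlessCycle H S ∧ a ∈ S ∧
        b ∈ S ∧ ¬ IsSimplicialTriangle H S} := by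
      rintro _ (rfl | rfl | rfl)
      exacts [⟨h.chordless t, h.bag_cyc _ ht.1, h.bag_cyc _ ht.2, hs⟩,
        ⟨h.chordless t', h.bag_cyc _ ht'.1, h.bag_cyc _ ht'.2, hs'⟩, ⟨hS, haAS.2, hbAS.2, hSs⟩]
    have := Set.ncard_le_ncard hsub3
    rw [Set.ncard_eq_three.2 ⟨_, _, _, hcc, hne t, hne t', rfl⟩] at this
    omega
  obtain ⟨x, hx, hxall⟩ : ∃ x ∈ P, ∀ t ∈ P, t ≠ x → IsSimplicialTriangle H (cyc t) := by
    by_cases hall : ∀ t ∈ P, IsSimplicialTriangle H (cyc t)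
    · exact ⟨t₁, ht₁, fun t ht _ => hall t ht⟩
    · push Not at hall
      obtain ⟨x, hx, hxs⟩ := hall
      refine ⟨x, hx, fun t ht htx => ?_⟩
      by_contra hts
      exact htx (huniq t ht x hx hts hxs)
  obtain ⟨y, hy, hyx⟩ : ∃ y ∈ P, y ≠ x := by
    by_cases hxt : x = t₁
    · exact ⟨t₀, ⟨hat₀, hbt₀⟩, fun e => hne₁ (hxt ▸ e.symm)⟩
    · exact ⟨t₁, ht₁, Ne.symm hxt⟩
  obtain ⟨z, hz, hzx, hzc⟩ := exists_noncut hPc hx hy hyx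
  have hzs := hxall z hz hzx
  refine ⟨z, z, Or.inl rfl, hz.1, hz.2, hz.1, hz.2, Or.inr ⟨rfl, fun _ => ?_, absurd hzs⟩⟩
  refine (Set.ncard_le_ncard ?_).trans (h.tree.isAcyclic.ncard_adj_le_one hzc)
  exact fun r hr => ⟨hnbr z hz hzs r hr.1, hr.1⟩

/-- The state of the construction after the vertices `x 0, …, x i` of a cycle have been processed. -/
structure FanState (H : SimpleGraph V) (A : Set V) (n : ℕ) (x : ℕ → V) (i : ℕ)
    (T : SimpleGraph ι) (bag cyc : ι → Set V) (τ : ι) : Prop where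
  core : Core H (A ∪ x '' Set.Iic i) T bag cyc
  cyc_or : ∀ t, cyc t ⊆ A ∨ cyc t = x '' Set.Iio n
  covered : ∀ a ∈ A, ∀ b ∈ A, H.Adj a b → ∃ t, a ∈ bag t ∧ b ∈ bag t
  step : ∀ j < i, ∃ t, x j ∈ bag t ∧ x (j + 1) ∈ bag t
  zero_mem : x 0 ∈ bag τ
  last_mem : x i ∈ bag τ
  cyc_last : cyc τ = x '' Set.Iio n
  last_unique : ∀ t, x i ∈ bag t → t = τ

theorem FanState.next [Finite ι] [Finite V] {n i : ℕ} {x : ℕ → V} {τ : ι}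
    (h : FanState H A n x i T bag cyc τ) (hx : CycSeq H n x) (hA : ∀ j, 2 ≤ j → j < n → x j ∉ A)
    (hi : 2 ≤ i) (hin : i + 1 < n) :
    ∃ (T' : SimpleGraph (Option ι)) (bag' cyc' : Option ι → Set V) (τ' : Option ι),
      FanState H A n x (i + 1) T' bag' cyc' τ' := by
  have hSs : ¬ IsSimplicialTriangle H (x '' Set.Iio n) := by
    rintro ⟨-, h3, -⟩
    have hinj : Set.InjOn x (Set.Iio n) := fun j hj k hk e => hx.inj j hj k hk e
    rw [hinj.ncard_image] at h3
    simp at h3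
    omega
  have h0 : x 0 ≠ x i := fun e => by have := hx.inj 0 (by omega) i (by omega) e; omega
  have hw : x (i + 1) ∉ A ∪ x '' Set.Iic i := by
    rintro (hw | ⟨j, hj, hj'⟩)
    · exact hA (i + 1) (by omega) hin hw
    · have hj2 : j ≤ i := hj
      have := hx.inj j (by omega) (i + 1) hin hj'
      omega
  have hmem : ∀ j < n, x j ∈ x '' Set.Iio n := fun j hj => ⟨j, hj, rfl⟩
  have hcore := h.core.insert (s := τ) (s' := τ) (Or.inl rfl) h.zero_mem h.last_mem h.zero_mem
    h.last_mem h0 hw hx.isChordlessCycle (hmem 0 (by omega)) (hmem i (by omega)) (hmem _ hin)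
    (fun hadj => by rw [hx.adj 0 (by omega) i (by omega)] at hadj; omega)
    (fun hs => by rw [h.cyc_last, or_self] at hs; exact absurd hs hSs)
    (Or.inr ⟨rfl, fun hs => absurd (h.cyc_last ▸ hs) hSs,
      fun _ r hr _ hir => hr.ne (h.last_unique r hir).symm⟩)
  have hset : insert (x (i + 1)) (A ∪ x '' Set.Iic i) = A ∪ x '' Set.Iic (i + 1) := by
    have : Set.Iic (i + 1) = insert (i + 1) (Set.Iic i) := by
      ext j
      simp only [Set.mem_Iic, Set.mem_insert_iff]
      omega
    rw [this, Set.image_insert_eq, Set.union_insert]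
  rw [hset] at hcore
  refine ⟨_, _, _, none, hcore, ?_, ?_, ?_, ?_, ?_, rfl, ?_⟩
  · rintro (_ | t)
    exacts [Or.inr rfl, h.cyc_or t]
  · intro a ha b hb hab
    obtain ⟨t, ht⟩ := h.covered a ha b hb hab
    exact ⟨some t, ht⟩
  · intro j hj
    rcases Nat.lt_succ_iff_lt_or_eq.1 hj with hj | rfl
    · obtain ⟨t, ht⟩ := h.step j hj
      exact ⟨some t, ht⟩
    · exact ⟨none, by simp⟩
  · simp
  · simp
  · rintro (_ | t) ht
    exacts [rfl, absurd (h.core.bag_sub t ht) hw]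

/-- A `Core` on `A` that is a tree decomposition of the subgraph induced by `A`. -/
def HasCore (H : SimpleGraph V) (A : Set V) : Prop :=
  ∃ (ι : Type) (_ : Finite ι) (T : SimpleGraph ι) (bag cyc : ι → Set V),
    Core H A T bag cyc ∧ (∀ t, cyc t ⊆ A) ∧
    ∀ a ∈ A, ∀ b ∈ A, H.Adj a b → ∃ t, a ∈ bag t ∧ b ∈ bag t

theorem FanState.hasCore [Finite ι] [Finite V] {n i : ℕ} {x : ℕ → V} {τ : ι}
    (h : FanState H A n x i T bag cyc τ) (hx : CycSeq H n x) (hA : ∀ j, 2 ≤ j → j < n → x j ∉ A)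
    (hcross : ∀ u ∈ A, ∀ v ∈ x '' Set.Iio n, u ∉ x '' Set.Iio n → v ∉ A → ¬ H.Adj u v)
    (hi : 2 ≤ i) (hin : i < n) : HasCore H (A ∪ x '' Set.Iio n) := by
  obtain ⟨k, hk⟩ : ∃ k, n = i + 1 + k := ⟨n - (i + 1), by omega⟩
  induction k generalizing i ι with
  | succ k ih =>
    obtain ⟨T', bag', cyc', τ', h'⟩ := h.next hx hA hi (by omega)
    exact ih h' (by omega) (by omega) (by omega)
  | zero =>
    have hset : x '' Set.Iic i = x '' Set.Iio n := by
      congr 1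
      ext j
      simp only [Set.mem_Iic, Set.mem_Iio]
      omega
    have hcore := h.core
    rw [hset] at hcore
    refine ⟨ι, inferInstance, T, bag, cyc, hcore, fun t => ?_, ?_⟩
    · rcases h.cyc_or t with ht | ht
      · exact ht.trans Set.subset_union_left
      · exact ht ▸ Set.subset_union_right
    have hSS : ∀ u ∈ x '' Set.Iio n, ∀ v ∈ x '' Set.Iio n, H.Adj u v →
        ∃ t, u ∈ bag t ∧ v ∈ bag t := by
      rintro _ ⟨j, hj, rfl⟩ _ ⟨k, hk', rfl⟩ hadj
      have hj' : j < n := hj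
      have hk'' : k < n := hk'
      rw [hx.adj j hj k hk'] at hadj
      rcases hadj with rfl | rfl | ⟨rfl, hk2⟩ | ⟨rfl, hj2⟩
      · exact h.step j (by omega)
      · obtain ⟨t, h1, h2⟩ := h.step k (by omega)
        exact ⟨t, h2, h1⟩
      · obtain rfl : k = i := by omega
        exact ⟨τ, h.zero_mem, h.last_mem⟩
      · obtain rfl : j = i := by omega
        exact ⟨τ, h.last_mem, h.zero_mem⟩
    intro u hu v hv huv
    by_cases huS : u ∈ x '' Set.Iio n
    · by_cases hvS : v ∈ x '' Set.Iio n
      · exact hSS u huS v hvS huv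
      by_cases huA : u ∈ A
      · exact h.covered u huA v (hv.resolve_right hvS) huv
      · exact absurd huv.symm (hcross v (hv.resolve_right hvS) u huS hvS huA)
    · by_cases hvA : v ∈ A
      · exact h.covered u (hu.resolve_right huS) v hvA huv
      · exact absurd huv (hcross u (hu.resolve_right huS) v (hv.resolve_left hvA) huS hvA)

end Fan

section CoreConstruction

variable {V : Type} {H : SimpleGraph V}

theorem CycSeq.fanState_single [Finite V] {n : ℕ} {x : ℕ → V} (hx : CycSeq H n x) :
    FanState H ∅ n x 2 (⊥ : SimpleGraph Unit) (fun _ => {x 0, x 1, x 2})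
      (fun _ => x '' Set.Iio n) () := by
  have h3 := hx.three_le
  have hne : ∀ i < 3, ∀ j < 3, i ≠ j → x i ≠ x j := fun i hi j hj hij e =>
    hij (hx.inj i (by omega) j (by omega) e)
  have hset : (∅ : Set V) ∪ x '' Set.Iic 2 = {x 0, x 1, x 2} := by
    have : Set.Iic 2 = ({0, 1, 2} : Set ℕ) := by
      ext j
      simp only [Set.mem_Iic, Set.mem_insert_iff, Set.mem_singleton_iff]
      omega
    rw [this, Set.empty_union, Set.image_insert_eq, Set.image_insert_eq, Set.image_singleton]
  refine ⟨?_, fun _ => Or.inr rfl, fun a ha => ha.elim, ?_, by simp, by simp, rfl, fun _ _ => rfl⟩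
  · rw [hset]
    refine ⟨IsTree.of_subsingleton, fun _ => subset_rfl, fun v hv => ⟨(), hv⟩, fun v hv => ?_,
      fun _ => ?_, fun _ _ h => h.elim, fun _ => ?_, fun _ => hx.isChordlessCycle,
      fun _ _ _ _ _ _ _ _ _ _ => rfl, fun _ _ _ _ _ _ _ => ?_, fun _ _ => ?_,
      fun _ _ _ _ _ _ _ => rfl⟩
    · convert ConnSet.singleton ()
      ext
      simpa using hv
    · exact Set.ncard_eq_three.2 ⟨_, _, _, hne 0 (by omega) 1 (by omega) (by omega),
        hne 0 (by omega) 2 (by omega) (by omega), hne 1 (by omega) 2 (by omega) (by omega), rfl⟩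
    · rintro v (rfl | rfl | rfl)
      exacts [⟨0, by simp; omega, rfl⟩, ⟨1, by simp; omega, rfl⟩, ⟨2, by simp; omega, rfl⟩]
    · simp
    · simp
  · intro j hj
    interval_cases j <;> exact ⟨(), by simp⟩

theorem CycleTree.hasCore [Finite V] {A : Set V} (hA : CycleTree H A)
    (hchain : ∀ u v : V, H.Adj u v →
      {S : Set V | IsChordlessCycle H S ∧ u ∈ S ∧ v ∈ S ∧ ¬ IsSimplicialTriangle H S}.ncard ≤ 2) :
    HasCore H A := by
  induction hA with
  | @cycle S hS =>
    obtain ⟨a, ha⟩ : S.Nonempty := by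
      obtain ⟨n, hn, ⟨e⟩⟩ := hS
      exact ⟨_, (e.symm 0).2⟩
    obtain ⟨n, x, hx, rfl, -⟩ := hS.exists_cycSeq ha
    have := hx.fanState_single.hasCore hx (fun _ _ _ h => h) (fun _ h => h.elim) le_rfl hx.three_le
    rwa [Set.empty_union] at this
  | @glue A S a b hA hS hab hAS hcross ih =>
    obtain ⟨ι, _, T, bag, cyc, hcore, hcyc, hcov⟩ := ih
    have haAS : a ∈ A ∩ S := hAS ▸ Or.inl rfl
    have hbAS : b ∈ A ∩ S := hAS ▸ Or.inr rfl
    have habt := hcov a haAS.1 b hbAS.1 hab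
    obtain ⟨hne, ha, hb, s, s', hss, has, hbs, has', hbs', hdeg⟩ :=
      hcore.exists_insert_position hcyc hS hab habt hAS hcross (hchain a b hab)
    obtain ⟨n, x, hx, rfl, rfl, rfl⟩ := hS.exists_cycSeq_of_adj haAS.2 hbAS.2 hab
    have h3 := hx.three_le
    have hxA : ∀ j, 2 ≤ j → j < n → x j ∉ A := by
      intro j hj hjn hjA
      have hjAS : x j ∈ A ∩ x '' Set.Iio n := ⟨hjA, j, hjn, rfl⟩
      rw [hAS] at hjAS
      rcases hjAS with e | e
      · have := hx.inj _ hjn 0 (by omega) e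
        omega
      · have := hx.inj _ hjn 1 (by omega) e
        omega
    have hw := hxA 2 le_rfl (by omega)
    have hins := hcore.insert hss has hbs has' hbs' hab.ne hw hS haAS.2 hbAS.2 ⟨2, by simp; omega, rfl⟩
      (fun _ t ht _ _ => hne t ht) (fun _ => ⟨ha, hb⟩) hdeg
    have hset : insert (x 2) A = A ∪ x '' Set.Iic 2 := by
      have : Set.Iic 2 = ({0, 1, 2} : Set ℕ) := by
        ext j
        simp only [Set.mem_Iic, Set.mem_insert_iff, Set.mem_singleton_iff]
        omega
      rw [this, Set.image_insert_eq, Set.image_insert_eq, Set.image_singleton, Set.union_insert,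
        Set.union_insert, Set.union_singleton, Set.insert_comm (x 1), Set.insert_comm (x 0),
        Set.insert_eq_of_mem hbAS.1, Set.insert_eq_of_mem haAS.1]
    rw [hset] at hins
    refine FanState.hasCore (τ := none) ⟨hins, ?_, ?_, ?_, by simp, by simp, rfl, ?_⟩ hx hxA hcross
      le_rfl (by omega)
    · rintro (_ | t)
      exacts [Or.inr rfl, Or.inl (hcyc t)]
    · intro u hu v hv huv
      obtain ⟨t, ht⟩ := hcov u hu v hv huv
      exact ⟨some t, ht⟩
    · intro j hj
      interval_cases j <;> exact ⟨none, by simp⟩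
    · rintro (_ | t) ht
      exacts [rfl, absurd (hcore.bag_sub t ht) hw]

end CoreConstruction

section Spaghetti

variable {V : Type} {G H : SimpleGraph V} {A B : Set V}

/-- The subgraph of `G` induced by `A` has a spaghetti tree decomposition of width at most two. -/
def HasSpaghetti (G : SimpleGraph V) (A : Set V) : Prop :=
  ∃ (ι : Type) (_ : Finite ι) (T : SimpleGraph ι) (bag : ι → Set V), T.IsTree ∧
    (∀ t, bag t ⊆ A) ∧ (∀ t, (bag t).ncard ≤ 3) ∧ (∀ v ∈ A, ConnSet T {t | v ∈ bag t}) ∧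
    (∀ v, ∀ t, v ∈ bag t → {s | v ∈ bag s ∧ T.Adj t s}.ncard ≤ 2) ∧
    ∀ a ∈ A, ∀ b ∈ A, G.Adj a b → ∃ t, a ∈ bag t ∧ b ∈ bag t

theorem HasSpaghetti.mono [Finite V] (h : HasSpaghetti G B) (hAB : A ⊆ B) : HasSpaghetti G A := by
  obtain ⟨ι, hι, T, bag, hT, -, hcard, hconn, hdeg, hcov⟩ := h
  refine ⟨ι, hι, T, fun t => bag t ∩ A, hT, fun t => Set.inter_subset_right, fun t =>
    (Set.ncard_le_ncard Set.inter_subset_left).trans (hcard t), fun v hv => ?_, fun v t ht => ?_,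
    fun a ha b hb hab => ?_⟩
  · convert hconn v (hAB hv) using 1
    ext t
    exact and_iff_left hv
  · refine (Set.ncard_le_ncard ?_).trans (hdeg v t ht.1)
    exact fun s hs => ⟨hs.1.1, hs.2⟩
  · obtain ⟨t, h1, h2⟩ := hcov a (hAB ha) b (hAB hb) hab
    exact ⟨t, ⟨h1, ha⟩, h2, hb⟩

theorem hasSpaghetti_of_ncard_le [Finite V] (hA : A.ncard ≤ 3) : HasSpaghetti G A := by
  refine ⟨Unit, inferInstance, ⊥, fun _ => A, IsTree.of_subsingleton, fun _ => subset_rfl,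
    fun _ => hA, fun v hv => ?_, fun v t _ => by simp, fun a ha b hb _ => ⟨(), ha, hb⟩⟩
  convert ConnSet.singleton ()
  ext
  simpa using hv

theorem Core.ncard_le_two {ι : Type} [Finite ι] [Finite V] {T : SimpleGraph ι}
    {bag cyc : ι → Set V} (h : Core H A T bag cyc) {v : V} {t : ι} (hv : v ∈ bag t) :
    {s | v ∈ bag s ∧ T.Adj t s}.ncard ≤ 2 := by
  by_cases hs : IsSimplicialTriangle H (cyc t)
  · refine (Set.ncard_le_ncard ?_).trans (h.simp_degree t hs)
    exact fun s hs => ⟨hs.2, trivial⟩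
  have h2 : (bag t \ {v}).ncard = 2 := by
    rw [Set.ncard_sdiff_singleton_of_mem hv, h.card t]
  obtain ⟨p, q, hpq, hpqv⟩ := Set.ncard_eq_two.1 h2
  have hp : p ∈ bag t \ {v} := hpqv ▸ Or.inl rfl
  have hq : q ∈ bag t \ {v} := hpqv ▸ Or.inr rfl
  have hsub : {s | v ∈ bag s ∧ T.Adj t s} ⊆ {s | T.Adj t s ∧ (v ∈ bag s ∧ p ∈ bag s)} ∪
      {s | T.Adj t s ∧ (v ∈ bag s ∧ q ∈ bag s)} := by
    rintro s ⟨hvs, hts⟩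
    obtain ⟨r, ⟨hrt, hrs⟩, hrv⟩ : ∃ r ∈ bag t ∩ bag s, r ≠ v := by
      have := h.adj_card t s hts
      exact Set.exists_ne_of_one_lt_ncard (by omega) v
    have hr : r ∈ bag t \ {v} := ⟨hrt, hrv⟩
    rw [hpqv] at hr
    rcases hr with rfl | rfl
    exacts [Or.inl ⟨hts, hvs, hrs⟩, Or.inr ⟨hts, hvs, hrs⟩]
  have h3 := h.nonsimp t hs v hv p hp.1 (Ne.symm hp.2)
  have h4 := h.nonsimp t hs v hv q hq.1 (Ne.symm hq.2)
  have h5 := Set.ncard_le_ncard hsub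
  have h6 := Set.ncard_union_le {s | T.Adj t s ∧ (v ∈ bag s ∧ p ∈ bag s)}
    {s | T.Adj t s ∧ (v ∈ bag s ∧ q ∈ bag s)}
  omega

theorem HasCore.hasSpaghetti [Finite V] (h : HasCore H A) : HasSpaghetti H A := by
  obtain ⟨ι, hι, T, bag, cyc, hcore, -, hcov⟩ := h
  exact ⟨ι, hι, T, bag, hcore.tree, hcore.bag_sub, fun t => (hcore.card t).le, hcore.conn,
    fun v t ht => hcore.ncard_le_two ht, hcov⟩

/-- The disjoint union of two graphs with an additional edge from `t` to `u`. -/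
def joinEdge {ι κ : Type} (T : SimpleGraph ι) (U : SimpleGraph κ) (t : ι) (u : κ) :
    SimpleGraph (ι ⊕ κ) where
  Adj p q := match p, q with
    | Sum.inl x, Sum.inl y => T.Adj x y
    | Sum.inl x, Sum.inr y => x = t ∧ y = u
    | Sum.inr x, Sum.inl y => x = u ∧ y = t
    | Sum.inr x, Sum.inr y => U.Adj x y
  symm := ⟨by
    rintro (x | x) (y | y) h
    · exact T.adj_symm h
    · exact ⟨h.2, h.1⟩
    · exact ⟨h.2, h.1⟩
    · exact U.adj_symm h⟩
  loopless := ⟨by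
    rintro (x | x) h
    · exact T.loopless.irrefl x h
    · exact U.loopless.irrefl x h⟩

section joinEdge

variable {ι κ : Type} {T : SimpleGraph ι} {U : SimpleGraph κ} {t : ι} {u : κ}

theorem joinEdge_conn_inl {P : Set ι} (hP : ConnSet T P) :
    ConnSet (joinEdge T U t u) (Sum.inl '' P) :=
  hP.map Sum.inl fun _ _ _ _ h _ => h

theorem joinEdge_conn_inr {Q : Set κ} (hQ : ConnSet U Q) :
    ConnSet (joinEdge T U t u) (Sum.inr '' Q) :=
  hQ.map Sum.inr fun _ _ _ _ h _ => h

theorem joinEdge_conn_union {P : Set ι} {Q : Set κ} (hP : ConnSet T P) (hQ : ConnSet U Q)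
    (ht : t ∈ P) (hu : u ∈ Q) : ConnSet (joinEdge T U t u) (Sum.inl '' P ∪ Sum.inr '' Q) :=
  (joinEdge_conn_inl hP).union_of_adj (joinEdge_conn_inr hQ) ⟨t, ht, rfl⟩ ⟨u, hu, rfl⟩ ⟨rfl, rfl⟩

theorem joinEdge_isTree (hT : T.IsTree) (hU : U.IsTree) : (joinEdge T U t u).IsTree := by
  refine isTree_of_cuts ?_ ?_
  · convert joinEdge_conn_union (ConnSet.univ_iff.2 hT.connected) (ConnSet.univ_iff.2 hU.connected)
      (Set.mem_univ t) (Set.mem_univ u) using 1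
    ext (x | x) <;> simp
  rintro (x | x) (y | y) hxy
  · obtain ⟨L, hx, hy, hL⟩ := hT.isAcyclic.exists_cut (show T.Adj x y from hxy)
    refine ⟨{p | p.elim (· ∈ L) (fun _ => t ∈ L)}, hx, hy, ?_⟩
    rintro (p | p) hp (q | q) hq hpq
    · obtain ⟨rfl, rfl⟩ := hL p hp q hq hpq
      exact ⟨rfl, rfl⟩
    · exact absurd (hpq.1 ▸ hp) hq
    · exact absurd (hpq.2 ▸ hp) hq
    · exact absurd hp hq
  · refine ⟨Set.range Sum.inl, ⟨x, rfl⟩, by simp, ?_⟩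
    rintro _ ⟨p, rfl⟩ (q | q) hq hpq
    · exact absurd ⟨q, rfl⟩ hq
    · exact ⟨by rw [hpq.1, hxy.1], by rw [hpq.2, hxy.2]⟩
  · refine ⟨Set.range Sum.inr, ⟨x, rfl⟩, by simp, ?_⟩
    rintro _ ⟨p, rfl⟩ (q | q) hq hpq
    · exact ⟨by rw [hpq.1, hxy.1], by rw [hpq.2, hxy.2]⟩
    · exact absurd ⟨q, rfl⟩ hq
  · obtain ⟨L, hx, hy, hL⟩ := hU.isAcyclic.exists_cut (show U.Adj x y from hxy)
    refine ⟨{p | p.elim (fun _ => u ∈ L) (· ∈ L)}, hx, hy, ?_⟩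
    rintro (p | p) hp (q | q) hq hpq
    · exact absurd hp hq
    · exact absurd (hpq.2 ▸ hp) hq
    · exact absurd (hpq.1 ▸ hp) hq
    · obtain ⟨rfl, rfl⟩ := hL p hp q hq hpq
      exact ⟨rfl, rfl⟩

theorem joinEdge_degree_inl [Finite ι] [Finite κ] {P : ι → Prop} {Q : κ → Prop} (x : ι)
    (h : {y | P y ∧ T.Adj x y}.ncard ≤ 2) (ht : Q u → {y | P y ∧ T.Adj t y}.ncard ≤ 1) :
    {q | Sum.elim P Q q ∧ (joinEdge T U t u).Adj (Sum.inl x) q}.ncard ≤ 2 := by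
  by_cases hxt : x = t ∧ Q u
  · obtain ⟨rfl, hQ⟩ := hxt
    have hsub : {q | Sum.elim P Q q ∧ (joinEdge T U x u).Adj (Sum.inl x) q} ⊆
        insert (Sum.inr u) (Sum.inl '' {y | P y ∧ T.Adj x y}) := by
      rintro (y | y) ⟨h1, h2⟩
      exacts [Or.inr ⟨y, ⟨h1, h2⟩, rfl⟩, Or.inl (congrArg _ h2.2)]
    refine (Set.ncard_le_ncard hsub).trans ((Set.ncard_insert_le _ _).trans ?_)
    rw [Set.ncard_image_of_injective _ Sum.inl_injective]
    exact Nat.succ_le_succ (ht hQ)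
  · have hsub : {q | Sum.elim P Q q ∧ (joinEdge T U t u).Adj (Sum.inl x) q} ⊆
        Sum.inl '' {y | P y ∧ T.Adj x y} := by
      rintro (y | y) ⟨h1, h2⟩
      exacts [⟨y, ⟨h1, h2⟩, rfl⟩, absurd ⟨h2.1, h2.2 ▸ h1⟩ hxt]
    refine (Set.ncard_le_ncard hsub).trans ?_
    rwa [Set.ncard_image_of_injective _ Sum.inl_injective]

theorem joinEdge_degree_inr [Finite ι] [Finite κ] {P : ι → Prop} {Q : κ → Prop} (x : κ)
    (h : {y | Q y ∧ U.Adj x y}.ncard ≤ 2) (hu : P t → {y | Q y ∧ U.Adj u y}.ncard ≤ 1) :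
    {q | Sum.elim P Q q ∧ (joinEdge T U t u).Adj (Sum.inr x) q}.ncard ≤ 2 := by
  have := joinEdge_degree_inl (T := U) (U := T) (t := u) (u := t) x h hu
  refine (Set.ncard_le_ncard_of_injOn Sum.swap ?_ Sum.swap_leftInverse.injective.injOn
    (Set.toFinite _)).trans this
  rintro (y | y) hy <;> exact hy

end joinEdge

theorem HasSpaghetti.union [Finite V] (hA : HasSpaghetti G A) (hB : HasSpaghetti G B)
    (hsub : (A ∩ B).Subsingleton) (hcross : ∀ a ∈ A, ∀ b ∈ B, a ∉ B → b ∉ A → ¬ G.Adj a b) :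
    HasSpaghetti G (A ∪ B) := by
  obtain ⟨ι, hι, T, bag, hT, hbA, hcard, hconn, hdeg, hcov⟩ := hA
  obtain ⟨κ, hκ, U, bag', hU, hbB, hcard', hconn', hdeg', hcov'⟩ := hB
  obtain ⟨t, u, htu⟩ : ∃ t u, ∀ v ∈ A ∩ B, v ∈ bag t ∧ v ∈ bag' u ∧
      {s | v ∈ bag s ∧ T.Adj t s}.ncard ≤ 1 ∧ {s | v ∈ bag' s ∧ U.Adj u s}.ncard ≤ 1 := by
    obtain hemp | ⟨c, hc⟩ := (A ∩ B).eq_empty_or_nonempty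
    · obtain ⟨t⟩ := hT.connected.nonempty
      obtain ⟨u⟩ := hU.connected.nonempty
      exact ⟨t, u, fun v hv => (hemp ▸ hv : v ∈ (∅ : Set V)).elim⟩
    · obtain ⟨t, h1, h2⟩ := hT.isAcyclic.exists_ncard_adj_le_one (hconn c hc.1)
      obtain ⟨u, h3, h4⟩ := hU.isAcyclic.exists_ncard_adj_le_one (hconn' c hc.2)
      refine ⟨t, u, fun v hv => ?_⟩
      obtain rfl := hsub hc hv
      exact ⟨h1, h3, h2, h4⟩
  have hset : ∀ v, {p | v ∈ Sum.elim bag bag' p} =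
      Sum.inl '' {t | v ∈ bag t} ∪ Sum.inr '' {t | v ∈ bag' t} := by
    intro v
    ext (p | p) <;> simp
  have hempA : ∀ v, v ∉ A → {t | v ∈ bag t} = ∅ := fun v hv =>
    Set.eq_empty_of_forall_notMem fun s hs => hv (hbA s hs)
  have hempB : ∀ v, v ∉ B → {t | v ∈ bag' t} = ∅ := fun v hv =>
    Set.eq_empty_of_forall_notMem fun s hs => hv (hbB s hs)
  have helim : ∀ v, (fun p => v ∈ Sum.elim bag bag' p) =
      Sum.elim (fun s => v ∈ bag s) (fun s => v ∈ bag' s) := by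
    intro v
    ext (p | p) <;> rfl
  refine ⟨ι ⊕ κ, inferInstance, joinEdge T U t u, Sum.elim bag bag', joinEdge_isTree hT hU,
    ?_, ?_, ?_, ?_, ?_⟩
  · rintro (p | p)
    exacts [(hbA p).trans Set.subset_union_left, (hbB p).trans Set.subset_union_right]
  · rintro (p | p)
    exacts [hcard p, hcard' p]
  · intro v hv
    rw [hset]
    by_cases hvA : v ∈ A
    · by_cases hvB : v ∈ B
      · obtain ⟨h1, h2, -⟩ := htu v ⟨hvA, hvB⟩
        exact joinEdge_conn_union (hconn v hvA) (hconn' v hvB) h1 h2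
      · rw [hempB v hvB, Set.image_empty, Set.union_empty]
        exact joinEdge_conn_inl (hconn v hvA)
    · rw [hempA v hvA, Set.image_empty, Set.empty_union]
      exact joinEdge_conn_inr (hconn' v (hv.resolve_left hvA))
  · intro v p hp
    have hsum := helim v
    have hrw : {s | v ∈ Sum.elim bag bag' s ∧ (joinEdge T U t u).Adj p s} =
        {s | Sum.elim (fun s => v ∈ bag s) (fun s => v ∈ bag' s) s ∧
          (joinEdge T U t u).Adj p s} := by
      rw [← hsum]
    rw [hrw]
    rcases p with p | p
    · refine joinEdge_degree_inl p (hdeg v p hp) fun hu => ?_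
      exact (htu v ⟨hbA p hp, hbB u hu⟩).2.2.1
    · refine joinEdge_degree_inr p (hdeg' v p hp) fun ht => ?_
      exact (htu v ⟨hbA t ht, hbB p hp⟩).2.2.2
  · have hl : ∀ a ∈ A, ∀ b ∈ A, G.Adj a b →
        ∃ p, a ∈ Sum.elim bag bag' p ∧ b ∈ Sum.elim bag bag' p := by
      intro a ha b hb hab
      obtain ⟨s, hs⟩ := hcov a ha b hb hab
      exact ⟨Sum.inl s, hs⟩
    have hr : ∀ a ∈ B, ∀ b ∈ B, G.Adj a b →
        ∃ p, a ∈ Sum.elim bag bag' p ∧ b ∈ Sum.elim bag bag' p := by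
      intro a ha b hb hab
      obtain ⟨s, hs⟩ := hcov' a ha b hb hab
      exact ⟨Sum.inr s, hs⟩
    intro a ha b hb hab
    by_cases h1 : a ∈ A ∧ b ∈ A
    · exact hl a h1.1 b h1.2 hab
    by_cases h2 : a ∈ B ∧ b ∈ B
    · exact hr a h2.1 b h2.2 hab
    rcases ha with ha | ha
    · have hbB' := hb.resolve_left fun h => h1 ⟨ha, h⟩
      exact absurd hab (hcross a ha b hbB' (fun h => h2 ⟨h, hbB'⟩) fun h => h1 ⟨ha, h⟩)
    · have hbA' := hb.resolve_right fun h => h2 ⟨ha, h⟩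
      exact absurd hab.symm (hcross b hbA' a ha (fun h => h2 ⟨ha, h⟩) fun h => h1 ⟨h, hbA'⟩)

theorem hasSpaghetti_of_noCutVertex [Finite V] (A : Set V)
    (h : ∀ S ⊆ A, ConnSet G S → NoCutVertex G S → HasSpaghetti G S) : HasSpaghetti G A := by
  induction hn : A.ncard using Nat.strong_induction_on generalizing A with
  | _ n ih =>
    subst hn
    have hsplit : ∀ C ⊆ A, C.Subsingleton → (A \ C).Nonempty → ¬ ConnSet G (A \ C) →
        HasSpaghetti G A := by
      intro C hCA hC hne hnc
      simp only [ConnSet, hne, true_and] at hnc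
      push Not at hnc
      obtain ⟨B, ⟨x, hx, hxB⟩, ⟨y, hy, hyB⟩, hB⟩ := hnc
      have hlt : ∀ X ⊆ A, ∀ z ∈ A, z ∉ X → HasSpaghetti G X := fun X hX z hz hzX =>
        ih _ (Set.ncard_lt_ncard ⟨hX, fun hAX => hzX (hAX hz)⟩) X
          (fun S hS => h S (hS.trans hX)) rfl
      have h1 := hlt (A ∩ B ∪ C) (Set.union_subset Set.inter_subset_left hCA) y hy.1
        (by rintro (h | h); exacts [hyB h.2, hy.2 h])
      have h2 := hlt (A \ B ∪ C) (Set.union_subset Set.sdiff_subset hCA) x hx.1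
        (by rintro (h | h); exacts [h.2 hxB, hx.2 h])
      convert h1.union h2 ?_ ?_ using 1
      · ext z
        have := @hCA z
        simp only [Set.mem_union, Set.mem_inter_iff, Set.mem_sdiff]
        tauto
      · refine hC.anti ?_
        rintro z ⟨h3 | h3, h4 | h4⟩
        exacts [absurd h3.2 h4.2, h4, h3, h3]
      · intro a ha b hb haB hbB hab
        have ha' : a ∉ C := fun h => haB (Or.inr h)
        have hb' : b ∉ C := fun h => hbB (Or.inr h)
        have ha2 := ha.resolve_right ha'
        have hb2 := hb.resolve_right hb'
        exact hB a ⟨ha2.1, ha'⟩ ha2.2 b ⟨hb2.1, hb'⟩ hb2.2 hab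
    obtain rfl | hA := A.eq_empty_or_nonempty
    · exact hasSpaghetti_of_ncard_le (by simp)
    by_cases hc : ConnSet G A
    · by_cases hcut : NoCutVertex G A
      · exact h A subset_rfl hc hcut
      · simp only [NoCutVertex] at hcut
        push Not at hcut
        obtain ⟨v, hv, hne, hnc⟩ := hcut
        exact hsplit {v} (by simpa using hv) Set.subsingleton_singleton hne
          (by rwa [ConnSet.iff_induce])
    · exact hsplit ∅ (Set.empty_subset _) Set.subsingleton_empty (by simpa using hA)
        (by simpa using hc)

theorem HasSpaghetti.image {W : Type} [Finite W] [Finite V] {G' : SimpleGraph W} {B : Set W}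
    (h : HasSpaghetti G' B) (f : W → V) (hf : Function.Injective f)
    (hG : ∀ x y, G.Adj (f x) (f y) → G'.Adj x y) : HasSpaghetti G (f '' B) := by
  obtain ⟨ι, hι, T, bag, hT, hbB, hcard, hconn, hdeg, hcov⟩ := h
  have hmem : ∀ x t, f x ∈ f '' bag t ↔ x ∈ bag t := fun x t => hf.mem_set_image
  refine ⟨ι, hι, T, fun t => f '' bag t, hT, fun t => Set.image_mono (hbB t),
    fun t => (Set.ncard_image_le).trans (hcard t), ?_, ?_, ?_⟩
  · rintro _ ⟨x, hx, rfl⟩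
    simpa only [hmem] using hconn x hx
  · rintro _ t ⟨x, hx, rfl⟩
    simpa only [hmem] using hdeg x t hx
  · rintro _ ⟨x, hx, rfl⟩ _ ⟨y, hy, rfl⟩ hxy
    simpa only [hmem] using hcov x hx y hy (hG x y hxy)

theorem HasSpaghetti.sptw_le (h : HasSpaghetti G Set.univ) : sptw G ≤ 2 := by
  obtain ⟨ι, hι, T, bag, hT, -, hcard, hconn, hdeg, hcov⟩ := h
  have hc := fun v => ConnSet.iff_induce.1 (hconn v trivial)
  exact Nat.sInf_le ⟨⟨⟨ι, hι, T, hT, bag, fun v => (hconn v trivial).1,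
    fun u v huv => hcov u trivial v trivial huv, hc⟩, fun v => ⟨hc v, fun t ht => hdeg v t ht⟩⟩, hcard⟩

theorem exists_isBlock_superset [Finite V] {S : Set V} (hS : ConnSet G S) (hcut : NoCutVertex G S) :
    ∃ B, S ⊆ B ∧ IsBlock G B := by
  obtain ⟨B, hSB, hB⟩ := (Set.toFinite {B : Set V | ConnSet G B ∧ NoCutVertex G B}).exists_le_maximal
    (show S ∈ _ from ⟨hS, hcut⟩)
  refine ⟨B, hSB, hB.prop.1.1, ConnSet.iff_induce.1 hB.prop.1, hB.prop.2, fun S' hBS hc hn => ?_⟩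
  exact (hB.eq_of_le ⟨ConnSet.iff_induce.2 hc, hn⟩ hBS).symm

theorem sptw_le_of_blocks [Finite V] (h : ∀ S : Set V, IsBlock G S →
    (TwoConnected (G.induce S) ∧ IsChainTreeOfCycles (cellCompletion (G.induce S))) ∨
    (∃ a b : V, a ≠ b ∧ S = {a, b} ∧ G.Adj a b) ∨ (∃ a : V, S = {a})) : sptw G ≤ 2 := by
  refine (hasSpaghetti_of_noCutVertex Set.univ fun S _ hS hcut => ?_).sptw_le
  obtain ⟨B, hSB, hB⟩ := exists_isBlock_superset hS hcut
  refine HasSpaghetti.mono ?_ hSB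
  rcases h B hB with ⟨-, htoc, hchain⟩ | ⟨a, b, hab, rfl, -⟩ | ⟨a, rfl⟩
  · have := (htoc.cycleTree.hasCore hchain).hasSpaghetti.image (G := G) Subtype.val
      Subtype.val_injective fun x y hxy => ?_
    · simpa using this
    · exact (fromRel_adj _ _ _).2 ⟨fun e => hxy.ne (congrArg _ e), Or.inl (Or.inl hxy)⟩
  · exact hasSpaghetti_of_ncard_le (by rw [Set.ncard_pair hab]; omega)
  · exact hasSpaghetti_of_ncard_le (by rw [Set.ncard_singleton]; omega)

end Spaghetti

/-- For every finite simple graph `G`, TFAE: (1) `G` has spaghetti treewidth at most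
two; (2) every block of `G` is a 2-connected subgraph whose cell completion is a
chain tree of cycles, a single edge, or an isolated vertex; (3) `G` has no minor
isomorphic to `K₄` or `D₃`. -/
theorem statement0 {V : Type} [Fintype V] (G : SimpleGraph V) :
    List.TFAE
      [sptw G ≤ 2,
       ∀ S : Set V, IsBlock G S →
         (TwoConnected (G.induce S) ∧ IsChainTreeOfCycles (cellCompletion (G.induce S))) ∨
           (∃ a b : V, a ≠ b ∧ S = {a, b} ∧ G.Adj a b) ∨ (∃ a : V, S = {a}),
       ¬ IsMinorOf K4 G ∧ ¬ IsMinorOf D3 G] := by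
  tfae_have 1 → 3 := not_isMinorOf_of_sptw_le
  tfae_have 3 → 2 := fun h S hS => block_of_not_minor h.1 h.2 hS
  tfae_have 2 → 1 := sptw_le_of_blocks
  tfae_finish
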